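/- Let c > 0 be a real number. The sequence (ω(n)^c)_{n∈ℕ} is uniformly distributed mod 1 if and only if c > 1/2 and c is not an integer. -/

import Mathlib

open Filter Finset

/-- Discrete derivative: `ΔW(N) = W(N) - W(N-1)` for `N ≥ 2`, and `ΔW(1) = W(1)`. -/
noncomputable def dd (W : ℕ → ℝ) (N : ℕ) : ℝ := if 2 ≤ N then W N - W (N - 1) else W 1

/-- Weighted average `E^W_{n ≤ N} f(n) = (1/W(N)) ∑_{n=1}^N ΔW(n) f(n)`. -/
noncomputable def wAvg (W : ℕ → ℝ) (f : ℕ → ℂ) (N : ℕ) : ℂ :=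
  (1 / (W N : ℂ)) * ∑ n ∈ Finset.Icc 1 N, (dd W n : ℂ) * f n

/-- Cesàro average `E_{n ≤ N} f(n) = (1/N) ∑_{n=1}^N f(n)`. -/
noncomputable def cesaro (f : ℕ → ℂ) (N : ℕ) : ℂ :=
  (1 / (N : ℂ)) * ∑ n ∈ Finset.Icc 1 N, f n

/-- Parity-neutral binomial mean. -/
noncomputable def e2bin (f : ℕ → ℂ) (N : ℕ) : ℂ :=
  (1 / 2 ^ (N + 1) : ℂ) * ∑ n ∈ Finset.Icc 1 (2 * N), (Nat.choose N (n / 2) : ℂ) * f n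

/-- Binomial mean. -/
noncomputable def ebin (f : ℕ → ℂ) (N : ℕ) : ℂ :=
  (1 / 2 ^ N : ℂ) * ∑ n ∈ Finset.Icc 1 N, (Nat.choose N n : ℂ) * f n

/-- The class 𝒲: eventually non-decreasing nonnegative functions tending to ∞. -/
def memW (W : ℕ → ℝ) : Prop :=
  (∀ n, 0 ≤ W n) ∧ (∃ N₀ : ℕ, ∀ m n : ℕ, N₀ ≤ m → m ≤ n → W m ≤ W n) ∧
    Tendsto W atTop atTop

/-- The class 𝒲*: members of 𝒲 for which `N·Δ²W(N)/ΔW(N)` converges in `ℝ ∪ {±∞}`. -/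
def memWstar (W : ℕ → ℝ) : Prop :=
  memW W ∧ ∃ l : EReal,
    Tendsto (fun N : ℕ => (((N : ℝ) * dd (dd W) N / dd W N : ℝ) : EReal)) atTop (nhds l)

/-- The class ℒ: members of 𝒲 (with values in ℕ) whose discrete derivative is
eventually in {0,1}. -/
def memL (L : ℕ → ℕ) : Prop :=
  memW (fun n => (L n : ℝ)) ∧
    ∃ N₀ : ℕ, ∀ n : ℕ, N₀ ≤ n → L n = L (n - 1) ∨ L n = L (n - 1) + 1

/-- Gaussian probability density with mean μ and standard deviation σ. -/
noncomputable def gauss (x μ σ : ℝ) : ℝ :=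
  (1 / (σ * Real.sqrt (2 * Real.pi))) * Real.exp (-(x - μ) ^ 2 / (2 * σ ^ 2))

/-- The Gaussian condition \eqref{gaussian_condition}. -/
def gaussCond (ϑ : ℕ → ℕ) (L : ℕ → ℕ) : Prop :=
  Tendsto (fun N : ℕ => ∑' k : ℕ,
      |(((Finset.Icc 1 N).filter (fun n => ϑ n = k + 1)).card : ℝ) / N -
        gauss (k + 1 : ℝ) (L N) (Real.sqrt (L N))|) atTop (nhds 0)

/-- Ω(n): number of prime factors with multiplicity. -/
def bigOmega (n : ℕ) : ℕ := n.primeFactorsList.length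

/-- ω(n): number of distinct prime factors. -/
def smallOmega (n : ℕ) : ℕ := n.primeFactors.card

/-- Uniform distribution mod 1. -/
def udMod1 (x : ℕ → ℝ) : Prop :=
  ∀ a b : ℝ, 0 ≤ a → a < b → b ≤ 1 →
    Tendsto (fun N : ℕ =>
        (((Finset.Icc 1 N).filter
            (fun n => a ≤ Int.fract (x n) ∧ Int.fract (x n) < b)).card : ℝ) / N)
      atTop (nhds (b - a))

open MeasureTheory

/-- The standard additive character `x ↦ exp (2πix)` of `ℝ`. -/
noncomputable def expChar (x : ℝ) : ℂ := Complex.exp (Complex.I * ((2 * Real.pi * x : ℝ) : ℂ))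

lemma norm_expChar (x : ℝ) : ‖expChar x‖ = 1 := by
  rw [expChar, mul_comm]; exact Complex.norm_exp_ofReal_mul_I _

lemma expChar_add (x y : ℝ) : expChar (x + y) = expChar x * expChar y := by
  rw [expChar, expChar, expChar, ← Complex.exp_add]; congr 1; push_cast; ring

lemma expChar_zero : expChar 0 = 1 := by simp [expChar]

lemma conj_expChar (x : ℝ) : (starRingEnd ℂ) (expChar x) = expChar (-x) := by
  rw [expChar, expChar, ← Complex.exp_conj, map_mul, Complex.conj_I,
    Complex.conj_ofReal]
  congr 1; push_cast; ring

lemma expChar_nat_mul (n : ℕ) (x : ℝ) : expChar (n * x) = expChar x ^ n := by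
  rw [expChar, expChar, ← Complex.exp_nat_mul]; congr 1; push_cast; ring

lemma norm_expChar_sub_one_le (x : ℝ) : ‖expChar x - 1‖ ≤ 2 * Real.pi * |x| := by
  have := Real.norm_exp_I_mul_ofReal_sub_one_le (x := 2 * Real.pi * x)
  rw [Real.norm_eq_abs, abs_mul, abs_of_pos Real.two_pi_pos] at this
  exact this

lemma norm_expChar_sub_le (x y : ℝ) : ‖expChar x - expChar y‖ ≤ 2 * Real.pi * |x - y| := by
  have h : expChar x - expChar y = expChar y * (expChar (x - y) - 1) := by
    rw [mul_sub, ← expChar_add]; simp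
  rw [h, norm_mul, norm_expChar, one_mul]
  exact norm_expChar_sub_one_le _

lemma four_mul_le_norm_expChar_sub_one {x : ℝ} (h0 : 0 ≤ x) (h1 : x ≤ 1 / 2) :
    4 * x ≤ ‖expChar x - 1‖ := by
  rw [expChar, Complex.norm_exp_I_mul_ofReal_sub_one, Real.norm_eq_abs]
  have h := Real.mul_le_sin (x := Real.pi * x) (by positivity) (by nlinarith [Real.pi_pos])
  have e : 2 / Real.pi * (Real.pi * x) = 2 * x := by field_simp
  have e2 : 2 * Real.pi * x / 2 = Real.pi * x := by ring
  rw [e2]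
  refine le_trans ?_ (le_abs_self _)
  linarith

/-- A sum whose consecutive blocks of length `B` are small is small. -/
lemma norm_sum_le_of_blocks (B : ℕ) (hB : 0 < B) (δ : ℝ) (hδ : 0 ≤ δ) (H : ℕ) :
    ∀ a : ℕ → ℂ, (∀ n, ‖a n‖ ≤ 1) →
    (∀ m, m + B ≤ H → ‖∑ n ∈ range B, a (m + n)‖ ≤ δ * B) →
    ‖∑ n ∈ range H, a n‖ ≤ δ * H + B := by
  induction H using Nat.strong_induction_on with
  | _ H ih =>
    intro a ha h
    by_cases hH : H < B
    · calc ‖∑ n ∈ range H, a n‖ ≤ ∑ n ∈ range H, (1 : ℝ) := norm_sum_le_of_le _ fun n _ => ha n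
        _ = H := by simp
        _ ≤ B := by exact_mod_cast hH.le
        _ ≤ δ * H + B := by nlinarith [mul_nonneg hδ (Nat.cast_nonneg (α := ℝ) H)]
    · obtain ⟨K, rfl⟩ := Nat.exists_eq_add_of_le (not_lt.mp hH)
      rw [sum_range_add]
      have h1 := h 0 (by omega)
      have h2 := ih K (by omega) (fun n => a (B + n)) (fun n => ha _) (fun m hm => by
        have := h (B + m) (by omega)
        simpa [add_assoc] using this)
      simp only [zero_add] at h1
      refine (norm_add_le _ _).trans ?_
      push_cast
      linarith

lemma norm_sum_expChar_linear_le {x : ℝ} (h0 : 0 < x) (h1 : x ≤ 1 / 2) (B : ℕ) :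
    ‖∑ n ∈ range B, expChar (n * x)‖ ≤ 1 / (2 * x) := by
  have h4 := four_mul_le_norm_expChar_sub_one h0.le h1
  have hne : expChar x ≠ 1 := by
    intro h; rw [h] at h4; simp at h4; linarith
  simp_rw [expChar_nat_mul]
  rw [geom_sum_eq hne, norm_div, div_le_div_iff₀ (by linarith) (by linarith)]
  have : ‖expChar x ^ B - 1‖ ≤ 2 := by
    refine (norm_sub_le _ _).trans ?_
    rw [norm_pow, norm_expChar]; norm_num
  nlinarith [norm_nonneg (expChar x ^ B - 1)]

/-- `VanDerCorputBound k`: sums of `expChar ∘ g` are small as soon as the `k`-th difference of `g`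
is nearly equal to a small constant `l` and the length `H` of the sum satisfies `l * H ^ k ≫ 1`. -/
def VanDerCorputBound (k : ℕ) : Prop :=
  ∀ ε : ℝ, 0 < ε → ∃ η l₀ A : ℝ, 0 < η ∧ 0 < l₀ ∧ 0 < A ∧ ∀ (g : ℕ → ℝ) (l : ℝ) (H : ℕ),
    0 < l → l < l₀ → A ≤ l * (H : ℝ) ^ k →
    (∀ n < 2 * H, |(fwdDiff 1)^[k] g n - l| ≤ η * l) →
    ‖∑ n ∈ range H, expChar (g n)‖ ≤ ε * H

lemma vanDerCorputBound_one : VanDerCorputBound 1 := by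
  intro ε hε
  have hpi := Real.pi_pos
  set A₁ : ℝ := 2 / ε with hA₁
  have hA₁0 : 0 < A₁ := by positivity
  refine ⟨ε ^ 2 / (32 * Real.pi), min (1 / 2) A₁, 4 * A₁ / ε, by positivity, by positivity,
    by positivity, ?_⟩
  intro g l H hl hl0 hA hg
  have hl2 : l ≤ 1 / 2 := (hl0.trans_le (min_le_left _ _)).le
  have hlA : l ≤ A₁ := (hl0.trans_le (min_le_right _ _)).le
  simp only [pow_one, Function.iterate_one, fwdDiff] at hA hg
  set B : ℕ := ⌈A₁ / l⌉₊ with hB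
  have hB1 : A₁ / l ≤ B := Nat.le_ceil _
  have h1l : 1 ≤ A₁ / l := by rw [le_div_iff₀ hl]; linarith
  have hB2 : (B : ℝ) ≤ 2 * (A₁ / l) := by
    have := (Nat.ceil_lt_add_one (by positivity : 0 ≤ A₁ / l)).le
    linarith
  have hB0 : 0 < B := by
    have : (0 : ℝ) < B := by linarith
    exact_mod_cast this
  have hBl : A₁ ≤ B * l := by rwa [div_le_iff₀ hl] at hB1
  have hBl2 : B * l ≤ 2 * A₁ := by
    have := mul_le_mul_of_nonneg_right hB2 hl.le
    have e : 2 * (A₁ / l) * l = 2 * A₁ := by field_simp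
    linarith
  set η : ℝ := ε ^ 2 / (32 * Real.pi) with hη
  have hη0 : 0 < η := by positivity
  have key := norm_sum_le_of_blocks B hB0 (ε / 2) (by positivity) H (fun n => expChar (g n))
    (fun n => (norm_expChar _).le) ?_
  · refine key.trans ?_
    have : (B : ℝ) ≤ ε / 2 * H := by
      refine hB2.trans ?_
      rw [div_le_iff₀ hε] at hA
      have : A₁ / l * l ≤ (ε / 4 * H) * l := by
        rw [div_mul_cancel₀ _ hl.ne']; linarith
      have := le_of_mul_le_mul_right this hl
      linarith
    linarith
  · intro m hm
    have lin : ∀ n, n ≤ B → |g (m + n) - (g m + n * l)| ≤ n * (η * l) := by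
      intro n
      induction n with
      | zero => simp
      | succ n ih =>
        intro hn
        have h1 := ih (by omega)
        have h2 := hg (m + n) (by omega)
        rw [abs_le] at h1 h2 ⊢
        push_cast
        rw [add_assoc m n 1] at h2
        constructor <;> nlinarith
    have hsplit : ∑ n ∈ range B, expChar (g (m + n))
        = expChar (g m) * ∑ n ∈ range B, expChar (n * l)
          + ∑ n ∈ range B, (expChar (g (m + n)) - expChar (g m + n * l)) := by
      rw [mul_sum, ← sum_add_distrib]
      refine sum_congr rfl fun n _ => ?_
      rw [expChar_add]; ring
    rw [hsplit]
    refine (norm_add_le _ _).trans ?_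
    rw [norm_mul, norm_expChar, one_mul]
    have g1 := norm_sum_expChar_linear_le hl hl2 B
    have g2 : ‖∑ n ∈ range B, (expChar (g (m + n)) - expChar (g m + n * l))‖
        ≤ ∑ n ∈ range B, (2 * Real.pi * (B * (η * l))) := by
      refine norm_sum_le_of_le _ fun n hn => ?_
      rw [mem_range] at hn
      refine (norm_expChar_sub_le _ _).trans ?_
      gcongr
      refine (lin n hn.le).trans ?_
      gcongr
    rw [sum_const, card_range, nsmul_eq_mul] at g2
    have g3 : 1 / (2 * l) ≤ ε / 4 * B := by
      rw [div_le_iff₀ (by positivity)]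
      have : ε * A₁ = 2 := by rw [hA₁]; field_simp
      nlinarith
    have g4 : 2 * Real.pi * (B * (η * l)) ≤ ε / 4 := by
      have : 2 * Real.pi * (B * (η * l)) = 2 * Real.pi * η * (B * l) := by ring
      rw [this]
      calc 2 * Real.pi * η * (B * l) ≤ 2 * Real.pi * η * (2 * A₁) := by gcongr
        _ = ε / 4 := by rw [hη, hA₁]; field_simp; norm_num
    have hBc : (0 : ℝ) ≤ B := Nat.cast_nonneg _
    nlinarith

/-- Van der Corput's inequality, in the averaged form obtained from the Cauchy-Schwarz inequality. -/
lemma norm_sum_le_van_der_corput (a : ℕ → ℂ) (ha : ∀ n, ‖a n‖ ≤ 1) (B D : ℕ) (hD : 0 < D)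
    (τ : ℝ)
    (h : ∑ d ∈ range D, ∑ d' ∈ range D,
      ‖∑ n ∈ range B, a (n + d) * (starRingEnd ℂ) (a (n + d'))‖ ≤ τ ^ 2 * B * D ^ 2)
    (hτ : 0 ≤ τ) :
    ‖∑ n ∈ range B, a n‖ ≤ 2 * D + τ * B := by
  have hD' : (0 : ℝ) < D := by exact_mod_cast hD
  have shift : ∀ d, ‖∑ n ∈ range B, a n - ∑ n ∈ range B, a (n + d)‖ ≤ 2 * d := by
    intro d
    have h1 := sum_range_add a B d
    have h2 := sum_range_add a d B
    rw [add_comm d B] at h2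
    have : ∑ n ∈ range B, a n - ∑ n ∈ range B, a (n + d)
        = ∑ n ∈ range d, a n - ∑ n ∈ range d, a (B + n) := by
      have h3 : ∑ n ∈ range B, a (n + d) = ∑ n ∈ range B, a (d + n) :=
        sum_congr rfl fun n _ => by rw [add_comm]
      rw [h3]
      linear_combination h2 - h1
    rw [this]
    refine (norm_sub_le _ _).trans ?_
    have h4 : ‖∑ n ∈ range d, a n‖ ≤ ∑ n ∈ range d, (1 : ℝ) := norm_sum_le_of_le _ fun n _ => ha n
    have h5 : ‖∑ n ∈ range d, a (B + n)‖ ≤ ∑ n ∈ range d, (1 : ℝ) :=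
      norm_sum_le_of_le _ fun n _ => ha _
    simp at h4 h5
    linarith
  set W : ℝ := ∑ n ∈ range B, ‖∑ d ∈ range D, a (n + d)‖ with hW
  have hW0 : 0 ≤ W := sum_nonneg fun _ _ => norm_nonneg _
  have h1 : D * ‖∑ n ∈ range B, a n‖ ≤ 2 * D * D + W := by
    have e : (D : ℂ) * ∑ n ∈ range B, a n
        = ∑ d ∈ range D, (∑ n ∈ range B, a n - ∑ n ∈ range B, a (n + d))
          + ∑ n ∈ range B, ∑ d ∈ range D, a (n + d) := by
      rw [sum_comm (s := range B), ← sum_add_distrib]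
      simp
    have : ‖(D : ℂ) * ∑ n ∈ range B, a n‖ ≤ ∑ d ∈ range D, (2 * D : ℝ) + W := by
      rw [e]
      refine (norm_add_le _ _).trans (add_le_add ?_ (norm_sum_le _ _))
      refine norm_sum_le_of_le _ fun d hd => (shift d).trans ?_
      have : (d : ℝ) ≤ D := by exact_mod_cast (mem_range.mp hd).le
      linarith
    rw [norm_mul, Complex.norm_natCast, sum_const, card_range, nsmul_eq_mul] at this
    linarith
  have h2 : W ^ 2 ≤ (τ * B * D) ^ 2 := by
    have cs : W ^ 2 ≤ B * ∑ n ∈ range B, ‖∑ d ∈ range D, a (n + d)‖ ^ 2 := by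
      have := sq_sum_le_card_mul_sum_sq (s := range B) (f := fun n => ‖∑ d ∈ range D, a (n + d)‖)
      simpa using this
    have sq : ∑ n ∈ range B, ‖∑ d ∈ range D, a (n + d)‖ ^ 2
        ≤ ∑ d ∈ range D, ∑ d' ∈ range D,
      ‖∑ n ∈ range B, a (n + d) * (starRingEnd ℂ) (a (n + d'))‖ := by
      have e : ((∑ n ∈ range B, ‖∑ d ∈ range D, a (n + d)‖ ^ 2 : ℝ) : ℂ)
          = ∑ d ∈ range D, ∑ d' ∈ range D,
              ∑ n ∈ range B, a (n + d) * (starRingEnd ℂ) (a (n + d')) := by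
        push_cast
        have : ∀ n, ((‖∑ d ∈ range D, a (n + d)‖ : ℝ) : ℂ) ^ 2
            = ∑ d ∈ range D, ∑ d' ∈ range D, a (n + d) * (starRingEnd ℂ) (a (n + d')) := by
          intro n
          rw [← Complex.mul_conj', map_sum, sum_mul_sum]
        simp_rw [this]
        rw [sum_comm]
        refine sum_congr rfl fun d _ => ?_
        rw [sum_comm]
      have h0 : 0 ≤ ∑ n ∈ range B, ‖∑ d ∈ range D, a (n + d)‖ ^ 2 :=
        sum_nonneg fun _ _ => by positivity
      have : ∑ n ∈ range B, ‖∑ d ∈ range D, a (n + d)‖ ^ 2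
          = ‖((∑ n ∈ range B, ‖∑ d ∈ range D, a (n + d)‖ ^ 2 : ℝ) : ℂ)‖ := by
        rw [Complex.norm_real, Real.norm_of_nonneg h0]
      rw [this, e]
      exact norm_sum_le_of_le _ fun d _ => norm_sum_le _ _
    calc W ^ 2 ≤ B * (τ ^ 2 * B * D ^ 2) := cs.trans (by gcongr; exact sq.trans h)
      _ = (τ * B * D) ^ 2 := by ring
  have h3 : W ≤ τ * B * D := abs_le_of_sq_le_sq' h2 (by positivity) |>.2
  have h4 : D * ‖∑ n ∈ range B, a n‖ ≤ D * (2 * D + τ * B) := by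
    refine h1.trans ?_
    linarith
  exact le_of_mul_le_mul_left h4 hD'

lemma fwdDiff_iterate_succ_telescope (k : ℕ) (g : ℕ → ℝ) (n q : ℕ) :
    (fwdDiff 1)^[k] (fun n => g (n + q) - g n) n
      = ∑ j ∈ range q, (fwdDiff 1)^[k + 1] g (n + j) := by
  have e : (fun n => g (n + q) - g n) = (fun n => g (n + q)) + (-1 : ℝ) • g := by
    ext n; simp; ring
  rw [e, fwdDiff_iter_add, fwdDiff_iter_const_smul, Pi.add_apply, fwdDiff_iter_comp_add]
  simp_rw [Function.iterate_succ_apply' (fwdDiff 1) k g]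
  simp only [fwdDiff, Pi.smul_apply]
  have := sum_range_sub (fun j => (fwdDiff 1)^[k] g (n + j)) q
  simp only [add_zero] at this
  simp only [add_assoc] at this ⊢
  rw [this]; simp; ring

set_option maxHeartbeats 1000000 in
lemma vanDerCorputBound_succ (k : ℕ) (hk : 1 ≤ k) (ih : VanDerCorputBound k) :
    VanDerCorputBound (k + 1) := by
  intro ε₀ hε₀
  set ε : ℝ := min ε₀ 1 with hεdef
  have hε : 0 < ε := lt_min hε₀ one_pos
  have hε1 : ε ≤ 1 := min_le_right _ _
  obtain ⟨η, l₁, A₁, hη, hl₁, hA₁, IH⟩ := ih (ε ^ 2 / 32) (by positivity)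
  set δ : ℝ := ε / 16 with hδ
  set κ : ℝ := ε ^ 2 / 128 with hκ
  have hδ0 : 0 < δ := by positivity
  have hκ0 : 0 < κ := by positivity
  set A₂ : ℝ := A₁ / (κ * δ) with hA₂
  have hA₂0 : 0 < A₂ := by positivity
  set X₀ : ℝ := max 1 (max (4 * A₂ / l₁) (1 / (κ * δ))) with hX₀
  have hX₀0 : 0 < X₀ := lt_of_lt_of_le one_pos (le_max_left _ _)
  refine ⟨η, A₂ / X₀ ^ (k + 1), A₂ * (8 / ε) ^ (k + 1), hη, by positivity, by positivity, ?_⟩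
  intro g l H hl hl0 hA hg
  set x : ℝ := (A₂ / l) ^ ((1 : ℝ) / (k + 1 : ℕ)) with hx
  have hx0 : 0 < x := by positivity
  have hxk : x ^ (k + 1) = A₂ / l := by
    rw [hx, one_div, Real.rpow_inv_natCast_pow (by positivity) (by omega)]
  have hxX : X₀ ≤ x := by
    refine le_of_pow_le_pow_left₀ (n := k + 1) (by omega) hx0.le ?_
    rw [hxk, le_div_iff₀ hl]
    rw [lt_div_iff₀ (by positivity)] at hl0
    linarith
  have hx1 : 1 ≤ x := (le_max_left _ _).trans hxX
  have hx2 : 4 * A₂ / l₁ ≤ x := (le_max_left _ _).trans ((le_max_right _ _).trans hxX)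
  have hx3 : 1 / (κ * δ) ≤ x := (le_max_right _ _).trans ((le_max_right _ _).trans hxX)
  have hxH : x * (8 / ε) ≤ H := by
    refine le_of_pow_le_pow_left₀ (n := k + 1) (by omega) (Nat.cast_nonneg _) ?_
    rw [mul_pow, hxk]
    have : A₂ / l * (8 / ε) ^ (k + 1) = (A₂ * (8 / ε) ^ (k + 1)) / l := by ring
    rw [this, div_le_iff₀ hl]
    linarith
  have hxH' : 8 * x ≤ ε * H := by
    have : x * (8 / ε) * ε = 8 * x := by field_simp
    nlinarith
  set B : ℕ := ⌈x⌉₊ with hB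
  have hBx : x ≤ B := Nat.le_ceil _
  have hBx2 : (B : ℝ) ≤ 2 * x := by
    have := (Nat.ceil_lt_add_one hx0.le).le
    linarith
  have hB0 : 0 < B := by
    have : (0 : ℝ) < B := by linarith
    exact_mod_cast this
  have hBH : 2 * B ≤ H := by
    have : (2 * B : ℝ) ≤ H := by nlinarith [Nat.cast_nonneg (α := ℝ) H]
    exact_mod_cast this
  have hxl : x * l ≤ l₁ / 4 := by
    have h1 : x * x ≤ x ^ (k + 1) := by
      rw [← pow_two]; exact pow_le_pow_right₀ hx1 (by omega)
    have h2 : x * x * l ≤ A₂ := by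
      calc x * x * l ≤ x ^ (k + 1) * l := by gcongr
        _ = A₂ := by rw [hxk]; field_simp
    have h3 : 4 * A₂ ≤ x * l₁ := by rwa [div_le_iff₀ hl₁] at hx2
    have h4 : x * (x * l) ≤ x * (l₁ / 4) := by linarith
    exact le_of_mul_le_mul_left h4 hx0
  set D : ℕ := ⌈δ * B⌉₊ with hDdef
  have hD1 : δ * B ≤ D := Nat.le_ceil _
  have hκδ : κ ≤ 1 := by rw [hκ]; nlinarith
  have hδx : 1 ≤ κ * (δ * x) := by
    rw [div_le_iff₀ (by positivity)] at hx3
    linarith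
  have hδB : 1 ≤ κ * (δ * B) := hδx.trans (by gcongr)
  have hδB1 : 1 ≤ δ * B := hδB.trans (by
    have : 0 ≤ δ * B := by positivity
    nlinarith)
  have hD2 : (D : ℝ) ≤ 2 * (δ * B) := by
    have := (Nat.ceil_lt_add_one (by positivity : 0 ≤ δ * B)).le
    linarith
  have hD0 : 0 < D := by
    have : (0 : ℝ) < D := by linarith
    exact_mod_cast this
  have hDB : D ≤ B := by
    have : (D : ℝ) ≤ B := by
      have : (0 : ℝ) ≤ B := Nat.cast_nonneg _
      rw [hδ] at hD2
      nlinarith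
    exact_mod_cast this
  set q : ℕ := ⌈κ * D⌉₊ with hq
  have hκD : 1 ≤ κ * D := hδB.trans (by gcongr)
  have hq1 : κ * D ≤ q := Nat.le_ceil _
  have hq2 : (q : ℝ) ≤ 2 * (κ * D) := by
    have := (Nat.ceil_lt_add_one (by positivity : 0 ≤ κ * D)).le
    linarith
  have hq0 : 0 < q := by
    have : (0 : ℝ) < q := by linarith
    exact_mod_cast this
  have key := norm_sum_le_of_blocks B hB0 (ε / 2) (by positivity) H (fun n => expChar (g n))
    (fun n => (norm_expChar _).le) ?_
  · refine key.trans ?_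
    have h1 : ε / 2 * H + B ≤ ε * H := by linarith
    refine h1.trans ?_
    gcongr
    exact min_le_left _ _
  intro m hm
  -- pairs of shifts at distance at least `q`
  have far : ∀ d d', d < D → d' + q ≤ d →
      ‖∑ n ∈ range B, expChar (g (m + (n + d))) * (starRingEnd ℂ) (expChar (g (m + (n + d'))))‖
        ≤ ε ^ 2 / 32 * B := by
    intro d d' hd hdd
    obtain ⟨r, rfl⟩ : ∃ r, d = d' + r := ⟨d - d', by omega⟩
    have hr : q ≤ r := by omega
    have hrD : r ≤ D := by omega
    have hr' : κ * D ≤ r := hq1.trans (by exact_mod_cast hr)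
    have hrB : (r : ℝ) ≤ B := by exact_mod_cast hrD.trans hDB
    have hr0 : (0 : ℝ) < r := by linarith
    have := IH (fun n => g (n + (m + d') + r) - g (n + (m + d'))) (r * l) B (by positivity) (by
        calc (r : ℝ) * l ≤ B * l := by gcongr
          _ ≤ 2 * x * l := by gcongr
          _ ≤ l₁ / 2 := by linarith
          _ < l₁ := by linarith) (by
        calc A₁ = κ * δ * A₂ := by rw [hA₂]; field_simp
          _ = κ * δ * (l * x ^ (k + 1)) := by rw [hxk]; field_simp
          _ ≤ κ * δ * (l * (B : ℝ) ^ (k + 1)) := by gcongr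
          _ = κ * (δ * B) * l * (B : ℝ) ^ k := by ring
          _ ≤ κ * D * l * (B : ℝ) ^ k := by gcongr
          _ ≤ r * l * (B : ℝ) ^ k := by gcongr) (by
        intro n hn
        have e1 : (fwdDiff 1)^[k] (fun n => g (n + (m + d') + r) - g (n + (m + d'))) n
          = (fwdDiff 1)^[k] (fun n => g (n + r) - g n) (n + (m + d')) :=
          fwdDiff_iter_comp_add 1 (fun n => g (n + r) - g n) (m + d') k n
        rw [e1, fwdDiff_iterate_succ_telescope]
        have e2 : (r : ℝ) * l = ∑ j ∈ range r, l := by simp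
        have e3 : η * (r * l) = ∑ j ∈ range r, η * l := by simp; ring
        rw [e3, e2, ← sum_sub_distrib]
        refine (abs_sum_le_sum_abs _ _).trans (sum_le_sum fun j hj => ?_)
        rw [mem_range] at hj
        exact hg _ (by omega))
    have e4 : ∀ n, expChar (g (m + (n + (d' + r)))) * (starRingEnd ℂ) (expChar (g (m + (n + d'))))
        = expChar (g (n + (m + d') + r) - g (n + (m + d'))) := fun n => by
      have a1 : m + (n + (d' + r)) = n + (m + d') + r := by omega
      have a2 : m + (n + d') = n + (m + d') := by omega
      rw [a1, a2, conj_expChar, ← expChar_add, ← sub_eq_add_neg]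
    simp only [e4]
    exact this
  have pair : ∀ d ∈ range D, ∀ d' ∈ range D,
      ‖∑ n ∈ range B, expChar (g (m + (n + d))) * (starRingEnd ℂ) (expChar (g (m + (n + d'))))‖
        ≤ ε ^ 2 / 32 * B + if d' ∈ Finset.Ico (d + 1 - q) (d + q) then (B : ℝ) else 0 := by
    intro d hd d' hd'
    rw [mem_range] at hd hd'
    have hsq : 0 ≤ ε ^ 2 / 32 * B := by positivity
    split_ifs with hmem
    · have : ‖∑ n ∈ range B,
          expChar (g (m + (n + d))) * (starRingEnd ℂ) (expChar (g (m + (n + d'))))‖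
          ≤ ∑ n ∈ range B, (1 : ℝ) := norm_sum_le_of_le _ fun n _ => by
        rw [norm_mul, RCLike.norm_conj, norm_expChar, norm_expChar, one_mul]
      simp only [sum_const, card_range, nsmul_eq_mul, mul_one] at this
      linarith
    · rw [add_zero]
      rw [Finset.mem_Ico, not_and_or] at hmem
      rcases hmem with hmem | hmem
      · exact far d d' hd (by omega)
      · have := far d' d hd' (by omega)
        rw [← Complex.norm_conj, map_sum] at this
        simpa only [map_mul, Complex.conj_conj, mul_comm] using this
  have tot : ∑ d ∈ range D, ∑ d' ∈ range D,
      ‖∑ n ∈ range B, expChar (g (m + (n + d))) * (starRingEnd ℂ) (expChar (g (m + (n + d'))))‖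
        ≤ (ε / 4) ^ 2 * B * D ^ 2 := by
    have inner : ∀ d ∈ range D, ∑ d' ∈ range D,
      ‖∑ n ∈ range B, expChar (g (m + (n + d))) * (starRingEnd ℂ) (expChar (g (m + (n + d'))))‖
        ≤ D * (ε ^ 2 / 32 * B) + 2 * q * B := by
      intro d hd
      refine (sum_le_sum (pair d hd)).trans ?_
      rw [sum_add_distrib, sum_const, card_range, nsmul_eq_mul, ← sum_filter, sum_const,
        nsmul_eq_mul]
      gcongr
      have : ((range D).filter (· ∈ Finset.Ico (d + 1 - q) (d + q))).card ≤ 2 * q := by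
        refine (card_le_card (t := Finset.Ico (d + 1 - q) (d + q)) fun a ha => ?_).trans ?_
        · exact (mem_filter.mp ha).2
        · rw [Nat.card_Ico]; omega
      exact_mod_cast this
    refine (sum_le_sum inner).trans ?_
    rw [sum_const, card_range, nsmul_eq_mul]
    have hBc : (0 : ℝ) ≤ B := Nat.cast_nonneg _
    have hDc : (0 : ℝ) ≤ D := Nat.cast_nonneg _
    calc (D : ℝ) * (D * (ε ^ 2 / 32 * B) + 2 * q * B)
        ≤ D * (D * (ε ^ 2 / 32 * B) + 2 * (2 * (κ * D)) * B) := by gcongr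
      _ = (ε / 4) ^ 2 * B * D ^ 2 := by rw [hκ]; ring
  have fin := norm_sum_le_van_der_corput (fun n => expChar (g (m + n)))
    (fun n => (norm_expChar _).le) B D hD0 (ε / 4) tot (by positivity)
  refine fin.trans ?_
  rw [hδ] at hD2
  linarith

lemma vanDerCorputBound (k : ℕ) (hk : 1 ≤ k) : VanDerCorputBound k := by
  induction k, hk using Nat.le_induction with
  | base => exact vanDerCorputBound_one
  | succ k hk ih => exact vanDerCorputBound_succ k hk ih

lemma exists_fwdDiff_iterate_eq (k : ℕ) : ∀ (f : ℕ → ℝ → ℝ) (x : ℝ), 0 < x →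
    (∀ i, ∀ y, 0 < y → HasDerivAt (f i) (f (i + 1) y) y) →
    ∀ n : ℕ, ∃ ξ, x + n ≤ ξ ∧ ξ ≤ x + n + k ∧
      (fwdDiff 1)^[k] (fun n : ℕ => f 0 (x + n)) n = f k ξ := by
  induction k with
  | zero => intro f x _ _ n; exact ⟨x + n, le_rfl, by simp, rfl⟩
  | succ k ih =>
    intro f x hx hf n
    obtain ⟨ξ, h1, h2, h3⟩ := ih (fun i y => f i (y + 1) - f i y) x hx (fun i y hy => by
      have := (hf i (y + 1) (by linarith)).comp_add_const y 1
      exact this.sub (hf i y hy)) n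
    have hξ : 0 < ξ := by
      have : (0 : ℝ) ≤ n := Nat.cast_nonneg _
      linarith
    obtain ⟨ζ, hζ, hζ'⟩ := exists_hasDerivAt_eq_slope (f k) (f (k + 1)) (a := ξ) (b := ξ + 1)
      (by linarith)
      (fun y hy => (hf k y (by linarith [hy.1])).continuousAt.continuousWithinAt)
      (fun y hy => hf k y (by linarith [hy.1]))
    refine ⟨ζ, by linarith [hζ.1], by push_cast; linarith [hζ.2], ?_⟩
    rw [Function.iterate_succ_apply]
    have e : fwdDiff 1 (fun n : ℕ => f 0 (x + n)) = fun n : ℕ => f 0 (x + n + 1) - f 0 (x + n) := by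
      ext m; simp [fwdDiff, add_assoc]
    rw [e, h3, hζ']
    simp

lemma exists_fwdDiff_iterate_rpow_eq (c : ℝ) (k : ℕ) (h x : ℝ) (hx : 0 < x) (n : ℕ) :
    ∃ ξ, x + n ≤ ξ ∧ ξ ≤ x + n + k ∧
      (fwdDiff 1)^[k] (fun n : ℕ => h * (x + n) ^ c) n
        = h * (∏ i ∈ range k, (c - i)) * ξ ^ (c - k) := by
  obtain ⟨ξ, h1, h2, h3⟩ := exists_fwdDiff_iterate_eq k
    (fun i y => h * (∏ j ∈ range i, (c - j)) * y ^ (c - i)) x hx (fun i y hy => by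
      have := (Real.hasDerivAt_rpow_const (p := c - i) (Or.inl hy.ne')).const_mul
        (h * ∏ j ∈ range i, (c - j))
      refine this.congr_deriv ?_
      rw [prod_range_succ, show c - ((i + 1 : ℕ) : ℝ) = c - i - 1 by push_cast; ring]
      ring) n
  refine ⟨ξ, h1, h2, ?_⟩
  rw [← h3]
  simp

/-- For `c > 1/2` not an integer, the values `h * m ^ c` equidistribute modulo one on windows of
length proportional to `√L` near `L`. -/
lemma eventually_norm_sum_expChar_rpow_le_of_pos {c : ℝ} (hc : 1 / 2 < c)
    (hcZ : ¬∃ m : ℤ, c = (m : ℝ)) {h : ℝ} (hh : 0 < h) {ε η : ℝ} (hε : 0 < ε) (hη : 0 < η) :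
    ∀ᶠ L : ℝ in atTop, ∀ a : ℕ, L / 2 ≤ a → a ≤ 2 * L →
      ‖∑ j ∈ range ⌈ε * √L⌉₊, expChar (h * ((a + j : ℕ) : ℝ) ^ c)‖ ≤ η * ⌈ε * √L⌉₊ := by
  set k : ℕ := ⌈c⌉₊ with hk
  have hc0 : 0 < c := by linarith
  have hk1 : 1 ≤ k := Nat.ceil_pos.mpr hc0
  have hck : c < k := by
    refine lt_of_le_of_ne (Nat.le_ceil c) fun he => hcZ ⟨k, by rw [he]; simp⟩
  have hkc : (k : ℝ) - 1 < c := by linarith [Nat.ceil_lt_add_one hc0.le]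
  have hk2 : (k : ℝ) / 2 < c := by
    rcases hk1.eq_or_lt with h1 | h1
    · rw [← h1]; simpa using hc
    · have : (2 : ℝ) ≤ k := by exact_mod_cast h1
      linarith
  set P : ℝ := h * ∏ i ∈ range k, (c - i) with hP
  have hP0 : 0 < P := by
    refine mul_pos hh (prod_pos fun i hi => ?_)
    have : (i : ℝ) + 1 ≤ k := by exact_mod_cast mem_range.mp hi
    linarith
  obtain ⟨θ, l₀, A, hθ, hl₀, hA, key⟩ := vanDerCorputBound k hk1 η hη
  have t1 : Tendsto (fun L : ℝ => P * (L / 2) ^ (c - k)) atTop (nhds 0) := by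
    have : Tendsto (fun L : ℝ => (L / 2) ^ (-(k - c))) atTop (nhds 0) :=
      (tendsto_rpow_neg_atTop (by linarith)).comp (tendsto_id.atTop_div_const two_pos)
    simpa using this.const_mul P
  have t2 : Tendsto (fun L : ℝ => P * (2 : ℝ) ^ (c - k) * ε ^ k * L ^ (c - k / 2)) atTop atTop :=
    (tendsto_rpow_atTop (by linarith)).const_mul_atTop (by positivity)
  have t3 : Tendsto (fun L : ℝ => (θ * √L / 2 - 2 * ε) * √L) atTop atTop := by
    refine Tendsto.atTop_mul_atTop₀ ?_ Real.tendsto_sqrt_atTop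
    exact tendsto_atTop_add_const_right _ _
      ((Real.tendsto_sqrt_atTop.const_mul_atTop hθ).atTop_div_const two_pos)
  filter_upwards [t1.eventually_lt_const hl₀, t2.eventually_ge_atTop A,
    t3.eventually_ge_atTop (3 * k + 2), eventually_gt_atTop 0] with L h1 h2 h3 hL a ha1 ha2
  have ha0 : (0 : ℝ) < a := by linarith
  set H := ⌈ε * √L⌉₊ with hH
  have hs : 0 < √L := Real.sqrt_pos.mpr hL
  have hss : √L * √L = L := Real.mul_self_sqrt hL.le
  have hH1 : ε * √L ≤ H := Nat.le_ceil _
  have hH2 : (H : ℝ) < ε * √L + 1 := Nat.ceil_lt_add_one (by positivity)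
  have := key (fun n => h * (a + n) ^ c) (P * (a : ℝ) ^ (c - k)) H (by positivity) ?_ ?_ ?_
  · simpa using this
  · refine lt_of_le_of_lt ?_ h1
    gcongr P * ?_
    exact Real.rpow_le_rpow_of_nonpos (by positivity) ha1 (by linarith)
  · have e1 : (2 * L) ^ (c - k) ≤ (a : ℝ) ^ (c - k) :=
      Real.rpow_le_rpow_of_nonpos ha0 ha2 (by linarith)
    have e2 : L ^ (c - k / 2) = L ^ (c - k) * (√L) ^ k := by
      rw [Real.sqrt_eq_rpow, ← Real.rpow_natCast, ← Real.rpow_mul hL.le, ← Real.rpow_add hL]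
      congr 1; ring
    calc A ≤ _ := h2
      _ = P * (2 * L) ^ (c - k) * (ε * √L) ^ k := by
        rw [e2, Real.mul_rpow two_pos.le hL.le, mul_pow]; ring
      _ ≤ P * (a : ℝ) ^ (c - k) * (H : ℝ) ^ k := by gcongr
  · intro n hn
    obtain ⟨ξ, x1, x2, x3⟩ := exists_fwdDiff_iterate_rpow_eq c k h a ha0 n
    have hn' : (n : ℝ) < 2 * H := by exact_mod_cast hn
    have hn0 : (0 : ℝ) ≤ n := Nat.cast_nonneg _
    have hξa : (a : ℝ) ≤ ξ := by linarith
    have hξ0 : 0 < ξ := by linarith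
    have hξ : ξ ≤ a + θ * a := by
      have hkk : (0 : ℝ) ≤ k := Nat.cast_nonneg _
      have : 2 * ε * √L + 2 + k ≤ θ * (L / 2) := by
        nlinarith
      have : θ * (L / 2) ≤ θ * a := by gcongr
      linarith
    rw [x3, ← hP, ← mul_sub, abs_mul, abs_of_pos hP0]
    have up : ξ ^ (c - k) ≤ (a : ℝ) ^ (c - k) :=
      Real.rpow_le_rpow_of_nonpos ha0 hξa (by linarith)
    have low : (1 - θ) * (a : ℝ) ^ (c - k) ≤ ξ ^ (c - k) := by
      have hq : ξ / a ≤ 1 + θ := by rw [div_le_iff₀ ha0]; linarith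
      have hq1 : 1 ≤ ξ / a := by rw [le_div_iff₀ ha0]; linarith
      have : 1 - θ ≤ (ξ / a) ^ (c - k) := by
        calc 1 - θ ≤ (1 + θ)⁻¹ := by
              rw [← one_div, le_div_iff₀ (by linarith)]; nlinarith
          _ ≤ (ξ / a)⁻¹ := by gcongr
          _ = (ξ / a) ^ (-1 : ℝ) := by rw [Real.rpow_neg_one]
          _ ≤ (ξ / a) ^ (c - k) := Real.rpow_le_rpow_of_exponent_le hq1 (by linarith)
      calc (1 - θ) * (a : ℝ) ^ (c - k) ≤ (ξ / a) ^ (c - k) * (a : ℝ) ^ (c - k) := by gcongr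
        _ = ξ ^ (c - k) := by
          rw [← Real.mul_rpow (by positivity) ha0.le]; congr 1; field_simp
    rw [abs_of_nonpos (by linarith)]
    have : -(ξ ^ (c - k) - (a : ℝ) ^ (c - k)) ≤ θ * (a : ℝ) ^ (c - k) := by linarith
    calc P * _ ≤ P * (θ * (a : ℝ) ^ (c - k)) := by gcongr
      _ = _ := by ring

lemma eventually_norm_sum_expChar_rpow_le {c : ℝ} (hc : 1 / 2 < c)
    (hcZ : ¬∃ m : ℤ, c = (m : ℝ)) {h : ℝ} (hh : h ≠ 0) {ε η : ℝ} (hε : 0 < ε) (hη : 0 < η) :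
    ∀ᶠ L : ℝ in atTop, ∀ a : ℕ, L / 2 ≤ a → a ≤ 2 * L →
      ‖∑ j ∈ range ⌈ε * √L⌉₊, expChar (h * ((a + j : ℕ) : ℝ) ^ c)‖ ≤ η * ⌈ε * √L⌉₊ := by
  rcases lt_or_gt_of_ne hh with hneg | hpos
  · filter_upwards [eventually_norm_sum_expChar_rpow_le_of_pos hc hcZ (neg_pos.mpr hneg) hε hη]
      with L hL a h1 h2
    have := hL a h1 h2
    rw [← Complex.norm_conj, map_sum] at this
    simpa only [conj_expChar, neg_mul, neg_neg] using this
  · exact eventually_norm_sum_expChar_rpow_le_of_pos hc hcZ hpos hε hη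

lemma smallOmega_mul {m n : ℕ} (h : m.Coprime n) :
    smallOmega (m * n) = smallOmega m + smallOmega n := by
  rw [smallOmega, h.primeFactors_mul, card_union_of_disjoint h.disjoint_primeFactors]
  rfl

lemma smallOmega_prime_pow {p k : ℕ} (hp : p.Prime) (hk : k ≠ 0) : smallOmega (p ^ k) = 1 := by
  rw [smallOmega, Nat.primeFactors_prime_pow hk hp, card_singleton]

lemma smallOmega_one : smallOmega 1 = 0 := by simp [smallOmega]

lemma two_pow_smallOmega_le {n : ℕ} (hn : n ≠ 0) : 2 ^ smallOmega n ≤ n.divisors.card := by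
  rw [Nat.card_divisors hn, smallOmega, ← prod_const]
  refine prod_le_prod' fun p hp => ?_
  have := (Nat.prime_of_mem_primeFactors hp).factorization_pos_of_dvd hn
    (Nat.dvd_of_mem_primeFactors hp)
  omega

/-- The coefficients `z ^ ω(n)`. -/
noncomputable def omegaPow (z : ℂ) (n : ℕ) : ℂ := z ^ smallOmega n

lemma norm_omegaPow_le {z : ℂ} (hz : ‖z‖ ≤ 3 / 2) {n : ℕ} (hn : n ≠ 0) :
    ‖omegaPow z n‖ ≤ ‖LSeries.convolution (1 : ℕ → ℂ) 1 n‖ := by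
  have e : LSeries.convolution (1 : ℕ → ℂ) 1 n = (n.divisors.card : ℂ) := by
    rw [LSeries.convolution_def]
    simp [← Nat.map_div_right_divisors]
  rw [e, Complex.norm_natCast, omegaPow, norm_pow]
  calc ‖z‖ ^ smallOmega n ≤ 2 ^ smallOmega n := by gcongr; linarith
    _ ≤ n.divisors.card := by exact_mod_cast two_pow_smallOmega_le hn

lemma lSeriesSummable_convolution_one {s : ℂ} (hs : 1 < s.re) :
    LSeriesSummable (LSeries.convolution (1 : ℕ → ℂ) 1) s :=
  (LSeriesSummable_one_iff.mpr hs).convolution (LSeriesSummable_one_iff.mpr hs)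

lemma lSeriesSummable_omegaPow {z : ℂ} (hz : ‖z‖ ≤ 3 / 2) {s : ℂ} (hs : 1 < s.re) :
    LSeriesSummable (omegaPow z) s := by
  refine (lSeriesSummable_convolution_one hs).norm.of_norm_bounded fun n => ?_
  rcases eq_or_ne n 0 with rfl | hn
  · simp
  · exact LSeries.norm_term_le s (norm_omegaPow_le hz hn)

lemma abscissaOfAbsConv_omegaPow_le {z : ℂ} (hz : ‖z‖ ≤ 3 / 2) :
    LSeries.abscissaOfAbsConv (omegaPow z) ≤ 1 :=
  LSeries.abscissaOfAbsConv_le_of_forall_lt_LSeriesSummable (x := 1) fun y hy =>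
    lSeriesSummable_omegaPow hz (by simpa using hy)

lemma hasProd_omegaPow {z : ℂ} (hz : ‖z‖ ≤ 3 / 2) {s : ℂ} (hs : 1 < s.re) :
    HasProd (fun p : Nat.Primes =>
      (1 + (z - 1) * (p : ℂ) ^ (-s)) / (1 - (p : ℂ) ^ (-s))) (LSeries (omegaPow z) s) := by
  have hs0 : s ≠ 0 := by rintro rfl; norm_num at hs
  have key := EulerProduct.eulerProduct_hasProd (f := LSeries.term (omegaPow z) s)
    (by simp [omegaPow, smallOmega_one]) (fun {m n} h => by
      rcases eq_or_ne m 0 with rfl | hm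
      · simp
      rcases eq_or_ne n 0 with rfl | hn
      · simp
      rw [LSeries.term_of_ne_zero (mul_ne_zero hm hn), LSeries.term_of_ne_zero hm,
        LSeries.term_of_ne_zero hn, omegaPow, smallOmega_mul h, pow_add, Nat.cast_mul,
        Complex.natCast_mul_natCast_cpow, omegaPow, omegaPow, mul_div_mul_comm])
    (lSeriesSummable_omegaPow hz hs).norm (LSeries.term_zero _ _)
  refine key.congr_fun fun p => ?_
  have hX : ‖(p : ℂ) ^ (-s)‖ < 1 :=
    (Complex.norm_prime_cpow_le_one_half p hs).trans_lt (by norm_num)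
  have h1 := (hasSum_geometric_of_norm_lt_one hX).mul_left z
  have h2 := h1.add (hasSum_ite_eq 0 (1 - z))
  have h3 : (fun e : ℕ => LSeries.term (omegaPow z) s ((p : ℕ) ^ e))
      = fun e => z * ((p : ℂ) ^ (-s)) ^ e + if e = 0 then 1 - z else 0 := by
    ext e
    rw [LSeries.term_of_ne_zero (pow_ne_zero _ p.2.ne_zero), omegaPow]
    rcases eq_or_ne e 0 with rfl | he
    · simp [smallOmega_one]
    · rw [smallOmega_prime_pow p.2 he, pow_one, if_neg he, add_zero, Nat.cast_pow,
        div_eq_mul_inv, ← Complex.cpow_neg, ← Complex.cpow_nat_mul, ← Complex.natCast_cpow_natCast_mul]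
  rw [h3, h2.tsum_eq]
  have : 1 - (p : ℂ) ^ (-s) ≠ 0 := Complex.one_sub_prime_cpow_ne_zero p.2 hs
  field_simp
  ring

lemma norm_prime_cpow_neg_le {p : ℕ} (hp : p.Prime) {s : ℂ} (hs : 9 / 10 < s.re) :
    ‖(p : ℂ) ^ (-s)‖ ≤ (p : ℝ) ^ (-(9 / 10) : ℝ) := by
  rw [Complex.norm_natCast_cpow_of_pos hp.pos, Complex.neg_re]
  exact Real.rpow_le_rpow_of_exponent_le (by exact_mod_cast hp.one_le) (by linarith)

lemma le_rpow_nine_div_ten {x y : ℝ} (hx : 0 ≤ x) (hy : 0 ≤ y) (h : x ^ 10 ≤ y ^ 9) :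
    x ≤ y ^ (9 / 10 : ℝ) := by
  refine (pow_le_pow_iff_left₀ hx (Real.rpow_nonneg hy _) (by norm_num : 10 ≠ 0)).mp ?_
  rw [← Real.rpow_natCast (y ^ (9 / 10 : ℝ)), ← Real.rpow_mul hy]
  norm_num
  exact_mod_cast h

lemma norm_prime_cpow_neg_le_of_three_le {p : ℕ} (hp : p.Prime) (hp3 : 3 ≤ p) {s : ℂ}
    (hs : 9 / 10 < s.re) : ‖(p : ℂ) ^ (-s)‖ ≤ 47 / 125 := by
  refine (norm_prime_cpow_neg_le hp hs).trans ?_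
  have h3 : (125 / 47 : ℝ) ≤ 3 ^ (9 / 10 : ℝ) :=
    le_rpow_nine_div_ten (by norm_num) (by norm_num) (by norm_num)
  calc (p : ℝ) ^ (-(9 / 10) : ℝ) ≤ (3 : ℝ) ^ (-(9 / 10) : ℝ) :=
        Real.rpow_le_rpow_of_nonpos (by norm_num) (by exact_mod_cast hp3) (by norm_num)
    _ = ((3 : ℝ) ^ (9 / 10 : ℝ))⁻¹ := Real.rpow_neg (by norm_num) _
    _ ≤ (125 / 47 : ℝ)⁻¹ := by gcongr
    _ = 47 / 125 := by norm_num

lemma norm_two_cpow_neg_le {s : ℂ} (hs : 9 / 10 < s.re) : ‖(2 : ℂ) ^ (-s)‖ ≤ 27 / 50 := by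
  have h := norm_prime_cpow_neg_le Nat.prime_two hs
  rw [Nat.cast_ofNat, Nat.cast_ofNat] at h
  refine h.trans ?_
  have h3 : (50 / 27 : ℝ) ≤ 2 ^ (9 / 10 : ℝ) :=
    le_rpow_nine_div_ten (by norm_num) (by norm_num) (by norm_num)
  calc (2 : ℝ) ^ (-(9 / 10) : ℝ) = ((2 : ℝ) ^ (9 / 10 : ℝ))⁻¹ := Real.rpow_neg (by norm_num) _
    _ ≤ (50 / 27 : ℝ)⁻¹ := by gcongr
    _ = 27 / 50 := by norm_num

/-- The Euler factor of `∑ z ^ ω(n) n ^ (-s)` multiplied by `(1 - p ^ (-s)) ^ z`. -/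
noncomputable def regFactor (z : ℂ) (p : ℕ) (s : ℂ) : ℂ :=
  (1 + (z - 1) * (p : ℂ) ^ (-s)) * Complex.exp ((z - 1) * Complex.log (1 - (p : ℂ) ^ (-s)))

/-- The logarithm of `regFactor z p s` for odd primes `p`. -/
noncomputable def logRegFactor (z : ℂ) (p : ℕ) (s : ℂ) : ℂ :=
  if p = 2 then 0 else
    Complex.log (1 + (z - 1) * (p : ℂ) ^ (-s)) + (z - 1) * Complex.log (1 - (p : ℂ) ^ (-s))

lemma norm_sub_one_le_of_norm_le {z : ℂ} (hz : ‖z‖ ≤ 3 / 2) : ‖z - 1‖ ≤ 5 / 2 :=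
  (norm_sub_le z 1).trans (by rw [norm_one]; linarith)

lemma norm_mul_prime_cpow_le {z : ℂ} (hz : ‖z‖ ≤ 3 / 2) {p : ℕ} (hp : p.Prime) (hp2 : p ≠ 2)
    {s : ℂ} (hs : 9 / 10 < s.re) : ‖(z - 1) * (p : ℂ) ^ (-s)‖ ≤ 47 / 50 := by
  rw [norm_mul]
  calc _ ≤ 5 / 2 * (47 / 125 : ℝ) := by
        gcongr
        · exact norm_sub_one_le_of_norm_le hz
        · exact norm_prime_cpow_neg_le_of_three_le hp
            (by have := hp.two_le; omega) hs
    _ = _ := by norm_num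

lemma norm_prime_cpow_neg_le_of_prime {p : ℕ} (hp : p.Prime) {s : ℂ} (hs : 9 / 10 < s.re) :
    ‖(p : ℂ) ^ (-s)‖ ≤ 27 / 50 := by
  rcases eq_or_ne p 2 with rfl | h2
  · exact_mod_cast norm_two_cpow_neg_le hs
  · exact (norm_prime_cpow_neg_le_of_three_le hp (by have := hp.two_le; omega) hs).trans
      (by norm_num)

lemma one_sub_mem_slitPlane_of_norm_lt_one {x : ℂ} (hx : ‖x‖ < 1) : 1 - x ∈ Complex.slitPlane := by
  have := Complex.mem_slitPlane_of_norm_lt_one (z := -x) (by rwa [norm_neg])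
  rwa [← sub_eq_add_neg] at this

lemma norm_logRegFactor_le {z : ℂ} (hz : ‖z‖ ≤ 3 / 2) {p : ℕ} (hp : p.Prime)
    {s : ℂ} (hs : 9 / 10 < s.re) : ‖logRegFactor z p s‖ ≤ 60 * (p : ℝ) ^ (-(9 / 5) : ℝ) := by
  rw [logRegFactor]
  split_ifs with h2
  · rw [norm_zero]; positivity
  set X := (p : ℂ) ^ (-s) with hX
  have hX2 : ‖X‖ ^ 2 ≤ (p : ℝ) ^ (-(9 / 5) : ℝ) := by
    calc ‖X‖ ^ 2 ≤ ((p : ℝ) ^ (-(9 / 10) : ℝ)) ^ 2 := by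
          gcongr; exact norm_prime_cpow_neg_le hp hs
      _ = _ := by rw [← Real.rpow_natCast, ← Real.rpow_mul (Nat.cast_nonneg _)]; norm_num
  have hw := norm_sub_one_le_of_norm_le hz
  have hwX := norm_mul_prime_cpow_le hz hp h2 hs
  have hX1 := norm_prime_cpow_neg_le_of_prime hp hs
  rw [← hX] at hwX hX1
  have b1 := Complex.norm_log_one_add_sub_self_le (z := (z - 1) * X) (by linarith)
  have b2 := Complex.norm_log_one_add_sub_self_le (z := -X) (by rw [norm_neg]; linarith)
  rw [norm_neg, ← sub_eq_add_neg] at b2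
  have c1 : ‖(z - 1) * X‖ ^ 2 * (1 - ‖(z - 1) * X‖)⁻¹ / 2 ≤ ((5 / 2) ^ 2 * ‖X‖ ^ 2) * (50 / 3) / 2 := by
    have : (1 - ‖(z - 1) * X‖)⁻¹ ≤ 50 / 3 := by
      rw [inv_le_comm₀ (by linarith) (by norm_num)]; linarith
    have h' : ‖(z - 1) * X‖ ^ 2 ≤ (5 / 2) ^ 2 * ‖X‖ ^ 2 := by
      rw [norm_mul, mul_pow]; gcongr
    have : 0 ≤ (1 - ‖(z - 1) * X‖)⁻¹ := inv_nonneg.mpr (by linarith)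
    gcongr
  have c2 : ‖X‖ ^ 2 * (1 - ‖X‖)⁻¹ / 2 ≤ ‖X‖ ^ 2 * (50 / 23) / 2 := by
    have : (1 - ‖X‖)⁻¹ ≤ 50 / 23 := by
      rw [inv_le_comm₀ (by linarith) (by norm_num)]; linarith
    gcongr
  have e : Complex.log (1 + (z - 1) * X) + (z - 1) * Complex.log (1 - X)
      = (Complex.log (1 + (z - 1) * X) - (z - 1) * X)
        + (z - 1) * (Complex.log (1 - X) - -X) := by ring
  rw [e]
  refine (norm_add_le _ _).trans ?_
  rw [norm_mul]
  have c3 : ‖z - 1‖ * ‖Complex.log (1 - X) - -X‖ ≤ 5 / 2 * (‖X‖ ^ 2 * (50 / 23) / 2) := by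
    gcongr
    exact b2.trans c2
  nlinarith [sq_nonneg ‖X‖]

lemma exp_logRegFactor {z : ℂ} (hz : ‖z‖ ≤ 3 / 2) {p : ℕ} (hp : p.Prime) (h2 : p ≠ 2)
    {s : ℂ} (hs : 9 / 10 < s.re) : Complex.exp (logRegFactor z p s) = regFactor z p s := by
  rw [logRegFactor, if_neg h2, Complex.exp_add, Complex.exp_log, regFactor]
  exact Complex.slitPlane_ne_zero (Complex.mem_slitPlane_of_norm_lt_one
    ((norm_mul_prime_cpow_le hz hp h2 hs).trans_lt (by norm_num)))

lemma differentiableAt_prime_cpow_neg {p : ℕ} (hp : p.Prime) (s : ℂ) :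
    DifferentiableAt ℂ (fun s => (p : ℂ) ^ (-s)) s :=
  differentiableAt_id.neg.const_cpow (Or.inl (Nat.cast_ne_zero.mpr hp.ne_zero))

lemma differentiableAt_log_one_sub_prime_cpow {p : ℕ} (hp : p.Prime) {s : ℂ}
    (hs : 9 / 10 < s.re) :
    DifferentiableAt ℂ (fun s => Complex.log (1 - (p : ℂ) ^ (-s))) s :=
  ((differentiableAt_prime_cpow_neg hp s).const_sub 1).clog
    (one_sub_mem_slitPlane_of_norm_lt_one
      ((norm_prime_cpow_neg_le_of_prime hp hs).trans_lt (by norm_num)))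

lemma differentiableAt_regFactor (z : ℂ) {p : ℕ} (hp : p.Prime) {s : ℂ}
    (hs : 9 / 10 < s.re) : DifferentiableAt ℂ (regFactor z p) s :=
  (((differentiableAt_prime_cpow_neg hp s).const_mul _).const_add 1).mul
    ((differentiableAt_log_one_sub_prime_cpow hp hs).const_mul _).cexp

lemma differentiableAt_logRegFactor {z : ℂ} (hz : ‖z‖ ≤ 3 / 2) {p : ℕ} (hp : p.Prime) {s : ℂ}
    (hs : 9 / 10 < s.re) : DifferentiableAt ℂ (logRegFactor z p) s := by
  by_cases h2 : p = 2
  · have : logRegFactor z p = fun _ => 0 := by ext s; rw [logRegFactor, if_pos h2]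
    rw [this]; exact differentiableAt_const _
  · have : logRegFactor z p = fun s => Complex.log (1 + (z - 1) * (p : ℂ) ^ (-s))
        + (z - 1) * Complex.log (1 - (p : ℂ) ^ (-s)) := by
      ext s; rw [logRegFactor, if_neg h2]
    rw [this]
    exact ((((differentiableAt_prime_cpow_neg hp s).const_mul _).const_add 1).clog
      (Complex.mem_slitPlane_of_norm_lt_one
        ((norm_mul_prime_cpow_le hz hp h2 hs).trans_lt (by norm_num)))).add
      ((differentiableAt_log_one_sub_prime_cpow hp hs).const_mul _)

/-- The function `(∑ z ^ ω(n) n ^ (-s)) * ζ(s) ^ (-z)`, continued to `re s > 9 / 10`. -/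
noncomputable def regPart (z s : ℂ) : ℂ :=
  regFactor z 2 s * Complex.exp (∑' p : Nat.Primes, logRegFactor z p s)

lemma summable_primes_rpow : Summable fun p : Nat.Primes => 60 * (p : ℝ) ^ (-(9 / 5) : ℝ) :=
  (Nat.Primes.summable_rpow.mpr (by norm_num)).mul_left _

lemma differentiableOn_regPart {z : ℂ} (hz : ‖z‖ ≤ 3 / 2) :
    DifferentiableOn ℂ (regPart z) {s | 9 / 10 < s.re} := by
  refine DifferentiableOn.mul
    (fun s hs => (differentiableAt_regFactor z Nat.prime_two hs).differentiableWithinAt) ?_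
  refine DifferentiableOn.cexp ?_
  exact Complex.differentiableOn_tsum_of_summable_norm summable_primes_rpow
    (fun p s hs => (differentiableAt_logRegFactor hz p.2 hs).differentiableWithinAt)
    (isOpen_lt continuous_const Complex.continuous_re)
    (fun p s hs => norm_logRegFactor_le hz p.2 hs)

lemma exists_norm_regPart_le : ∃ C > 0, ∀ z : ℂ, ‖z‖ ≤ 3 / 2 → ∀ s : ℂ, 9 / 10 < s.re →
    ‖regPart z s‖ ≤ C := by
  refine ⟨(1 + 5 / 2) * Real.exp (5 / 2) *
    Real.exp (∑' p : Nat.Primes, 60 * (p : ℝ) ^ (-(9 / 5) : ℝ)), by positivity, ?_⟩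
  intro z hz s hs
  have hw := norm_sub_one_le_of_norm_le hz
  have hX := norm_prime_cpow_neg_le_of_prime Nat.prime_two hs
  rw [regPart, regFactor, norm_mul, norm_mul, Complex.norm_exp, Complex.norm_exp]
  gcongr
  · refine (norm_add_le _ _).trans ?_
    rw [norm_one, norm_mul]
    nlinarith [norm_nonneg (z - 1), norm_nonneg (((2 : ℕ) : ℂ) ^ (-s))]
  · refine (Complex.re_le_norm _).trans ?_
    have b2 := Complex.norm_log_one_add_le (z := -((2 : ℕ) : ℂ) ^ (-s))
      (by rw [norm_neg]; exact hX.trans_lt (by norm_num))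
    rw [norm_neg, ← sub_eq_add_neg] at b2
    set x := ‖((2 : ℕ) : ℂ) ^ (-s)‖
    have h0 : 0 ≤ x := norm_nonneg _
    have h1 : (1 - x)⁻¹ ≤ 50 / 23 := by
      rw [inv_le_comm₀ (by linarith) (by norm_num)]; linarith
    have h1' : 0 ≤ (1 - x)⁻¹ := inv_nonneg.mpr (by linarith)
    have h2 : x ^ 2 * (1 - x)⁻¹ / 2 ≤ (27 / 50) ^ 2 * (50 / 23) / 2 := by gcongr
    have h3 : ‖Complex.log (1 - ((2 : ℕ) : ℂ) ^ (-s))‖ ≤ 1 := by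
      refine b2.trans ?_
      norm_num at h2 ⊢
      linarith
    rw [norm_mul]
    calc _ ≤ 5 / 2 * (1 : ℝ) := by gcongr
      _ = _ := by norm_num
  · refine (Complex.re_le_norm _).trans ?_
    exact tsum_of_norm_bounded summable_primes_rpow.hasSum fun p => norm_logRegFactor_le hz p.2 hs

/-- The branch of `log ζ` on `re s > 1` given by the Euler product. -/
noncomputable def logZeta (s : ℂ) : ℂ := ∑' p : Nat.Primes, -Complex.log (1 - (p : ℂ) ^ (-s))

lemma exp_logZeta {s : ℂ} (hs : 1 < s.re) : Complex.exp (logZeta s) = riemannZeta s :=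
  riemannZeta_eulerProduct_exp_log hs

lemma norm_log_one_sub_prime_cpow_le {p : ℕ} (hp : p.Prime) {σ : ℝ} (hσ : 1 < σ) {s : ℂ}
    (hs : σ < s.re) : ‖-Complex.log (1 - (p : ℂ) ^ (-s))‖ ≤ 2 * (p : ℝ) ^ (-σ) := by
  have hX := norm_prime_cpow_neg_le_of_prime hp (s := s) (by linarith)
  have hXσ : ‖(p : ℂ) ^ (-s)‖ ≤ (p : ℝ) ^ (-σ) := by
    rw [Complex.norm_natCast_cpow_of_pos hp.pos, Complex.neg_re]
    exact Real.rpow_le_rpow_of_exponent_le (by exact_mod_cast hp.one_le) (by linarith)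
  have b2 := Complex.norm_log_one_add_le (z := -(p : ℂ) ^ (-s)) (by rw [norm_neg]; linarith)
  rw [norm_neg, ← sub_eq_add_neg] at b2
  rw [norm_neg]
  refine (b2.trans ?_).trans (mul_le_mul_of_nonneg_left hXσ two_pos.le)
  set x := ‖(p : ℂ) ^ (-s)‖
  have h0 : 0 ≤ x := norm_nonneg _
  have h1 : (1 - x)⁻¹ ≤ 50 / 23 := by
    rw [inv_le_comm₀ (by linarith) (by norm_num)]; linarith
  have h2 : x ^ 2 * (1 - x)⁻¹ / 2 ≤ x ^ 2 * (50 / 23) / 2 := by gcongr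
  nlinarith

lemma differentiableAt_logZeta {s : ℂ} (hs : 1 < s.re) : DifferentiableAt ℂ logZeta s := by
  obtain ⟨σ, h1, h2⟩ := exists_between hs
  have hU : IsOpen {s : ℂ | σ < s.re} := isOpen_lt continuous_const Complex.continuous_re
  refine DifferentiableOn.differentiableAt (s := {s : ℂ | σ < s.re}) ?_ (hU.mem_nhds h2)
  exact Complex.differentiableOn_tsum_of_summable_norm
    (u := fun p : Nat.Primes => 2 * (p : ℝ) ^ (-σ))
    ((Nat.Primes.summable_rpow.mpr (by linarith)).mul_left _)
    (fun p s hs => (differentiableAt_log_one_sub_prime_cpow p.2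
      (by have : σ < s.re := hs
          linarith)).neg.differentiableWithinAt) hU
    (fun p s hs => norm_log_one_sub_prime_cpow_le p.2 h1 hs)

lemma lSeries_omegaPow_eq {z : ℂ} (hz : ‖z‖ ≤ 3 / 2) {s : ℂ} (hs : 1 < s.re) :
    LSeries (omegaPow z) s = regPart z s * Complex.exp (z * logZeta s) := by
  have hs' : 9 / 10 < s.re := by linarith
  obtain ⟨σ, h1, h2⟩ := exists_between hs
  have sumZ : Summable fun p : Nat.Primes => -Complex.log (1 - (p : ℂ) ^ (-s)) :=
    ((Nat.Primes.summable_rpow.mpr (by linarith : -σ < -1)).mul_left 2).of_norm_bounded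
      fun p => norm_log_one_sub_prime_cpow_le p.2 h1 h2
  have hZ := (sumZ.hasSum.mul_left z).cexp
  have sumR : Summable fun p : Nat.Primes => logRegFactor z p s :=
    summable_primes_rpow.of_norm_bounded fun p => norm_logRegFactor_le hz p.2 hs'
  have hR := sumR.hasSum.cexp
  have h2 := hasProd_ite_eq (⟨2, Nat.prime_two⟩ : Nat.Primes) (regFactor z 2 s)
  refine (hasProd_omegaPow hz hs).unique (((h2.mul hR).mul hZ).congr_fun fun p => ?_)
  have hne : 1 - (p : ℂ) ^ (-s) ≠ 0 := Complex.one_sub_prime_cpow_ne_zero p.2 hs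
  have e1 : (if p = ⟨2, Nat.prime_two⟩ then regFactor z 2 s else 1) *
      (Complex.exp ∘ fun p : Nat.Primes => logRegFactor z p s) p = regFactor z p s := by
    by_cases hp : p = ⟨2, Nat.prime_two⟩
    · subst hp
      change (if _ then _ else _) * Complex.exp (logRegFactor z 2 s) = regFactor z 2 s
      rw [if_pos rfl, logRegFactor, if_pos rfl, Complex.exp_zero, mul_one]
    · rw [if_neg hp, one_mul]
      exact exp_logRegFactor hz p.2 (fun h => hp (Subtype.ext h)) hs'
  have e2 : Complex.exp ((z - 1) * Complex.log (1 - (p : ℂ) ^ (-s)))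
      * Complex.exp (z * -Complex.log (1 - (p : ℂ) ^ (-s))) = (1 - (p : ℂ) ^ (-s))⁻¹ := by
    rw [← Complex.exp_add]
    have : (z - 1) * Complex.log (1 - (p : ℂ) ^ (-s)) + z * -Complex.log (1 - (p : ℂ) ^ (-s))
      = -Complex.log (1 - (p : ℂ) ^ (-s)) := by ring
    rw [this, Complex.exp_neg, Complex.exp_log hne]
  rw [e1, regFactor, div_eq_mul_inv, mul_assoc, ← e2]
  rfl

lemma isOpen_one_lt_re : IsOpen {s : ℂ | 1 < s.re} :=
  isOpen_lt continuous_const Complex.continuous_re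

/-- On a bounded part of `1 < re s`, the function `logZeta s + log (s - 1)` and its derivative are
bounded. -/
lemma exists_norm_logZeta_add_log_le {T : ℝ} (hT : 0 ≤ T) : ∃ B > 0, ∀ s : ℂ, 1 < s.re →
    s.re ≤ 2 → |s.im| ≤ T → ‖deriv logZeta s + 1 / (s - 1)‖ ≤ B ∧
      ‖logZeta s + Complex.log (s - 1)‖ ≤ B := by
  set ζ₁ := DirichletCharacter.LFunctionTrivChar₁ 1 with hζ₁
  have hζ : DirichletCharacter.LFunctionTrivChar 1 = riemannZeta :=
    DirichletCharacter.LFunction_modOne_eq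
  have hK : IsCompact (Set.Icc (1 : ℝ) 2 ×ℂ Set.Icc (-T) T) := isCompact_Icc.reProdIm isCompact_Icc
  obtain ⟨B, hB⟩ := hK.exists_bound_of_continuousOn
    ((DirichletCharacter.continuousOn_neg_logDeriv_LFunctionTrivChar₁ 1).mono (fun s hs => by
      right
      rw [hζ]
      exact riemannZeta_ne_zero_of_one_le_re hs.1.1))
  set E : ℂ → ℂ := fun s => logZeta s + Complex.log (s - 1) with hE
  have hlog : ∀ s : ℂ, 1 < s.re → HasDerivAt (fun s => Complex.log (s - 1)) (1 / (s - 1)) s := by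
    intro s hs
    have h1 : s - 1 ∈ Complex.slitPlane := Or.inl (by simpa using hs)
    exact ((hasDerivAt_id s).sub_const 1).clog h1
  have hEd : ∀ s : ℂ, 1 < s.re → HasDerivAt E (deriv logZeta s + 1 / (s - 1)) s := fun s hs =>
    (differentiableAt_logZeta hs).hasDerivAt.add (hlog s hs)
  have hexp : ∀ s : ℂ, 1 < s.re → Complex.exp (E s) = ζ₁ s := by
    intro s hs
    have hs1 : s ≠ 1 := by rintro rfl; simp at hs
    rw [hE]
    simp only
    rw [Complex.exp_add, exp_logZeta hs, Complex.exp_log (sub_ne_zero.mpr hs1), hζ₁,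
      DirichletCharacter.LFunctionTrivChar₁, Function.update_of_ne hs1, hζ, mul_comm]
  have hder : ∀ s : ℂ, 1 < s.re → deriv logZeta s + 1 / (s - 1) = deriv ζ₁ s / ζ₁ s := by
    intro s hs
    have h1 : HasDerivAt ζ₁ (Complex.exp (E s) * (deriv logZeta s + 1 / (s - 1))) s := by
      refine (hEd s hs).cexp.congr_of_eventuallyEq ?_
      filter_upwards [isOpen_one_lt_re.mem_nhds hs] with w hw
      exact (hexp w hw).symm
    rw [h1.deriv, ← hexp s hs, mul_div_cancel_left₀ _ (Complex.exp_ne_zero _)]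
  have hbd : ∀ s : ℂ, 1 < s.re → s.re ≤ 2 → |s.im| ≤ T →
      ‖deriv logZeta s + 1 / (s - 1)‖ ≤ B := by
    intro s h1 h2 h3
    have := hB s ⟨⟨h1.le, h2⟩, abs_le.mp h3⟩
    rw [hder s h1]
    rwa [neg_div, norm_neg] at this
  have h22 : ‖deriv logZeta 2 + 1 / (2 - 1)‖ ≤ B := hbd 2 (by norm_num) (by norm_num) (by simpa)
  have hB0 : 0 ≤ B := (norm_nonneg _).trans h22
  refine ⟨‖E 2‖ + B * (T + 2) + 1, by positivity, fun s h1 h2 h3 => ⟨?_, ?_⟩⟩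
  · refine (hbd s h1 h2 h3).trans ?_
    nlinarith [norm_nonneg (E 2)]
  · have hconv : Convex ℝ (Set.Ioc (1 : ℝ) 2 ×ℂ Set.Icc (-T) T) :=
      ((convex_Ioc (1 : ℝ) 2).is_linear_preimage Complex.reLm.isLinear).inter
        ((convex_Icc (-T) T).is_linear_preimage Complex.imLm.isLinear)
    have := hconv.norm_image_sub_le_of_norm_deriv_le (𝕜 := ℂ) (f := E) (C := B) (x := 2) (y := s)
      (fun w hw => (hEd w hw.1.1).differentiableAt)
      (fun w hw => by
        rw [(hEd w hw.1.1).deriv]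
        exact hbd w hw.1.1 hw.1.2 (abs_le.mpr hw.2))
      ⟨by simp, by simpa using hT⟩ ⟨⟨h1, h2⟩, abs_le.mp h3⟩
    have h4 : ‖s - 2‖ ≤ T + 2 := by
      refine (Complex.norm_le_abs_re_add_abs_im _).trans ?_
      have : |(s - 2).re| ≤ 1 := by
        rw [abs_le]; simp; constructor <;> linarith
      have : |(s - 2).im| ≤ T := by simpa using h3
      linarith
    have h5 : ‖E s‖ ≤ ‖E s - E 2‖ + ‖E 2‖ := by
      simpa using norm_add_le (E s - E 2) (E 2)
    have : B * ‖s - 2‖ ≤ B * (T + 2) := by gcongr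
    change ‖E s‖ ≤ _
    linarith

lemma exists_norm_deriv_regPart_le : ∃ C > 0, ∀ z : ℂ, ‖z‖ ≤ 3 / 2 → ∀ s : ℂ, 1 < s.re →
    ‖regPart z s‖ ≤ C ∧ ‖deriv (regPart z) s‖ ≤ C := by
  obtain ⟨C, hC, h⟩ := exists_norm_regPart_le
  refine ⟨20 * C, by positivity, fun z hz s hs => ⟨?_, ?_⟩⟩
  · exact (h z hz s (by linarith)).trans (by linarith)
  have hsub : Metric.closedBall s (1 / 20) ⊆ {s | 9 / 10 < s.re} := by
    intro w hw
    rw [Metric.mem_closedBall, dist_eq_norm] at hw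
    have := (abs_le.mp ((Complex.abs_re_le_norm _).trans hw)).1
    simp only [Complex.sub_re] at this
    simp only [Set.mem_ofPred_eq]
    linarith
  have := Complex.norm_deriv_le_of_forall_mem_sphere_norm_le (by norm_num : (0 : ℝ) < 1 / 20)
    ((differentiableOn_regPart hz).diffContOnCl_ball hsub)
    (fun w hw => h z hz w (hsub (Metric.sphere_subset_closedBall hw)))
  linarith

lemma exists_norm_lSeries_omegaPow_le {T : ℝ} (hT : 0 ≤ T) : ∃ C > 0, ∀ z : ℂ, ‖z‖ ≤ 3 / 2 →
    ∀ s : ℂ, 1 < s.re → s.re ≤ 2 → |s.im| ≤ T →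
      ‖LSeries (omegaPow z) s‖ ≤ C * ‖s - 1‖ ^ (-max z.re (1 / 2)) ∧
      ‖deriv (LSeries (omegaPow z)) s‖ ≤ C * ‖s - 1‖ ^ (-max z.re (1 / 2) - 1) := by
  obtain ⟨B, hB, hZ⟩ := exists_norm_logZeta_add_log_le hT
  obtain ⟨G, hG, hR⟩ := exists_norm_deriv_regPart_le
  set D : ℝ := Real.exp (3 / 2 * B + 3 / 2 * Real.pi) * (2 + T) ^ 2 with hD
  refine ⟨G * D + ((2 + T) * G + 3 / 2 * (B * (2 + T) + 1) * G) * D, by positivity,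
    fun z hz s h1 h2 h3 => ?_⟩
  obtain ⟨hZ1, hZ2⟩ := hZ s h1 h2 h3
  obtain ⟨hR1, hR2⟩ := hR z hz s h1
  set α := max z.re (1 / 2) with hα
  have hs1 : s - 1 ≠ 0 := by
    intro h
    rw [sub_eq_zero] at h
    rw [h] at h1
    simp at h1
  set r := ‖s - 1‖ with hr
  have hr0 : 0 < r := norm_pos_iff.mpr hs1
  have hr2 : r ≤ 2 + T := by
    refine (Complex.norm_le_abs_re_add_abs_im _).trans ?_
    have : |(s - 1).re| ≤ 1 := by
      rw [abs_le]; simp; constructor <;> linarith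
    have : |(s - 1).im| ≤ T := by simpa using h3
    linarith
  have hzre : z.re ≤ α := le_max_left _ _
  have hzre2 : -(3 / 2) ≤ z.re := by
    have := (abs_le.mp (Complex.abs_re_le_norm z)).1
    linarith
  have hzre3 : α - z.re ≤ 2 := by
    have h5 : z.re ≤ z.re + 2 := by linarith
    have : α ≤ z.re + 2 := max_le h5 (by linarith)
    linarith
  have hexp : ‖Complex.exp (z * logZeta s)‖ ≤ D * r ^ (-α) := by
    rw [Complex.norm_exp]
    have e : (z * logZeta s).re = (z * (logZeta s + Complex.log (s - 1))).re
        - z.re * Real.log r + z.im * (s - 1).arg := by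
      simp only [mul_add, Complex.add_re, Complex.mul_re, Complex.log_re, Complex.log_im, ← hr]
      ring
    have b1 : (z * (logZeta s + Complex.log (s - 1))).re ≤ 3 / 2 * B := by
      refine (Complex.re_le_norm _).trans ?_
      rw [norm_mul]; gcongr
    have b2 : z.im * (s - 1).arg ≤ 3 / 2 * Real.pi := by
      refine (le_abs_self _).trans ?_
      rw [abs_mul]
      gcongr
      · exact (Complex.abs_im_le_norm z).trans hz
      · exact Complex.abs_arg_le_pi _
    have b3 : Real.exp (z * logZeta s).re
        ≤ Real.exp (3 / 2 * B + 3 / 2 * Real.pi) * r ^ (-z.re) := by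
      rw [Real.rpow_def_of_pos hr0, ← Real.exp_add]
      gcongr
      rw [e]; linarith
    have b4 : r ^ (-z.re) ≤ (2 + T) ^ 2 * r ^ (-α) := by
      have : r ^ (-z.re) = r ^ (α - z.re) * r ^ (-α) := by
        rw [← Real.rpow_add hr0]; congr 1; ring
      rw [this]
      gcongr
      calc r ^ (α - z.re) ≤ (2 + T) ^ (α - z.re) := by gcongr
        _ ≤ (2 + T) ^ (2 : ℝ) := by gcongr; linarith
        _ = (2 + T) ^ 2 := by norm_cast
    calc _ ≤ _ := b3
      _ ≤ Real.exp (3 / 2 * B + 3 / 2 * Real.pi) * ((2 + T) ^ 2 * r ^ (-α)) := by gcongr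
      _ = D * r ^ (-α) := by rw [hD]; ring
  have hra : 0 < r ^ (-α) := Real.rpow_pos_of_pos hr0 _
  have hra1 : r ^ (-α - 1) = r⁻¹ * r ^ (-α) := by
    rw [Real.rpow_sub hr0, Real.rpow_one]; field_simp
  constructor
  · rw [lSeries_omegaPow_eq hz h1, norm_mul]
    calc _ ≤ G * (D * r ^ (-α)) := by gcongr
      _ = G * D * r ^ (-α) := by ring
      _ ≤ _ := by
        gcongr
        have : 0 ≤ ((2 + T) * G + 3 / 2 * (B * (2 + T) + 1) * G) * D := by positivity
        linarith
  · have hZd := (differentiableAt_logZeta h1).hasDerivAt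
    have hRd : HasDerivAt (regPart z) (deriv (regPart z) s) s := by
      refine ((differentiableOn_regPart hz).differentiableAt ?_).hasDerivAt
      exact (isOpen_lt continuous_const Complex.continuous_re).mem_nhds
        (show 9 / 10 < s.re by linarith)
    have hF := (hRd.mul (hZd.const_mul z).cexp).congr_of_eventuallyEq
      (f₁ := LSeries (omegaPow z)) (by
        filter_upwards [isOpen_one_lt_re.mem_nhds h1] with w hw
        exact lSeries_omegaPow_eq hz hw)
    rw [hF.deriv]
    have hZ' : ‖deriv logZeta s‖ ≤ B + r⁻¹ := by
      have : deriv logZeta s = (deriv logZeta s + 1 / (s - 1)) - 1 / (s - 1) := by ring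
      rw [this]
      refine (norm_sub_le _ _).trans ?_
      rw [norm_div, norm_one, ← hr, ← one_div r]
      gcongr
    have hone : 1 ≤ (2 + T) * r⁻¹ := by
      rw [← div_eq_mul_inv, le_div_iff₀ hr0]; linarith
    have hinv : 0 < r⁻¹ := inv_pos.mpr hr0
    have e : deriv (regPart z) s * Complex.exp (z * logZeta s) + regPart z s *
        (Complex.exp (z * logZeta s) * (z * deriv logZeta s))
        = (deriv (regPart z) s + z * deriv logZeta s * regPart z s)
          * Complex.exp (z * logZeta s) := by ring
    rw [e, norm_mul]
    have h6 : ‖deriv (regPart z) s + z * deriv logZeta s * regPart z s‖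
        ≤ ((2 + T) * G + 3 / 2 * (B * (2 + T) + 1) * G) * r⁻¹ := by
      refine (norm_add_le _ _).trans ?_
      rw [norm_mul, norm_mul]
      have a1 : G ≤ (2 + T) * G * r⁻¹ := by nlinarith
      have a2 : B + r⁻¹ ≤ (B * (2 + T) + 1) * r⁻¹ := by nlinarith
      have a3 : ‖z‖ * ‖deriv logZeta s‖ * ‖regPart z s‖
          ≤ 3 / 2 * ((B * (2 + T) + 1) * r⁻¹) * G := by
        gcongr
        exact hZ'.trans a2
      linarith
    calc _ ≤ (((2 + T) * G + 3 / 2 * (B * (2 + T) + 1) * G) * r⁻¹) * (D * r ^ (-α)) := by gcongr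
      _ = ((2 + T) * G + 3 / 2 * (B * (2 + T) + 1) * G) * D * (r⁻¹ * r ^ (-α)) := by ring
      _ ≤ _ := by
        rw [hra1]
        gcongr
        have : 0 ≤ G * D := by positivity
        linarith

/-- The Fejér kernel. -/
noncomputable def fejer (y : ℝ) : ℝ := Real.sinc (y / 2) ^ 2

lemma continuous_fejer : Continuous fejer :=
  (Real.continuous_sinc.comp (continuous_id.div_const 2)).pow 2

lemma fejer_nonneg (y : ℝ) : 0 ≤ fejer y := sq_nonneg _

lemma fejer_le_one (y : ℝ) : fejer y ≤ 1 := by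
  rw [fejer, ← sq_abs]
  exact pow_le_one₀ (abs_nonneg _) (Real.abs_sinc_le_one _)

lemma fejer_le {y : ℝ} (hy : y ≠ 0) : fejer y ≤ 4 / y ^ 2 := by
  rw [fejer, Real.sinc_of_ne_zero (by simpa using hy), div_pow, div_pow]
  have : Real.sin (y / 2) ^ 2 ≤ 1 := Real.sin_sq_le_one _
  have hy2 : 0 < y ^ 2 := by positivity
  rw [div_le_div_iff₀ (by positivity) hy2]
  nlinarith

lemma integral_triangle_mul_cos {y : ℝ} (hy : y ≠ 0) :
    ∫ t in (0 : ℝ)..1, (1 - t) * Real.cos (t * y) = (1 - Real.cos y) / y ^ 2 := by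
  have h : ∀ t ∈ Set.uIcc (0 : ℝ) 1, HasDerivAt
      (fun t => (1 - t) * (Real.sin (t * y) / y) - Real.cos (t * y) / y ^ 2)
      ((1 - t) * Real.cos (t * y)) t := by
    intro t _
    have h1 : HasDerivAt (fun t : ℝ => t * y) y t := by
      simpa using (hasDerivAt_id t).mul_const y
    have h2 := (((hasDerivAt_id t).const_sub 1).mul (h1.sin.div_const y)).sub
      (h1.cos.div_const (y ^ 2))
    refine h2.congr_deriv ?_
    simp only [id]
    field_simp
    ring
  rw [intervalIntegral.integral_eq_sub_of_hasDerivAt h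
    (Continuous.intervalIntegrable (by fun_prop) _ _)]
  simp
  ring

lemma integral_triangle_mul_exp (y : ℝ) :
    ∫ t in (-1 : ℝ)..1, ((1 - |t| : ℝ) : ℂ) * Complex.exp (Complex.I * (t * y : ℝ))
      = (fejer y : ℂ) := by
  set f : ℝ → ℂ := fun t => ((1 - |t| : ℝ) : ℂ) * Complex.exp (Complex.I * (t * y : ℝ)) with hf
  have hc : Continuous f := by
    rw [hf]
    fun_prop
  have h1 : ∫ t in (-1 : ℝ)..1, f t = ∫ t in (0 : ℝ)..1, (f t + f (-t)) := by
    have hcn : Continuous fun t => f (-t) := hc.comp continuous_neg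
    rw [intervalIntegral.integral_add (hc.intervalIntegrable _ _)
      (hcn.intervalIntegrable _ _), intervalIntegral.integral_comp_neg,
      ← intervalIntegral.integral_add_adjacent_intervals (hc.intervalIntegrable (-1) 0)
        (hc.intervalIntegrable 0 1), neg_zero, add_comm]
  have h2 : ∀ t ∈ Set.uIcc (0 : ℝ) 1, f t + f (-t) = ((2 * ((1 - t) * Real.cos (t * y)) : ℝ) : ℂ) := by
    intro t ht
    rw [Set.uIcc_of_le zero_le_one] at ht
    simp only [hf, abs_neg, abs_of_nonneg ht.1]
    have h3 := Complex.two_cos ((t * y : ℝ) : ℂ)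
    have h4 : Complex.exp (Complex.I * (t * y : ℝ)) + Complex.exp (Complex.I * (-t * y : ℝ))
        = 2 * Complex.cos (t * y : ℝ) := by
      rw [h3]
      congr 2 <;> push_cast <;> ring
    rw [← mul_add, h4]
    push_cast
    ring
  rw [h1, intervalIntegral.integral_congr h2, intervalIntegral.integral_ofReal,
    intervalIntegral.integral_const_mul]
  congr 1
  rcases eq_or_ne y 0 with rfl | hy
  · simp only [mul_zero, Real.cos_zero, mul_one, fejer, zero_div, Real.sinc_zero, one_pow]
    rw [intervalIntegral.integral_sub (by simp) (by simp), integral_id]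
    norm_num
  · rw [integral_triangle_mul_cos hy, fejer, Real.sinc_of_ne_zero (by simpa using hy), div_pow,
      Real.sin_sq_eq_half_sub]
    rw [show 2 * (y / 2) = y by ring]
    field_simp

lemma integrable_fejer : Integrable fejer := by
  have := (integrable_inv_one_add_sq).const_mul 8
  refine this.mono' continuous_fejer.aestronglyMeasurable (Eventually.of_forall fun y => ?_)
  rw [Real.norm_of_nonneg (fejer_nonneg y)]
  have h1 := fejer_le_one y
  have hp : (0 : ℝ) < 1 + y ^ 2 := by positivity
  rw [← div_eq_mul_inv, le_div_iff₀ hp]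
  rcases eq_or_ne y 0 with rfl | hy
  · nlinarith
  · have h2 := fejer_le hy
    rw [le_div_iff₀ (by positivity)] at h2
    linarith

lemma integral_fejer_pos : 0 < ∫ y, fejer y := by
  rw [integral_pos_iff_support_of_nonneg fejer_nonneg integrable_fejer]
  have hopen : IsOpen (Function.support fejer) := continuous_fejer.isOpen_support
  exact hopen.measure_pos _ ⟨0, by simp [fejer]⟩

lemma integral_Ioi_mul_cexp {s : ℂ} (hs : 1 ≤ s.re) {a : ℝ} (ha : 0 ≤ a) :
    IntegrableOn (fun u : ℝ => (u : ℂ) * Complex.exp (-s * u)) (Set.Ioi a) ∧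
    ∫ u in Set.Ioi a, (u : ℂ) * Complex.exp (-s * u)
      = (a / s + 1 / s ^ 2) * Complex.exp (-s * a) := by
  have hs0 : s ≠ 0 := by rintro rfl; norm_num at hs
  have hint : IntegrableOn (fun u : ℝ => (u : ℂ) * Complex.exp (-s * u)) (Set.Ioi a) := by
    have h0 := (Real.GammaIntegral_convergent two_pos).mono_set (Set.Ioi_subset_Ioi ha)
    refine Integrable.mono' h0 (by fun_prop) ?_
    refine (ae_restrict_iff' measurableSet_Ioi).mpr (Eventually.of_forall fun u hu => ?_)
    have hu0 : 0 < u := lt_of_le_of_lt ha hu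
    rw [norm_mul, Complex.norm_exp, Complex.norm_of_nonneg hu0.le, mul_comm]
    norm_num
    gcongr
    nlinarith
  refine ⟨hint, ?_⟩
  have hd : ∀ u ∈ Set.Ioi a, HasDerivAt
      (fun u : ℝ => -(((u : ℂ) / s + 1 / s ^ 2) * Complex.exp (-s * u)))
      ((u : ℂ) * Complex.exp (-s * u)) u := by
    intro u _
    have h1 : HasDerivAt (fun u : ℝ => (u : ℂ)) 1 u := Complex.ofRealCLM.hasDerivAt
    have h2 := ((((h1.div_const s).add_const (1 / s ^ 2)).mul (h1.const_mul (-s)).cexp)).neg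
    refine h2.congr_deriv ?_
    field_simp
    ring
  have ht : Tendsto (fun u : ℝ => -(((u : ℂ) / s + 1 / s ^ 2) * Complex.exp (-s * u))) atTop
      (nhds 0) := by
    rw [tendsto_zero_iff_norm_tendsto_zero]
    have t1 := Real.tendsto_pow_mul_exp_neg_atTop_nhds_zero 1
    have t0 := Real.tendsto_pow_mul_exp_neg_atTop_nhds_zero 0
    have t2 := (t1.const_mul (1 / ‖s‖)).add (t0.const_mul (1 / ‖s‖ ^ 2))
    simp only [mul_zero, add_zero] at t2
    refine squeeze_zero' (Eventually.of_forall fun u => norm_nonneg _) ?_ t2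
    filter_upwards [eventually_ge_atTop 0] with u hu
    rw [norm_neg, norm_mul, Complex.norm_exp]
    have e1 : ‖(u : ℂ) / s + 1 / s ^ 2‖ ≤ 1 / ‖s‖ * u + 1 / ‖s‖ ^ 2 := by
      refine (norm_add_le _ _).trans (le_of_eq ?_)
      rw [norm_div, norm_div, norm_pow, norm_one, Complex.norm_of_nonneg hu]
      ring
    have e2 : Real.exp (-s * u).re ≤ Real.exp (-u) := by
      gcongr
      simp
      nlinarith
    calc _ ≤ (1 / ‖s‖ * u + 1 / ‖s‖ ^ 2) * Real.exp (-u) := by gcongr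
      _ = _ := by ring
  rw [integral_Ioi_of_hasDerivAt_of_tendsto (by fun_prop) hd hint ht]
  ring

/-- A weight concentrated at distance `1 / T` from `U`. -/
noncomputable def weight (T U u : ℝ) : ℝ := u / U * Real.exp (-(u / U)) * (T * fejer (T * (u - U)))

/-- The mass given to `n` by the weight. -/
noncomputable def mass (T U : ℝ) (n : ℕ) : ℝ :=
  if n = 0 then 0 else ∫ u in Set.Ioi (Real.log n), Real.exp (-u) * weight T U u

lemma continuous_weight (T U : ℝ) : Continuous (weight T U) := by
  unfold weight
  have := continuous_fejer
  fun_prop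

lemma weight_nonneg {T U u : ℝ} (hT : 0 ≤ T) (hU : 0 < U) (hu : 0 ≤ u) : 0 ≤ weight T U u := by
  have := fejer_nonneg (T * (u - U))
  unfold weight
  positivity

lemma mass_nonneg {T U : ℝ} (hT : 0 ≤ T) (hU : 0 < U) (n : ℕ) : 0 ≤ mass T U n := by
  rw [mass]
  split_ifs with h
  · exact le_rfl
  · refine setIntegral_nonneg measurableSet_Ioi fun u hu => ?_
    have : 0 ≤ Real.log n := Real.log_natCast_nonneg n
    exact mul_nonneg (Real.exp_nonneg _) (weight_nonneg hT hU (this.trans (le_of_lt hu)))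

/-- The vertical line on which the Dirichlet series is evaluated. -/
noncomputable def linePt (T U t : ℝ) : ℂ := 1 + 1 / U - Complex.I * (t * T)

lemma linePt_re (T U t : ℝ) : (linePt T U t).re = 1 + 1 / U := by
  simp [linePt, ← Complex.ofReal_inv]

lemma linePt_im (T U t : ℝ) : (linePt T U t).im = -(t * T) := by
  simp [linePt, ← Complex.ofReal_inv]

lemma continuous_linePt (T U : ℝ) : Continuous (linePt T U) := by
  unfold linePt; fun_prop

lemma mass_eq_integral {T U : ℝ} (hU : 0 < U) {n : ℕ} (hn : n ≠ 0) :
    (mass T U n : ℂ) = ∫ t in (-1 : ℝ)..1,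
      (((T / U * (1 - |t|) : ℝ) : ℂ) * Complex.exp (Complex.I * (-(t * (T * U)) : ℝ))) *
      ((Real.log n / linePt T U t + 1 / linePt T U t ^ 2) * (n : ℂ) ^ (-linePt T U t)) := by
  have hlog : 0 ≤ Real.log n := Real.log_natCast_nonneg n
  have hre : ∀ t, 1 ≤ (linePt T U t).re := fun t => by
    rw [linePt_re]
    have : 0 ≤ 1 / U := by positivity
    linarith
  set c : ℝ → ℂ := fun t =>
    ((T / U * (1 - |t|) : ℝ) : ℂ) * Complex.exp (Complex.I * (-(t * (T * U)) : ℝ)) with hc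
  have hcc : Continuous c := by rw [hc]; fun_prop
  have hnorm : ∀ t ∈ Set.uIoc (-1 : ℝ) 1, ‖c t‖ ≤ |T / U| := by
    intro t ht
    rw [Set.uIoc_of_le (by norm_num)] at ht
    have h1 : |t| ≤ 1 := abs_le.mpr ⟨ht.1.le, ht.2⟩
    have h0 := abs_nonneg t
    rw [hc]
    simp only
    rw [norm_mul, Complex.norm_exp_I_mul_ofReal, mul_one, Complex.norm_real, Real.norm_eq_abs,
      abs_mul]
    have : abs (1 - |t|) ≤ 1 := by rw [abs_le]; constructor <;> linarith
    nlinarith [abs_nonneg (T / U)]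
  have e1 : ∀ t, (Real.log n / linePt T U t + 1 / linePt T U t ^ 2) * (n : ℂ) ^ (-linePt T U t)
      = ∫ u in Set.Ioi (Real.log n), (u : ℂ) * Complex.exp (-linePt T U t * u) := by
    intro t
    rw [(integral_Ioi_mul_cexp (hre t) hlog).2, Complex.cpow_def_of_ne_zero (by exact_mod_cast hn),
      Complex.natCast_log, mul_comm (Complex.log _)]
  have e2 : ∀ u : ℝ, ((Real.exp (-u) * weight T U u : ℝ) : ℂ)
      = ∫ t in (-1 : ℝ)..1, c t * ((u : ℂ) * Complex.exp (-linePt T U t * u)) := by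
    intro u
    have : ∀ t : ℝ, c t * ((u : ℂ) * Complex.exp (-linePt T U t * u))
        = ((Real.exp (-u) * (u / U * Real.exp (-(u / U)) * T) : ℝ) : ℂ) *
          (((1 - |t| : ℝ) : ℂ) * Complex.exp (Complex.I * (t * (T * (u - U)) : ℝ))) := by
      intro t
      have h3 : Complex.exp (Complex.I * (-(t * (T * U)) : ℝ)) * Complex.exp (-linePt T U t * u)
        = Complex.exp (-u) * Complex.exp (-(u / U)) *
          Complex.exp (Complex.I * (t * (T * (u - U)) : ℝ)) := by
        rw [← Complex.exp_add, ← Complex.exp_add, ← Complex.exp_add, linePt]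
        congr 1
        push_cast
        ring
      calc _ = ((T / U * (1 - |t|) : ℝ) : ℂ) * u *
            (Complex.exp (Complex.I * (-(t * (T * U)) : ℝ)) * Complex.exp (-linePt T U t * u)) := by
            rw [hc]; ring
        _ = _ := by
          rw [h3]; push_cast; ring
    simp_rw [this]
    rw [intervalIntegral.integral_const_mul, integral_triangle_mul_exp, weight]
    push_cast
    ring
  rw [mass, if_neg hn, ← integral_complex_ofReal]
  change _ = ∫ t in (-1 : ℝ)..1, c t *
    ((Real.log n / linePt T U t + 1 / linePt T U t ^ 2) * (n : ℂ) ^ (-linePt T U t))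
  simp_rw [e1, ← integral_const_mul]
  rw [intervalIntegral_integral_swap]
  · exact integral_congr_ae (Eventually.of_forall e2)
  · have h0 := (Real.GammaIntegral_convergent two_pos).mono_set (Set.Ioi_subset_Ioi hlog)
    have hb : Integrable (fun _ : ℝ => |T / U|) (volume.restrict (Set.uIoc (-1 : ℝ) 1)) := by
      rw [Set.uIoc_of_le (by norm_num)]
      exact integrable_const _
    refine (hb.mul_prod h0).mono' ?_ ?_
    · refine Continuous.aestronglyMeasurable ?_
      have := continuous_linePt T U
      unfold Function.uncurry
      fun_prop
    · rw [Measure.prod_restrict]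
      refine (ae_restrict_iff' (measurableSet_uIoc.prod measurableSet_Ioi)).mpr
        (Eventually.of_forall fun p hp => ?_)
      have hu0 : 0 < p.2 := lt_of_le_of_lt hlog hp.2
      have e3 : ‖(p.2 : ℂ) * Complex.exp (-linePt T U p.1 * p.2)‖ ≤
          Real.exp (-p.2) * p.2 ^ ((2 : ℝ) - 1) := by
        rw [norm_mul, Complex.norm_exp, Complex.norm_of_nonneg hu0.le, mul_comm]
        norm_num
        gcongr
        have := hre p.1
        nlinarith
      rw [Function.uncurry, norm_mul (c p.1)]
      exact mul_le_mul (hnorm p.1 hp.1) e3 (norm_nonneg _) (abs_nonneg _)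

lemma one_le_norm_linePt {T U t : ℝ} (hU : 0 < U) : 1 ≤ ‖linePt T U t‖ := by
  refine le_trans ?_ (Complex.re_le_norm _)
  rw [linePt_re]
  have : 0 ≤ 1 / U := by positivity
  linarith

lemma norm_linePt_sub_one_rpow_le {T U t α : ℝ} (hU : 0 < U) (hα : 1 / 2 ≤ α) :
    ‖linePt T U t - 1‖ ^ (-α - 1) ≤
      U ^ (α + 1) * (1 + ‖t * (T * U)‖ ^ 2) ^ (-(3 / 2 : ℝ) / 2) := by
  have h1 : ‖linePt T U t - 1‖ = U⁻¹ * (1 + ‖t * (T * U)‖ ^ 2) ^ (1 / 2 : ℝ) := by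
    rw [← Real.sqrt_eq_rpow, Complex.norm_def, Complex.normSq_apply, Complex.sub_re, Complex.sub_im,
      linePt_re, linePt_im, Real.norm_eq_abs, sq_abs]
    rw [← Real.sqrt_sq (inv_nonneg.mpr hU.le), ← Real.sqrt_mul (by positivity)]
    congr 1
    simp
    field_simp
  have hp : (1 : ℝ) ≤ 1 + ‖t * (T * U)‖ ^ 2 := by
    have := sq_nonneg ‖t * (T * U)‖
    linarith
  have hp0 : (0 : ℝ) ≤ 1 + ‖t * (T * U)‖ ^ 2 := by linarith
  rw [h1, Real.mul_rpow (by positivity) (by positivity), Real.inv_rpow hU.le, ← Real.rpow_neg hU.le,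
    ← Real.rpow_mul hp0]
  rw [show -(-α - 1) = α + 1 by ring]
  gcongr ?_ * ?_
  exact Real.rpow_le_rpow_of_exponent_le hp (by linarith)

lemma exists_norm_tsum_mass_le {T : ℝ} (hT : 0 < T) : ∃ C > 0, ∀ U : ℝ, 1 ≤ U → ∀ z : ℂ,
    ‖z‖ ≤ 3 / 2 → Summable (fun n => ‖omegaPow z n * mass T U n‖) ∧
      ‖∑' n, omegaPow z n * mass T U n‖ ≤ C * U ^ (max z.re (1 / 2) - 1) := by
  obtain ⟨C, hC, hbd⟩ := exists_norm_lSeries_omegaPow_le hT.le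
  set J : ℝ := ∫ y : ℝ, (1 + ‖y‖ ^ 2) ^ (-(3 / 2 : ℝ) / 2) with hJ
  have hJ0 : 0 ≤ J := integral_nonneg fun y => by positivity
  have hJi : Integrable (fun y : ℝ => (1 + ‖y‖ ^ 2) ^ (-(3 / 2 : ℝ) / 2)) :=
    integrable_rpow_neg_one_add_norm_sq (by norm_num)
  refine ⟨C * (2 + T) * (J + 1), by positivity, fun U hU1 z hz => ?_⟩
  have hU : 0 < U := by linarith
  set α := max z.re (1 / 2) with hα
  have hα2 : 1 / 2 ≤ α := le_max_right _ _
  set c : ℝ → ℂ := fun t =>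
    ((T / U * (1 - |t|) : ℝ) : ℂ) * Complex.exp (Complex.I * (-(t * (T * U)) : ℝ)) with hc
  have hcc : Continuous c := by rw [hc]; fun_prop
  have hnorm : ∀ t ∈ Set.uIoc (-1 : ℝ) 1, ‖c t‖ ≤ T / U := by
    intro t ht
    rw [Set.uIoc_of_le (by norm_num)] at ht
    have h1 : |t| ≤ 1 := abs_le.mpr ⟨ht.1.le, ht.2⟩
    have h0 := abs_nonneg t
    have hTU : 0 < T / U := by positivity
    rw [hc]
    simp only
    rw [norm_mul, Complex.norm_exp_I_mul_ofReal, mul_one, Complex.norm_real, Real.norm_eq_abs,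
      abs_mul, abs_of_pos hTU]
    have : abs (1 - |t|) ≤ 1 := by rw [abs_le]; constructor <;> linarith
    nlinarith
  set s : ℝ → ℂ := linePt T U with hs
  have hsre : ∀ t, (s t).re = 1 + 1 / U := linePt_re T U
  have hU' : 0 < 1 / U := by positivity
  have hUle : 1 / U ≤ 1 := by rw [div_le_one hU]; exact hU1
  have hs1 : ∀ t, 1 < (s t).re := fun t => by rw [hsre]; linarith
  have hab : ∀ t, LSeries.abscissaOfAbsConv (omegaPow z) < (s t).re := fun t =>
    lt_of_le_of_lt (abscissaOfAbsConv_omegaPow_le hz) (by exact_mod_cast hs1 t)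
  have hsum : ∀ t, LSeriesSummable (omegaPow z) (s t) := fun t =>
    lSeriesSummable_omegaPow hz (hs1 t)
  have hsum' : ∀ t, LSeriesSummable (LSeries.logMul (omegaPow z)) (s t) := fun t =>
    LSeriesSummable_logMul_of_lt_re (hab t)
  set F : ℕ → ℝ → ℂ := fun n t => c t * (LSeries.term (LSeries.logMul (omegaPow z)) (s t) n / s t
    + LSeries.term (omegaPow z) (s t) n / s t ^ 2) with hF
  set b : ℕ → ℝ := fun n => T / U * (‖LSeries.term (LSeries.logMul (omegaPow z)) (s 0) n‖
    + ‖LSeries.term (omegaPow z) (s 0) n‖) with hb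
  have hbs : Summable b := ((hsum' 0).norm.add (hsum 0).norm).mul_left _
  have hterm : ∀ (f : ℕ → ℂ) (t : ℝ) (n : ℕ),
      ‖LSeries.term f (s t) n‖ = ‖LSeries.term f (s 0) n‖ := by
    intro f t n
    rw [LSeries.norm_term_eq, LSeries.norm_term_eq, hsre, hsre]
  have hs1n : ∀ t, 1 ≤ ‖s t‖ := fun t => one_le_norm_linePt hU
  have hFb : ∀ n, ∀ t ∈ Set.uIoc (-1 : ℝ) 1, ‖F n t‖ ≤ b n := by
    intro n t ht
    rw [hF, hb]
    simp only
    rw [norm_mul]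
    refine mul_le_mul (hnorm t ht) ?_ (norm_nonneg _) (by positivity)
    refine (norm_add_le _ _).trans ?_
    rw [norm_div, norm_div, norm_pow, hterm, hterm (omegaPow z)]
    exact add_le_add (div_le_self (norm_nonneg _) (hs1n t))
      (div_le_self (norm_nonneg _) (one_le_pow₀ (hs1n t)))
  have hmass : ∀ n, omegaPow z n * mass T U n = ∫ t in (-1 : ℝ)..1, F n t := by
    intro n
    rcases eq_or_ne n 0 with rfl | hn
    · simp [mass, hF]
    · rw [mass_eq_integral hU hn, ← intervalIntegral.integral_const_mul]
      refine intervalIntegral.integral_congr fun t _ => ?_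
      simp only [hF, LSeries.term_def, if_neg hn, LSeries.logMul, hc, hs, Complex.cpow_neg,
        Complex.natCast_log]
      ring
  have hsne : ∀ t, s t ≠ 0 := fun t h => by
    have := hs1n t
    rw [h, norm_zero] at this
    linarith
  have hscont : Continuous s := continuous_linePt T U
  have hcont : ∀ n, Continuous (F n) := by
    intro n
    rcases eq_or_ne n 0 with rfl | hn
    · simp only [hF, LSeries.term_zero, zero_div, add_zero, mul_zero]
      exact continuous_const
    · have hn' : (n : ℂ) ≠ 0 := by exact_mod_cast hn
      simp only [hF, LSeries.term_def, if_neg hn, div_eq_mul_inv, ← Complex.cpow_neg]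
      have hp : Continuous fun t => (n : ℂ) ^ (-s t) :=
        hscont.neg.const_cpow (Or.inl hn')
      exact hcc.mul (((continuous_const.mul hp).mul (hscont.inv₀ hsne)).add
        ((continuous_const.mul hp).mul ((hscont.pow 2).inv₀ fun t => pow_ne_zero 2 (hsne t))))
  set f : ℝ → ℂ := fun t => c t * (-deriv (LSeries (omegaPow z)) (s t) / s t
    + LSeries (omegaPow z) (s t) / s t ^ 2) with hf
  have hhas : HasSum (fun n => ∫ t in (-1 : ℝ)..1, F n t) (∫ t in (-1 : ℝ)..1, f t) := by
    refine intervalIntegral.hasSum_integral_of_dominated_convergence (fun n _ => b n)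
      (fun n => (hcont n).aestronglyMeasurable) (fun n => Eventually.of_forall (hFb n))
      (Eventually.of_forall fun _ _ => hbs) (by simp) (Eventually.of_forall fun t _ => ?_)
    rw [hf]
    simp only
    rw [LSeries_deriv (hab t), neg_neg]
    exact (((hsum' t).LSeriesHasSum.div_const _).add ((hsum t).LSeriesHasSum.div_const _)).mul_left _
  simp_rw [hmass]
  constructor
  · refine (hbs.mul_right |1 - (-1 : ℝ)|).of_nonneg_of_le (fun n => norm_nonneg _) fun n => ?_
    exact intervalIntegral.norm_integral_le_of_norm_le_const (hFb n)
  · rw [hhas.tsum_eq]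
    set K : ℝ := T / U * (C * (2 + T)) * U ^ (α + 1) with hK
    have hfb : ∀ t ∈ Set.Ioc (-1 : ℝ) 1,
        ‖f t‖ ≤ K * (1 + ‖t * (T * U)‖ ^ 2) ^ (-(3 / 2 : ℝ) / 2) := by
      intro t ht
      have h1 : |t| ≤ 1 := abs_le.mpr ⟨ht.1.le, ht.2⟩
      obtain ⟨b1, b2⟩ := hbd z hz (s t) (hs1 t) (by rw [hsre]; linarith) (by
        rw [hs, linePt_im, abs_neg, abs_mul, abs_of_pos hT]
        nlinarith)
      have hsm : ‖s t - 1‖ ≤ 1 + T := by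
        rw [show s t - 1 = ((1 / U : ℝ) : ℂ) - Complex.I * ((t * T : ℝ) : ℂ) by
          rw [hs, linePt]; push_cast; ring]
        refine (norm_sub_le _ _).trans ?_
        rw [norm_mul, Complex.norm_I, one_mul, Complex.norm_real, Complex.norm_real,
          Real.norm_eq_abs, Real.norm_eq_abs, abs_mul, abs_of_pos hU', abs_of_pos hT]
        nlinarith
      have hs0 : 0 < ‖s t - 1‖ := by
        rw [norm_pos_iff, sub_ne_zero]
        intro h
        have := hs1 t
        rw [h] at this
        simp at this
      have b1' : ‖LSeries (omegaPow z) (s t)‖ ≤ C * ((1 + T) * ‖s t - 1‖ ^ (-α - 1)) := by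
        refine b1.trans ?_
        have : ‖s t - 1‖ ^ (-α) = ‖s t - 1‖ * ‖s t - 1‖ ^ (-α - 1) := by
          rw [mul_comm, ← Real.rpow_add_one hs0.ne']
          congr 1
          ring
        rw [this]
        gcongr
      have hq := norm_linePt_sub_one_rpow_le (T := T) (t := t) hU hα2
      calc ‖f t‖ ≤ T / U * (‖deriv (LSeries (omegaPow z)) (s t)‖ + ‖LSeries (omegaPow z) (s t)‖) := by
            rw [hf]
            simp only
            rw [norm_mul]
            refine mul_le_mul (hnorm t ?_) ?_ (norm_nonneg _) (by positivity)
            · rw [Set.uIoc_of_le (by norm_num)]; exact ht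
            refine (norm_add_le _ _).trans ?_
            rw [norm_div, norm_div, norm_pow, norm_neg]
            gcongr
            · exact div_le_self (norm_nonneg _) (hs1n t)
            · exact div_le_self (norm_nonneg _) (one_le_pow₀ (hs1n t))
        _ ≤ T / U * (C * ‖s t - 1‖ ^ (-α - 1) + C * ((1 + T) * ‖s t - 1‖ ^ (-α - 1))) := by
            gcongr
        _ = T / U * (C * (2 + T)) * ‖s t - 1‖ ^ (-α - 1) := by ring
        _ ≤ T / U * (C * (2 + T)) *
            (U ^ (α + 1) * (1 + ‖t * (T * U)‖ ^ 2) ^ (-(3 / 2 : ℝ) / 2)) := by gcongr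
        _ = _ := by rw [hK]; ring
    have hK0 : 0 ≤ K := by positivity
    have hTU : 0 < T * U := by positivity
    refine (intervalIntegral.norm_integral_le_of_norm_le (by norm_num)
      (Eventually.of_forall hfb) ?_).trans ?_
    · exact (((hJi.comp_mul_right' hTU.ne').const_mul K)).intervalIntegrable
    rw [intervalIntegral.integral_const_mul, intervalIntegral.integral_comp_mul_right
      (fun y : ℝ => (1 + ‖y‖ ^ 2) ^ (-(3 / 2 : ℝ) / 2)) hTU.ne', smul_eq_mul]
    have hle : ∫ y in (-1 * (T * U))..(1 * (T * U)), (1 + ‖y‖ ^ 2) ^ (-(3 / 2 : ℝ) / 2) ≤ J + 1 := by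
      rw [intervalIntegral.integral_of_le (by linarith)]
      refine (setIntegral_le_integral hJi (Eventually.of_forall fun y => by positivity)).trans ?_
      linarith
    calc K * ((T * U)⁻¹ * _) ≤ K * ((T * U)⁻¹ * (J + 1)) := by gcongr
      _ = C * (2 + T) * (J + 1) * (U ^ (α + 1) / U ^ (2 : ℝ)) := by
        rw [hK, Real.rpow_two]
        field_simp
      _ = _ := by
        rw [← Real.rpow_sub hU]
        congr 2
        ring

/-- The total mass of the integers with exactly `k` prime factors. -/
noncomputable def fiberMass (T U : ℝ) (k : ℕ) : ℝ :=
  ∑' n : ↑(smallOmega ⁻¹' {k}), mass T U n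

lemma hasSum_fiberMass {T U : ℝ} {φ : ℕ → ℂ}
    (h : Summable fun n => φ (smallOmega n) * (mass T U n : ℂ)) :
    HasSum (fun k => φ k * (fiberMass T U k : ℂ)) (∑' n, φ (smallOmega n) * (mass T U n : ℂ)) := by
  refine (h.hasSum.tsum_fiberwise smallOmega).congr_fun fun k => ?_
  rw [fiberMass, Complex.ofReal_tsum, ← tsum_mul_left]
  exact tsum_congr fun b => by rw [show smallOmega b = k from b.2]

/-- The Selberg–Delange type bounds on the generating function of a sequence of masses. -/
def SelbergBound (C U : ℝ) (Q : ℕ → ℝ) : Prop :=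
  (∀ k, 0 ≤ Q k) ∧ ∀ z : ℂ, ‖z‖ ≤ 3 / 2 → Summable (fun k => z ^ k * (Q k : ℂ)) ∧
    ‖∑' k, z ^ k * (Q k : ℂ)‖ ≤ C * U ^ (max z.re (1 / 2) - 1)

lemma exists_selbergBound {T : ℝ} (hT : 0 < T) :
    ∃ C > 0, ∀ U : ℝ, 1 ≤ U → SelbergBound C U (fiberMass T U) := by
  obtain ⟨C, hC, h⟩ := exists_norm_tsum_mass_le hT
  refine ⟨C, hC, fun U hU => ⟨fun k => tsum_nonneg fun n => mass_nonneg hT.le (by linarith) _,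
    fun z hz => ?_⟩⟩
  obtain ⟨h1, h2⟩ := h U hU z hz
  have := hasSum_fiberMass (T := T) (U := U) (φ := fun k => z ^ k) h1.of_norm
  refine ⟨this.summable, ?_⟩
  rw [this.tsum_eq]
  exact h2

namespace SelbergBound

variable {C U : ℝ} {Q : ℕ → ℝ}

lemma hasSum_real (h : SelbergBound C U Q) {r : ℝ} (hr : 1 / 2 ≤ r) (hr' : r ≤ 3 / 2) :
    Summable (fun k => r ^ k * Q k) ∧ ∑' k, r ^ k * Q k ≤ C * U ^ (r - 1) := by
  have hn : ‖(r : ℂ)‖ ≤ 3 / 2 := by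
    rw [Complex.norm_of_nonneg (by linarith)]; exact hr'
  obtain ⟨h1, h2⟩ := h.2 r hn
  rw [Complex.ofReal_re, max_eq_left hr] at h2
  have e : ∀ k, (r : ℂ) ^ k * (Q k : ℂ) = ((r ^ k * Q k : ℝ) : ℂ) := fun k => by push_cast; rfl
  simp_rw [e] at h1 h2
  rw [← Complex.ofReal_tsum, Complex.norm_real] at h2
  exact ⟨Complex.summable_ofReal.mp h1, (le_abs_self _).trans h2⟩

lemma summable (h : SelbergBound C U Q) : Summable Q := by
  simpa using (h.hasSum_real (r := 1) (by norm_num) (by norm_num)).1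

lemma tsum_le (h : SelbergBound C U Q) : ∑' k, Q k ≤ C := by
  simpa using (h.hasSum_real (r := 1) (by norm_num) (by norm_num)).2

lemma tsum_exp_le (h : SelbergBound C U Q) (hC : 0 ≤ C) (hU : 0 < U) (hL : 16 ≤ Real.log U) {δ : ℝ}
    (hδ : |δ| = 1 / √(Real.log U)) :
    Summable (fun k : ℕ => Real.exp (δ * (k - Real.log U)) * Q k) ∧
      ∑' k : ℕ, Real.exp (δ * (k - Real.log U)) * Q k ≤ 3 * C := by
  set L := Real.log U with hLdef
  have hsq : 4 ≤ √L := by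
    rw [show (4 : ℝ) = √16 by rw [show (16 : ℝ) = 4 ^ 2 by norm_num, Real.sqrt_sq (by norm_num)]]
    exact Real.sqrt_le_sqrt hL
  have hδ4 : |δ| ≤ 1 / 4 := by
    rw [hδ]
    gcongr
  have hδ2 : δ ^ 2 * L = 1 := by
    rw [← sq_abs, hδ, div_pow, Real.sq_sqrt (by linarith)]
    field_simp
  have hx := Real.abs_exp_sub_one_sub_id_le (x := δ) (by linarith)
  have hx1 := abs_le.mp hx
  have hd := abs_le.mp hδ4
  have hr : 1 / 2 ≤ Real.exp δ := by nlinarith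
  have hr' : Real.exp δ ≤ 3 / 2 := by nlinarith
  obtain ⟨s1, s2⟩ := h.hasSum_real hr hr'
  have e : ∀ k : ℕ, Real.exp (δ * (k - L)) * Q k
      = Real.exp (-(δ * L)) * (Real.exp δ ^ k * Q k) := by
    intro k
    rw [← Real.exp_nat_mul, ← mul_assoc, ← Real.exp_add]
    congr 2
    ring
  simp_rw [e]
  refine ⟨s1.mul_left _, ?_⟩
  rw [tsum_mul_left]
  calc _ ≤ Real.exp (-(δ * L)) * (C * U ^ (Real.exp δ - 1)) := by gcongr
    _ = C * Real.exp (L * (Real.exp δ - 1 - δ)) := by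
      rw [Real.rpow_def_of_pos hU, mul_left_comm, ← Real.exp_add]
      congr 2
      ring
    _ ≤ C * Real.exp 1 := by
      gcongr
      nlinarith
    _ ≤ _ := by
      have := Real.exp_one_lt_d9
      nlinarith

lemma tsum_tail_le (h : SelbergBound C U Q) (hC : 0 ≤ C) (hU : 0 < U) (hL : 16 ≤ Real.log U) (A : ℝ) :
    ∑' k : ℕ, (if A * √(Real.log U) < |(k : ℝ) - Real.log U| then Q k else 0)
      ≤ 6 * C * Real.exp (-A) := by
  set L := Real.log U with hLdef
  have hs : 0 < √L := Real.sqrt_pos.mpr (by linarith)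
  have hp : 0 < 1 / √L := by positivity
  obtain ⟨s1, t1⟩ := h.tsum_exp_le hC hU hL (δ := 1 / √L) (abs_of_pos hp)
  obtain ⟨s2, t2⟩ := h.tsum_exp_le hC hU hL (δ := -(1 / √L)) (by rw [abs_neg, abs_of_pos hp])
  rw [← hLdef] at s1 t1 s2 t2
  have key : ∀ k : ℕ, (if A * √L < |(k : ℝ) - L| then Q k else 0) ≤
      Real.exp (-A) * (Real.exp (1 / √L * (k - L)) * Q k + Real.exp (-(1 / √L) * (k - L)) * Q k) := by
    intro k
    have hQ := h.1 k
    split_ifs with hk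
    · have h1 : A ≤ 1 / √L * |(k : ℝ) - L| := by
        rw [one_div, inv_mul_eq_div, le_div_iff₀ hs]
        exact hk.le
      have h2 : 1 ≤ Real.exp (-A) * (Real.exp (1 / √L * (k - L)) + Real.exp (-(1 / √L) * (k - L))) := by
        rw [mul_add, ← Real.exp_add, ← Real.exp_add]
        rcases abs_cases ((k : ℝ) - L) with ⟨h3, _⟩ | ⟨h3, _⟩
        · rw [h3] at h1
          have := Real.one_le_exp (show 0 ≤ -A + 1 / √L * (k - L) by linarith)
          have := Real.exp_nonneg (-A + -(1 / √L) * (k - L))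
          linarith
        · rw [h3] at h1
          have := Real.one_le_exp (show 0 ≤ -A + -(1 / √L) * (k - L) by linarith)
          have := Real.exp_nonneg (-A + 1 / √L * (k - L))
          linarith
      nlinarith
    · positivity
  have hsum := (s1.add s2).mul_left (Real.exp (-A))
  have hsum' : Summable fun k : ℕ => (if A * √L < |(k : ℝ) - L| then Q k else 0) :=
    hsum.of_nonneg_of_le (fun k => by split_ifs; exacts [h.1 k, le_rfl]) key
  refine (hsum'.tsum_le_tsum key hsum).trans ?_
  rw [tsum_mul_left, s1.tsum_add s2]
  have := Real.exp_pos (-A)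
  nlinarith

lemma norm_summable (h : SelbergBound C U Q) {G : ℕ → ℂ} (hG : ∀ k, ‖G k‖ ≤ 1) :
    Summable (fun k => ‖G k * (Q k : ℂ)‖) := by
  refine h.summable.of_nonneg_of_le (fun k => norm_nonneg _) fun k => ?_
  rw [norm_mul, Complex.norm_of_nonneg (h.1 k)]
  exact mul_le_of_le_one_left (h.1 k) (hG k)

lemma continuous_tsum_expChar (h : SelbergBound C U Q) :
    Continuous fun θ : ℝ => ∑' j, expChar θ ^ j * (Q j : ℂ) := by
  refine continuous_tsum (u := Q) (fun j => ?_) h.summable fun j θ => ?_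
  · unfold expChar; fun_prop
  · rw [norm_mul, norm_pow, norm_expChar, one_pow, one_mul, Complex.norm_of_nonneg (h.1 j)]

lemma norm_tsum_expChar_le (h : SelbergBound C U Q) (hC : 0 ≤ C) (hU : 1 ≤ U) {θ : ℝ}
    (hθ : |θ| ≤ 1 / 2) : ‖∑' j, expChar θ ^ j * (Q j : ℂ)‖ ≤
      C * Real.exp (-(2 * Real.log U) * θ ^ 2) := by
  refine (h.2 (expChar θ) (by rw [norm_expChar]; norm_num)).2.trans ?_
  rw [Real.rpow_def_of_pos (by linarith)]
  have hL := Real.log_nonneg hU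
  have hre : (expChar θ).re = Real.cos (2 * Real.pi * θ) := by
    rw [expChar, mul_comm Complex.I, Complex.exp_ofReal_mul_I_re]
  have hpi := Real.pi_pos
  have h1 : Real.cos (2 * Real.pi * θ) ≤ 1 - 2 * θ ^ 2 := by
    have := Real.cos_le_one_sub_mul_cos_sq (x := 2 * Real.pi * θ) (by
      rw [abs_mul, abs_of_pos (by positivity)]; nlinarith)
    refine this.trans ?_
    have e : 2 / Real.pi ^ 2 * (2 * Real.pi * θ) ^ 2 = 8 * θ ^ 2 := by
      field_simp
      ring
    rw [e]
    nlinarith [sq_nonneg θ]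
  have h2 : max (expChar θ).re (1 / 2) - 1 ≤ -2 * θ ^ 2 := by
    have : θ ^ 2 ≤ 1 / 4 := by
      rw [← sq_abs]; nlinarith [abs_nonneg θ]
    rw [hre]
    rcases max_cases (Real.cos (2 * Real.pi * θ)) (1 / 2 : ℝ) with ⟨h3, _⟩ | ⟨h3, _⟩ <;> rw [h3] <;>
      linarith
  refine mul_le_mul_of_nonneg_left (Real.exp_le_exp.mpr ?_) hC
  have := mul_le_mul_of_nonneg_left h2 hL
  linarith

lemma integral_expChar_int (m : ℤ) :
    ∫ θ in (-(1 / 2) : ℝ)..(1 / 2), expChar (m * θ) = if m = 0 then 1 else 0 := by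
  split_ifs with hm
  · simp only [hm, Int.cast_zero, zero_mul, expChar_zero, intervalIntegral.integral_const]
    norm_num
  · have hm' : (m : ℂ) ≠ 0 := by exact_mod_cast hm
    have hne : Complex.I * (2 * Real.pi * m) ≠ 0 :=
      mul_ne_zero Complex.I_ne_zero (mul_ne_zero (by simp [Real.pi_ne_zero]) hm')
    have e : ∀ θ : ℝ, expChar (m * θ) = Complex.exp (Complex.I * (2 * Real.pi * m) * θ) := by
      intro θ
      rw [expChar]
      congr 1
      push_cast
      ring
    simp_rw [e]
    rw [integral_exp_mul_complex hne, div_eq_zero_iff]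
    left
    rw [sub_eq_zero, Complex.exp_eq_exp_iff_exists_int]
    refine ⟨m, ?_⟩
    push_cast
    ring

lemma coeff_eq_integral (h : SelbergBound C U Q) (k : ℕ) :
    (Q k : ℂ) = ∫ θ in (-(1 / 2) : ℝ)..(1 / 2),
      (∑' j, expChar θ ^ j * (Q j : ℂ)) * expChar (-(k * θ)) := by
  have hexp : ∀ j : ℕ, ∀ θ : ℝ, expChar θ ^ j * (Q j : ℂ) * expChar (-(k * θ))
      = expChar (((j : ℤ) - (k : ℤ) : ℤ) * θ) * Q j := by
    intro j θ
    rw [← expChar_nat_mul, mul_right_comm, ← expChar_add]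
    congr 2
    push_cast
    ring
  have hcont : Continuous expChar := by unfold expChar; fun_prop
  have hs : HasSum (fun j : ℕ => ∫ θ in (-(1 / 2) : ℝ)..(1 / 2),
      expChar (((j : ℤ) - (k : ℤ) : ℤ) * θ) * (Q j : ℂ))
      (∫ θ in (-(1 / 2) : ℝ)..(1 / 2),
      (∑' j, expChar θ ^ j * (Q j : ℂ)) * expChar (-(k * θ))) := by
    refine intervalIntegral.hasSum_integral_of_dominated_convergence (fun n _ => Q n)
      (fun n => Continuous.aestronglyMeasurable ?_) (fun n => Eventually.of_forall fun θ _ => ?_)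
      (Eventually.of_forall fun _ _ => h.summable) (by simp) (Eventually.of_forall fun θ _ => ?_)
    · exact (hcont.comp (continuous_const.mul continuous_id)).mul continuous_const
    · rw [norm_mul, norm_expChar, one_mul, Complex.norm_of_nonneg (h.1 n)]
    · simp_rw [← hexp]
      exact ((h.2 (expChar θ) (by rw [norm_expChar]; norm_num)).1.hasSum).mul_right _
  simp_rw [intervalIntegral.integral_mul_const, integral_expChar_int, ite_mul, zero_mul, one_mul,
    sub_eq_zero, Nat.cast_inj] at hs
  rw [← hs.tsum_eq, tsum_eq_single k (fun b hb => if_neg hb), if_pos rfl]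

lemma intervalIntegral_exp_neg_mul_sq_le {b : ℝ} (hb : 0 < b) :
    ∫ θ in (-(1 / 2) : ℝ)..(1 / 2), Real.exp (-b * θ ^ 2) ≤ 2 / √b := by
  rw [intervalIntegral.integral_of_le (by norm_num)]
  refine (setIntegral_le_integral (integrable_exp_neg_mul_sq hb)
    (Eventually.of_forall fun θ => Real.exp_nonneg _)).trans ?_
  rw [integral_gaussian, Real.sqrt_div Real.pi_pos.le]
  gcongr
  rw [Real.sqrt_le_left (by norm_num)]
  have := Real.pi_lt_four
  linarith

lemma coeff_le (h : SelbergBound C U Q) (hC : 0 ≤ C) (hU : 1 ≤ U) (hL : 0 < Real.log U) (k : ℕ) :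
    Q k ≤ 2 * C / √(Real.log U) := by
  have e : Q k = ‖(Q k : ℂ)‖ := (Complex.norm_of_nonneg (h.1 k)).symm
  rw [e, h.coeff_eq_integral k]
  have hb : ∀ θ ∈ Set.Ioc (-(1 / 2) : ℝ) (1 / 2),
      ‖(∑' j, expChar θ ^ j * (Q j : ℂ)) * expChar (-(k * θ))‖ ≤
        C * Real.exp (-(Real.log U) * θ ^ 2) := by
    intro θ hθ
    rw [norm_mul, norm_expChar, mul_one]
    refine (h.norm_tsum_expChar_le hC hU (abs_le.mpr ⟨hθ.1.le, hθ.2⟩)).trans ?_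
    gcongr
    linarith
  refine (intervalIntegral.norm_integral_le_of_norm_le (by norm_num) (Eventually.of_forall hb)
    (Continuous.intervalIntegrable (by fun_prop) _ _)).trans ?_
  rw [intervalIntegral.integral_const_mul]
  have := mul_le_mul_of_nonneg_left (intervalIntegral_exp_neg_mul_sq_le hL) hC
  refine this.trans (le_of_eq ?_)
  ring

lemma abs_coeff_succ_sub_le (h : SelbergBound C U Q) (hC : 0 ≤ C) (hU : 1 ≤ U)
    (hL : 0 < Real.log U) (k : ℕ) : |Q (k + 1) - Q k| ≤ 16 * C / Real.log U := by
  set L := Real.log U with hLdef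
  have hcont : Continuous expChar := by unfold expChar; fun_prop
  have hi : ∀ k : ℕ, IntervalIntegrable (fun θ : ℝ => (∑' j, expChar θ ^ j * (Q j : ℂ)) *
      expChar (-(k * θ))) volume (-(1 / 2)) (1 / 2) := fun k =>
    (h.continuous_tsum_expChar.mul
      (hcont.comp (continuous_const.mul continuous_id).neg)).intervalIntegrable _ _
  have e : |Q (k + 1) - Q k| = ‖(Q (k + 1) : ℂ) - Q k‖ := by
    rw [← Complex.ofReal_sub, Complex.norm_real, Real.norm_eq_abs]
  rw [e, h.coeff_eq_integral k, h.coeff_eq_integral (k + 1),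
    ← intervalIntegral.integral_sub (hi (k + 1)) (hi k)]
  have hs : 0 < √L := Real.sqrt_pos.mpr hL
  have hb : ∀ θ ∈ Set.Ioc (-(1 / 2) : ℝ) (1 / 2),
      ‖(∑' j, expChar θ ^ j * (Q j : ℂ)) * expChar (-((k + 1 : ℕ) * θ)) -
        (∑' j, expChar θ ^ j * (Q j : ℂ)) * expChar (-(k * θ))‖ ≤
        8 * C / √L * Real.exp (-L * θ ^ 2) := by
    intro θ hθ
    have e1 : expChar (-((k + 1 : ℕ) * θ)) = expChar (-(k * θ)) * expChar (-θ) := by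
      rw [← expChar_add]
      congr 1
      push_cast
      ring
    rw [e1, ← mul_sub, norm_mul, ← mul_sub_one, norm_mul, norm_expChar, one_mul]
    have h1 := h.norm_tsum_expChar_le hC hU (abs_le.mpr ⟨hθ.1.le, hθ.2⟩)
    have h2 := norm_expChar_sub_one_le (-θ)
    rw [abs_neg] at h2
    have h3 : √L * |θ| ≤ Real.exp (L * θ ^ 2) := by
      have h4 := Real.add_one_le_exp (L * θ ^ 2)
      have h5 : (√L * |θ|) ^ 2 = L * θ ^ 2 := by
        rw [mul_pow, Real.sq_sqrt hL.le, sq_abs]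
      nlinarith [sq_nonneg (√L * |θ| - 1)]
    have hpi := Real.pi_lt_four
    have hpi0 := Real.pi_pos
    calc _ ≤ (C * Real.exp (-(2 * L) * θ ^ 2)) * (2 * Real.pi * |θ|) := by gcongr
      _ ≤ (C * Real.exp (-(2 * L) * θ ^ 2)) * (2 * 4 * (Real.exp (L * θ ^ 2) / √L)) := by
        gcongr
        rw [le_div_iff₀ hs, mul_comm]
        exact h3
      _ = 8 * C / √L * (Real.exp (-(2 * L) * θ ^ 2) * Real.exp (L * θ ^ 2)) := by ring
      _ = _ := by
        rw [← Real.exp_add]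
        congr 2
        ring
  refine (intervalIntegral.norm_integral_le_of_norm_le (by norm_num) (Eventually.of_forall hb)
    (Continuous.intervalIntegrable (by fun_prop) _ _)).trans ?_
  rw [intervalIntegral.integral_const_mul]
  calc _ ≤ 8 * C / √L * (2 / √L) := by
        gcongr
        exact intervalIntegral_exp_neg_mul_sq_le hL
    _ = 16 * C / √L ^ 2 := by ring
    _ = _ := by rw [Real.sq_sqrt hL.le]

lemma norm_rpow_mul_tsum_sub_le (h : SelbergBound C U Q) (hU : 1 ≤ U) {z : ℂ}
    (hz : ‖z - 1‖ < 1 / 2) :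
    ‖(U : ℂ) ^ (1 - z) * ∑' k, z ^ k * (Q k : ℂ) - ((∑' k, Q k : ℝ) : ℂ)‖ ≤ 4 * C * ‖z - 1‖ := by
  have hU0 : 0 < U := by linarith
  set g : ℂ → ℂ := fun z => (U : ℂ) ^ (1 - z) * ∑' k, z ^ k * (Q k : ℂ) with hg
  have hball : ∀ w ∈ Metric.ball (1 : ℂ) (1 / 2), ‖w‖ ≤ 3 / 2 := by
    intro w hw
    rw [Metric.mem_ball, dist_eq_norm] at hw
    have := norm_add_le (w - 1) 1
    rw [sub_add_cancel, norm_one] at this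
    linarith
  have hu : Summable (fun k => (3 / 2 : ℝ) ^ k * Q k) := (h.hasSum_real (by norm_num) le_rfl).1
  have hd : DifferentiableOn ℂ g (Metric.ball 1 (1 / 2)) := by
    refine DifferentiableOn.mul ?_ ?_
    · refine DifferentiableOn.const_cpow (by fun_prop) (Or.inl ?_)
      exact_mod_cast hU0.ne'
    · refine Complex.differentiableOn_tsum_of_summable_norm hu (fun k => by fun_prop)
        Metric.isOpen_ball fun k w hw => ?_
      rw [norm_mul, norm_pow, Complex.norm_of_nonneg (h.1 k)]
      have := h.1 k
      have := hball w hw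
      gcongr
  have hb : ∀ w ∈ Metric.ball (1 : ℂ) (1 / 2), ‖g w‖ ≤ C := by
    intro w hw
    have hre : 1 / 2 ≤ w.re := by
      rw [Metric.mem_ball, dist_eq_norm] at hw
      have := (Complex.abs_re_le_norm (w - 1)).trans hw.le
      rw [Complex.sub_re, Complex.one_re, abs_le] at this
      linarith [this.1]
    have h1 := (h.2 w (hball w hw)).2
    rw [max_eq_left hre] at h1
    rw [hg]
    simp only
    rw [norm_mul, Complex.norm_cpow_eq_rpow_re_of_pos hU0]
    calc _ ≤ U ^ (1 - w).re * (C * U ^ (w.re - 1)) := by gcongr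
      _ = C * (U ^ (1 - w.re) * U ^ (w.re - 1)) := by
        rw [Complex.sub_re, Complex.one_re]; ring
      _ = C := by
        rw [← Real.rpow_add hU0]
        simp
  have h1 : (1 : ℂ) ∈ Metric.ball (1 : ℂ) (1 / 2) := Metric.mem_ball_self (by norm_num)
  have hg1 : g 1 = ((∑' k, Q k : ℝ) : ℂ) := by
    rw [hg, Complex.ofReal_tsum]
    simp
  have key := Complex.dist_le_div_mul_dist_of_mapsTo_ball (R₂ := 2 * C) hd (fun w hw => by
    rw [Metric.mem_closedBall, dist_eq_norm]
    have := norm_sub_le (g w) (g 1)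
    linarith [hb w hw, hb 1 h1]) (z := z) (by rw [Metric.mem_ball, dist_eq_norm]; exact hz)
  rw [dist_eq_norm, dist_eq_norm, hg1] at key
  refine key.trans (le_of_eq ?_)
  ring

end SelbergBound

/-- The mean of the first `exp u` terms of a sequence. -/
noncomputable def expAvg (a : ℕ → ℂ) (u : ℝ) : ℂ :=
  Real.exp (-u) * ∑ n ∈ Icc 1 ⌊Real.exp u⌋₊, a n

lemma norm_sum_Icc_le {a : ℕ → ℂ} (ha : ∀ n, ‖a n‖ ≤ 1) (u : ℝ) :
    ‖∑ n ∈ Icc 1 ⌊Real.exp u⌋₊, a n‖ ≤ Real.exp u := by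
  refine (norm_sum_le _ _).trans ((sum_le_sum fun n _ => ha n).trans ?_)
  rw [sum_const, Nat.card_Icc, nsmul_eq_mul, mul_one, Nat.add_sub_cancel]
  exact Nat.floor_le (Real.exp_nonneg u)

lemma norm_expAvg_le {a : ℕ → ℂ} (ha : ∀ n, ‖a n‖ ≤ 1) (u : ℝ) : ‖expAvg a u‖ ≤ 1 := by
  rw [expAvg, norm_mul, Complex.norm_of_nonneg (Real.exp_nonneg _)]
  calc _ ≤ Real.exp (-u) * Real.exp u := by
        gcongr
        exact norm_sum_Icc_le ha u
    _ = 1 := by rw [← Real.exp_add]; simp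

lemma norm_expAvg_sub_le_of_le {a : ℕ → ℂ} (ha : ∀ n, ‖a n‖ ≤ 1) {p q : ℝ} (hpq : p ≤ q) :
    ‖expAvg a q - expAvg a p‖ ≤ 2 * (q - p) + Real.exp (-q) := by
  have hexp : Real.exp p ≤ Real.exp q := Real.exp_le_exp.mpr hpq
  have hfl : ⌊Real.exp p⌋₊ ≤ ⌊Real.exp q⌋₊ := Nat.floor_le_floor hexp
  set S : ℝ → ℂ := fun u => ∑ n ∈ Icc 1 ⌊Real.exp u⌋₊, a n with hS
  have h1 : ‖S q - S p‖ ≤ Real.exp q - Real.exp p + 1 := by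
    have e : S q - S p = ∑ n ∈ Ioc ⌊Real.exp p⌋₊ ⌊Real.exp q⌋₊, a n := by
      rw [sub_eq_iff_eq_add', hS]
      simp only
      rw [← Finset.sum_union]
      · congr 1
        ext n
        simp only [mem_union, mem_Icc, mem_Ioc]
        omega
      · rw [Finset.disjoint_left]
        intro n h1 h2
        simp only [mem_Icc, mem_Ioc] at h1 h2
        omega
    rw [e]
    refine (norm_sum_le _ _).trans ((sum_le_sum fun n _ => ha n).trans ?_)
    rw [sum_const, Nat.card_Ioc, nsmul_eq_mul, mul_one, Nat.cast_sub hfl]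
    have := Nat.floor_le (Real.exp_nonneg q)
    have := Nat.lt_floor_add_one (Real.exp p)
    linarith
  have h2 : ‖S p‖ ≤ Real.exp p := norm_sum_Icc_le ha p
  have e : expAvg a q - expAvg a p
      = Real.exp (-q) * (S q - S p) - ((Real.exp (-p) - Real.exp (-q) : ℝ) : ℂ) * S p := by
    rw [expAvg, expAvg, hS]
    push_cast
    ring
  have hneg : 0 ≤ Real.exp (-p) - Real.exp (-q) := by
    rw [sub_nonneg, Real.exp_le_exp]
    linarith
  rw [e]
  refine (norm_sub_le _ _).trans ?_
  rw [norm_mul, norm_mul, Complex.norm_of_nonneg (Real.exp_nonneg _), Complex.norm_of_nonneg hneg]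
  have e1 : Real.exp (-q) * Real.exp q = 1 := by rw [← Real.exp_add]; simp
  have e2 : Real.exp (-p) * Real.exp p = 1 := by rw [← Real.exp_add]; simp
  have e3 : 1 - (q - p) ≤ Real.exp (-q) * Real.exp p := by
    rw [← Real.exp_add]
    have := Real.add_one_le_exp (-q + p)
    linarith
  have h3 := mul_le_mul_of_nonneg_left h1 (Real.exp_nonneg (-q))
  have h4 := mul_le_mul_of_nonneg_left h2 hneg
  nlinarith

lemma norm_expAvg_sub_le {a : ℕ → ℂ} (ha : ∀ n, ‖a n‖ ≤ 1) {p q δ : ℝ} (hpq : |p - q| ≤ δ) :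
    ‖expAvg a q - expAvg a p‖ ≤ 2 * δ + Real.exp (-(q - δ)) := by
  rw [abs_le] at hpq
  rcases le_total p q with h | h
  · refine (norm_expAvg_sub_le_of_le ha h).trans ?_
    gcongr
    · linarith
    · linarith
  · rw [norm_sub_rev]
    refine (norm_expAvg_sub_le_of_le ha h).trans ?_
    gcongr
    · linarith
    · linarith

lemma measurable_expAvg (a : ℕ → ℂ) : Measurable (expAvg a) := by
  have h : Measurable fun u : ℝ => ∑ n ∈ Icc 1 ⌊Real.exp u⌋₊, a n :=
    (measurable_from_nat (f := fun m => ∑ n ∈ Icc 1 m, a n)).comp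
      (Nat.measurable_floor.comp Real.measurable_exp)
  unfold expAvg
  fun_prop

lemma weight_le_fejer {T U u : ℝ} (hT : 0 ≤ T) : weight T U u ≤ T * fejer (T * (u - U)) := by
  have h := fejer_nonneg (T * (u - U))
  have h1 : u / U * Real.exp (-(u / U)) ≤ 1 := by
    have h2 := Real.add_one_le_exp (u / U)
    have h3 := Real.exp_pos (-(u / U))
    have h4 : Real.exp (u / U) * Real.exp (-(u / U)) = 1 := by rw [← Real.exp_add]; simp
    nlinarith
  exact mul_le_of_le_one_left (by positivity) h1

lemma weight_le {T U u : ℝ} (hT : 0 ≤ T) : weight T U u ≤ T :=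
  (weight_le_fejer hT).trans (mul_le_of_le_one_right hT (fejer_le_one _))

lemma integrable_scaled_fejer {T : ℝ} (hT : 0 < T) (U : ℝ) :
    Integrable (fun u => T * fejer (T * (u - U))) :=
  ((integrable_fejer.comp_mul_left' hT.ne').comp_sub_right U).const_mul T

lemma integral_scaled_fejer {T : ℝ} (hT : 0 < T) (U : ℝ) :
    ∫ u, T * fejer (T * (u - U)) = ∫ y, fejer y := by
  rw [integral_const_mul, integral_sub_right_eq_self (fun u => fejer (T * u)) U,
    Measure.integral_comp_mul_left, smul_eq_mul, abs_of_pos (inv_pos.mpr hT)]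
  field_simp

lemma hasSum_mul_mass {T U : ℝ} (hT : 0 < T) (hU : 0 < U) (hs : Summable (mass T U)) {a : ℕ → ℂ}
    (ha : ∀ n, ‖a n‖ ≤ 1) :
    HasSum (fun n => a n * (mass T U n : ℂ))
      (∫ u in Set.Ici 0, (weight T U u : ℂ) * expAvg a u) := by
  set w : ℝ → ℝ := fun u => Real.exp (-u) * weight T U u with hw
  have hwi : IntegrableOn w (Set.Ici 0) := by
    have h0 : IntegrableOn (fun u : ℝ => T * Real.exp (-u)) (Set.Ici 0) := by
      rw [integrableOn_Ici_iff_integrableOn_Ioi]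
      exact (integrableOn_exp_neg_Ioi 0).const_mul T
    have := continuous_weight T U
    refine Integrable.mono' h0 (by fun_prop) ?_
    refine (ae_restrict_iff' measurableSet_Ici).mpr (Eventually.of_forall fun u hu => ?_)
    have h1 := weight_nonneg hT.le hU (Set.mem_Ici.mp hu)
    rw [hw, Real.norm_of_nonneg (by positivity), mul_comm T]
    exact mul_le_mul_of_nonneg_left (weight_le hT.le) (Real.exp_nonneg _)
  set F : ℕ → ℝ → ℂ := fun n =>
    if n = 0 then 0 else (Set.Ici (Real.log n)).indicator fun u => a n * (w u : ℂ) with hF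
  have hsub : ∀ n : ℕ, Set.Ici (0 : ℝ) ∩ Set.Ici (Real.log n) = Set.Ici (Real.log n) := fun n =>
    Set.inter_eq_right.mpr (Set.Ici_subset_Ici.mpr (Real.log_natCast_nonneg n))
  have hFi : ∀ n, Integrable (F n) (volume.restrict (Set.Ici 0)) := by
    intro n
    rw [hF]
    simp only
    split_ifs with hn
    · exact integrable_zero _ _ _
    · exact (Integrable.const_mul (Integrable.ofReal hwi) (a n)).indicator measurableSet_Ici
  have hFint : ∀ n, ∫ u in Set.Ici 0, F n u = a n * (mass T U n : ℂ) := by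
    intro n
    rw [hF]
    simp only
    split_ifs with hn
    · simp [hn, mass]
    · rw [setIntegral_indicator measurableSet_Ici, hsub, integral_const_mul,
        integral_complex_ofReal, integral_Ici_eq_integral_Ioi, mass, if_neg hn]
  have hFn : ∀ n, ∫ u in Set.Ici 0, ‖F n u‖ ≤ mass T U n := by
    intro n
    rw [hF]
    simp only
    split_ifs with hn
    · simp [hn, mass]
    · simp_rw [norm_indicator_eq_indicator_norm]
      rw [setIntegral_indicator measurableSet_Ici, hsub]
      have e : ∀ u ∈ Set.Ici (Real.log n), ‖a n * (w u : ℂ)‖ = ‖a n‖ * w u := by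
        intro u hu
        have h1 := weight_nonneg (u := u) hT.le hU ((Real.log_natCast_nonneg n).trans hu)
        rw [norm_mul, Complex.norm_of_nonneg]
        rw [hw]; positivity
      rw [setIntegral_congr_fun measurableSet_Ici e, integral_const_mul,
        integral_Ici_eq_integral_Ioi]
      have hm := mass_nonneg hT.le hU n
      have e2 : mass T U n = ∫ u in Set.Ioi (Real.log n), w u := by rw [mass, if_neg hn]
      rw [← e2]
      exact mul_le_of_le_one_left hm (ha n)
  have key := hasSum_integral_of_summable_integral_norm hFi
    (hs.of_nonneg_of_le (fun n => integral_nonneg fun u => norm_nonneg _) hFn)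
  simp_rw [hFint] at key
  suffices hfin : ∫ u in Set.Ici 0, ∑' n, F n u =
      ∫ u in Set.Ici 0, (weight T U u : ℂ) * expAvg a u by
    rw [hfin] at key
    exact key
  refine setIntegral_congr_fun measurableSet_Ici fun u _ => ?_
  have hsupp : ∀ n ∉ Icc 1 ⌊Real.exp u⌋₊, F n u = 0 := by
    intro n hn
    rw [hF]
    simp only
    split_ifs with h0
    · rfl
    · refine Set.indicator_of_notMem (fun hmem => hn ?_) _
      rw [mem_Icc]
      refine ⟨Nat.pos_of_ne_zero h0, Nat.le_floor ?_⟩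
      rw [← Real.log_le_iff_le_exp (by positivity)]
      exact hmem
  rw [tsum_eq_sum hsupp, expAvg, mul_sum, mul_sum]
  refine sum_congr rfl fun n hn => ?_
  rw [mem_Icc] at hn
  have hn0 : n ≠ 0 := by omega
  rw [hF]
  simp only
  rw [if_neg hn0, Set.indicator_of_mem]
  · rw [hw]; push_cast; ring
  · rw [Set.mem_Ici, Real.log_le_iff_le_exp (by positivity)]
    exact (Nat.le_floor_iff (Real.exp_nonneg u)).mp hn.2

lemma summable_mass {T U : ℝ} (hT : 0 < T) (hU : 1 ≤ U) : Summable (mass T U) := by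
  obtain ⟨C, _, h⟩ := exists_norm_tsum_mass_le hT
  have := (h U hU 1 (by norm_num)).1.of_norm
  simp only [omegaPow, one_pow, one_mul] at this
  exact Complex.summable_ofReal.mp this

lemma integrableOn_weight_mul {T U : ℝ} (hT : 0 < T) (hU : 0 < U) {a : ℕ → ℂ}
    (ha : ∀ n, ‖a n‖ ≤ 1) :
    IntegrableOn (fun u => (weight T U u : ℂ) * expAvg a u) (Set.Ici 0) := by
  have hm := (measurable_expAvg a)
  have hw := (continuous_weight T U).measurable
  refine Integrable.mono' (integrable_scaled_fejer hT U).integrableOn (by fun_prop) ?_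
  refine (ae_restrict_iff' measurableSet_Ici).mpr (Eventually.of_forall fun u hu => ?_)
  rw [norm_mul, Complex.norm_of_nonneg (weight_nonneg hT.le hU hu)]
  exact (mul_le_of_le_one_right (weight_nonneg hT.le hU hu) (norm_expAvg_le ha u)).trans
    (weight_le_fejer hT.le)

lemma tendsto_weighted_of_tendsto_expAvg {a : ℕ → ℂ} (ha : ∀ n, ‖a n‖ ≤ 1) {T : ℝ} (hT : 0 < T)
    (h : Tendsto (expAvg a) atTop (nhds 0)) :
    Tendsto (fun U => ∫ u in Set.Ici 0, (weight T U u : ℂ) * expAvg a u) atTop (nhds 0) := by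
  set J := ∫ y, fejer y with hJ
  have hJ0 : 0 ≤ J := integral_nonneg fejer_nonneg
  rw [Metric.tendsto_nhds]
  intro ε hε
  set η := ε / (2 * (J + 1)) with hη
  have hη0 : 0 < η := by positivity
  obtain ⟨u₀, hu₀⟩ := eventually_atTop.mp ((Metric.tendsto_nhds.mp h) η hη0)
  set v := max u₀ 1 with hv
  have hv1 : 1 ≤ v := le_max_right _ _
  have hlim : Tendsto (fun U : ℝ => v ^ 2 * T / U) atTop (nhds 0) :=
    tendsto_const_nhds.div_atTop tendsto_id
  filter_upwards [eventually_gt_atTop 0, hlim.eventually (gt_mem_nhds (half_pos hε))] with U hU hUε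
  rw [dist_zero_right]
  have hg : Integrable (fun u => η * (T * fejer (T * (u - U))) +
      (Set.Icc 0 v).indicator (fun _ => v * T / U) u) :=
    ((integrable_scaled_fejer hT U).const_mul η).add
      ((integrable_indicator_iff measurableSet_Icc).mpr (by simp))
  have hpt : ∀ u ∈ Set.Ici (0 : ℝ), ‖(weight T U u : ℂ) * expAvg a u‖ ≤
      η * (T * fejer (T * (u - U))) + (Set.Icc 0 v).indicator (fun _ => v * T / U) u := by
    intro u hu
    have hw := weight_nonneg hT.le hU hu
    rw [norm_mul, Complex.norm_of_nonneg hw]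
    have hf := fejer_nonneg (T * (u - U))
    by_cases huv : u ≤ v
    · rw [Set.indicator_of_mem (s := Set.Icc 0 v) ⟨hu, huv⟩]
      have h1 : weight T U u ≤ v * T / U := by
        have e1 : u / U ≤ v / U := by gcongr
        have e2 : Real.exp (-(u / U)) ≤ 1 := by
          rw [Real.exp_le_one_iff, neg_nonpos]
          exact div_nonneg hu hU.le
        have e3 : T * fejer (T * (u - U)) ≤ T := mul_le_of_le_one_right hT.le (fejer_le_one _)
        have hu0 : 0 ≤ u := hu
        calc weight T U u ≤ v / U * 1 * T := by
              unfold weight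
              gcongr
          _ = _ := by ring
      have h2 := mul_le_of_le_one_right hw (norm_expAvg_le ha u)
      have : 0 ≤ η * (T * fejer (T * (u - U))) := by positivity
      linarith
    · have hu' : u₀ ≤ u := (le_max_left _ _).trans (not_le.mp huv).le
      have h1 := hu₀ u hu'
      rw [dist_zero_right] at h1
      rw [Set.indicator_of_notMem (s := Set.Icc 0 v) (fun hmem => huv hmem.2), add_zero, mul_comm]
      exact mul_le_mul h1.le (weight_le_fejer hT.le) hw hη0.le
  have hnn : ∀ u, 0 ≤ η * (T * fejer (T * (u - U))) +
      (Set.Icc 0 v).indicator (fun _ => v * T / U) u := fun u => by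
    have hf := fejer_nonneg (T * (u - U))
    have : 0 ≤ (Set.Icc 0 v).indicator (fun _ => v * T / U) u :=
      Set.indicator_nonneg (fun _ _ => by positivity) _
    positivity
  calc _ ≤ ∫ u in Set.Ici 0, (η * (T * fejer (T * (u - U))) +
        (Set.Icc 0 v).indicator (fun _ => v * T / U) u) := by
        refine norm_integral_le_of_norm_le hg.integrableOn ?_
        exact (ae_restrict_iff' measurableSet_Ici).mpr (Eventually.of_forall hpt)
    _ ≤ ∫ u, (η * (T * fejer (T * (u - U))) +
        (Set.Icc 0 v).indicator (fun _ => v * T / U) u) :=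
        setIntegral_le_integral hg (Eventually.of_forall hnn)
    _ = η * J + v ^ 2 * T / U := by
        rw [integral_add ((integrable_scaled_fejer hT U).const_mul η)
          ((integrable_indicator_iff measurableSet_Icc).mpr (by simp)), integral_const_mul,
          integral_scaled_fejer hT, integral_indicator measurableSet_Icc, setIntegral_const,
          Real.volume_real_Icc_of_le (by linarith), smul_eq_mul]
        ring
    _ < ε := by
        have : η * J ≤ ε / 2 := by
          rw [hη, div_mul_eq_mul_div, div_le_div_iff₀ (by positivity) two_pos]
          nlinarith
        linarith

lemma tendsto_expAvg_of_tendsto_weighted {a : ℕ → ℂ} (ha : ∀ n, ‖a n‖ ≤ 1)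
    (h : ∀ T : ℝ, 0 < T → Tendsto (fun U => ∫ u in Set.Ici 0, (weight T U u : ℂ) * expAvg a u)
      atTop (nhds 0)) :
    Tendsto (expAvg a) atTop (nhds 0) := by
  set J := ∫ y, fejer y with hJ
  have hJ0 : 0 < J := integral_fejer_pos
  have hlim : ∀ δ : ℝ, 0 < δ → δ ≤ 1 → ∀ T : ℝ, 0 < T → ∀ᶠ U in atTop,
      J * ‖expAvg a U‖ ≤ δ + 4 * δ * J + 16 * Real.pi / (T * δ ^ 2) := by
    intro δ hδ hδ1 T hT
    have h1 : ∀ᶠ U : ℝ in atTop,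
        ‖∫ u in Set.Ici 0, (weight T U u : ℂ) * expAvg a u‖ < δ / 3 := by
      have := (Metric.tendsto_nhds.mp (h T hT)) (δ / 3) (by positivity)
      simpa only [dist_zero_right] using this
    have h2 : ∀ᶠ U : ℝ in atTop, Real.exp (-(U - δ)) < δ := by
      have : Tendsto (fun U : ℝ => Real.exp (-(U - δ))) atTop (nhds 0) :=
        Real.tendsto_exp_neg_atTop_nhds_zero.comp (tendsto_atTop_add_const_right _ (-δ) tendsto_id)
      exact this.eventually (gt_mem_nhds hδ)
    filter_upwards [h1, h2, eventually_ge_atTop 1] with U hU1 hU2 hU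
    have hU0 : 0 < U := by linarith
    set K : ℝ → ℝ := fun u => T * fejer (T * (u - U)) with hK
    have hK0 : ∀ u, 0 ≤ K u := fun u => mul_nonneg hT.le (fejer_nonneg _)
    have hKi : Integrable K := integrable_scaled_fejer hT U
    have hKI : ∫ u, K u = J := integral_scaled_fejer hT U
    set W : ℝ → ℂ := fun u => Real.exp 1 *
      (Set.Ici (0 : ℝ)).indicator (fun u => (weight T U u : ℂ) * expAvg a u) u with hW
    have hWi : Integrable W :=
      ((integrable_indicator_iff measurableSet_Ici).mpr
        (integrableOn_weight_mul hT hU0 ha)).const_mul _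
    have hWI : ‖∫ u, W u‖ ≤ δ := by
      rw [hW, integral_const_mul, integral_indicator measurableSet_Ici, norm_mul,
        Complex.norm_of_nonneg (Real.exp_nonneg _)]
      have := Real.exp_one_lt_d9
      nlinarith [norm_nonneg (∫ u in Set.Ici 0, (weight T U u : ℂ) * expAvg a u)]
    set B : ℝ → ℝ := fun u => 4 * δ * K u + 16 / (T * δ ^ 2) * (1 + (u - U) ^ 2)⁻¹ with hB
    have hBi : Integrable B :=
      (hKi.const_mul _).add ((integrable_inv_one_add_sq.comp_sub_right U).const_mul _)
    have hBI : ∫ u, B u = 4 * δ * J + 16 * Real.pi / (T * δ ^ 2) := by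
      have hK4 : ∫ u, 4 * δ * K u = 4 * δ * J := by rw [integral_const_mul, hKI]
      rw [hB, integral_add (hKi.const_mul _)
        ((integrable_inv_one_add_sq.comp_sub_right U).const_mul _), hK4,
        integral_const_mul, integral_sub_right_eq_self (fun u : ℝ => (1 + u ^ 2)⁻¹) U,
        integral_univ_inv_one_add_sq]
      ring
    have hpt : ∀ u, ‖(K u : ℂ) * expAvg a U - W u‖ ≤ B u := by
      intro u
      obtain ⟨ψ, hψ0, hψ1, hψ2, hWψ⟩ : ∃ ψ : ℝ, 0 ≤ ψ ∧ ψ ≤ 1 ∧ (0 ≤ u → 1 - (u / U - 1) ^ 2 ≤ ψ) ∧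
          W u = K u * (ψ * expAvg a u) := by
        by_cases hu : 0 ≤ u
        · have hx : 0 ≤ u / U := by positivity
          refine ⟨u / U * Real.exp (1 - u / U), by positivity, ?_, fun _ => ?_, ?_⟩
          · have e1 := Real.add_one_le_exp (u / U - 1)
            have e2 : Real.exp (u / U - 1) * Real.exp (1 - u / U) = 1 := by
              rw [← Real.exp_add]; simp
            have e3 := Real.exp_pos (1 - u / U)
            nlinarith
          · have e1 := Real.add_one_le_exp (1 - u / U)
            nlinarith
          · rw [hW, hK]
            simp only
            rw [Set.indicator_of_mem (Set.mem_Ici.mpr hu), weight,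
              show 1 - u / U = 1 + -(u / U) by ring, Real.exp_add]
            push_cast
            ring
        · refine ⟨0, le_rfl, zero_le_one, fun h => absurd h hu, ?_⟩
          rw [hW]
          simp only
          rw [Set.indicator_of_notMem (s := Set.Ici 0) (fun hm => hu hm)]
          simp
      rw [hWψ, ← mul_sub, norm_mul, Complex.norm_of_nonneg (hK0 u)]
      have hM := norm_expAvg_le ha U
      have hm := norm_expAvg_le ha u
      have hB2 : 0 ≤ 16 / (T * δ ^ 2) * (1 + (u - U) ^ 2)⁻¹ := by positivity
      by_cases hd : |u - U| ≤ δ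
      · have hd' := abs_le.mp hd
        have hu : 0 ≤ u := by linarith
        have e1 := norm_expAvg_sub_le ha hd
        have e2 : expAvg a U - ψ * expAvg a u
            = (expAvg a U - expAvg a u) + ((1 - ψ : ℝ) : ℂ) * expAvg a u := by
          push_cast
          ring
        have e3 : ‖expAvg a U - ψ * expAvg a u‖ ≤ 4 * δ := by
          rw [e2]
          refine (norm_add_le _ _).trans ?_
          rw [norm_mul, Complex.norm_of_nonneg (by linarith)]
          have e4 : 1 - ψ ≤ δ := by
            have e5 := hψ2 hu
            have e6 : u / U - 1 = (u - U) / U := by field_simp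
            have e7 : |u / U - 1| ≤ δ := by
              rw [e6, abs_div, abs_of_pos hU0]
              exact (div_le_self (abs_nonneg _) hU).trans hd
            have e8 : (u / U - 1) ^ 2 ≤ δ ^ 2 := by
              rw [← sq_abs]
              gcongr
            nlinarith
          have e9 := mul_le_of_le_one_right (show 0 ≤ 1 - ψ by linarith) hm
          linarith
        have := mul_le_mul_of_nonneg_left e3 (hK0 u)
        rw [hB]
        simp only
        linarith
      · have hd := not_le.mp hd
        have hne : T * (u - U) ≠ 0 := by
          refine mul_ne_zero hT.ne' fun h0 => ?_
          rw [h0, abs_zero] at hd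
          linarith
        have e1 : ‖expAvg a U - ψ * expAvg a u‖ ≤ 2 := by
          refine (norm_sub_le _ _).trans ?_
          rw [norm_mul, Complex.norm_of_nonneg hψ0]
          nlinarith [norm_nonneg (expAvg a u)]
        have e2 := fejer_le hne
        have e3 : δ ^ 2 ≤ (u - U) ^ 2 := by
          rw [← sq_abs (u - U)]
          gcongr
        have e4 : K u ≤ 8 / (T * δ ^ 2) * (1 + (u - U) ^ 2)⁻¹ := by
          calc K u ≤ T * (4 / (T * (u - U)) ^ 2) := mul_le_mul_of_nonneg_left e2 hT.le
            _ = 4 / (T * (u - U) ^ 2) := by field_simp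
            _ ≤ 8 / (T * δ ^ 2 * (1 + (u - U) ^ 2)) := by
              have hp : 0 < (u - U) ^ 2 := lt_of_lt_of_le (by positivity) e3
              rw [div_le_div_iff₀ (by positivity) (by positivity)]
              have e5 : δ ^ 2 * (1 + (u - U) ^ 2) ≤ 2 * (u - U) ^ 2 := by
                have : δ ^ 2 ≤ 1 := pow_le_one₀ hδ.le hδ1
                nlinarith
              nlinarith
            _ = _ := by rw [← div_div, div_eq_mul_inv]
        have e6 := mul_le_mul e4 e1 (norm_nonneg _) (by positivity)
        have e7 : 0 ≤ 4 * δ * K u := mul_nonneg (by positivity) (hK0 u)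
        rw [hB]
        simp only
        refine e6.trans ?_
        have : 8 / (T * δ ^ 2) * (1 + (u - U) ^ 2)⁻¹ * 2
          = 16 / (T * δ ^ 2) * (1 + (u - U) ^ 2)⁻¹ := by ring
        linarith
    have hdiff : (J : ℂ) * expAvg a U = (∫ u, ((K u : ℂ) * expAvg a U - W u)) + ∫ u, W u := by
      have hKc : Integrable fun u => (K u : ℂ) * expAvg a U :=
        (Integrable.ofReal hKi).mul_const _
      rw [integral_sub hKc hWi, sub_add_cancel, integral_mul_const,
        integral_complex_ofReal, hKI]
    have h3 : J * ‖expAvg a U‖ = ‖(J : ℂ) * expAvg a U‖ := by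
      rw [norm_mul, Complex.norm_of_nonneg hJ0.le]
    rw [h3, hdiff]
    refine (norm_add_le _ _).trans ?_
    have := norm_integral_le_of_norm_le hBi (Eventually.of_forall hpt)
    rw [hBI] at this
    linarith
  rw [Metric.tendsto_nhds]
  intro ε hε
  set δ := min 1 (J * ε / (4 * (2 + 4 * J))) with hδ
  have hδ0 : 0 < δ := lt_min one_pos (by positivity)
  filter_upwards [hlim δ hδ0 (min_le_left _ _) (16 * Real.pi / δ ^ 3)
    (by have := Real.pi_pos; positivity)] with U hU
  rw [dist_zero_right]
  have e1 : 16 * Real.pi / (16 * Real.pi / δ ^ 3 * δ ^ 2) = δ := by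
    have := Real.pi_pos
    field_simp
  rw [e1] at hU
  have e2 : δ ≤ J * ε / (4 * (2 + 4 * J)) := min_le_right _ _
  rw [le_div_iff₀ (by positivity)] at e2
  nlinarith [mul_pos hJ0 hε]

lemma exists_le_tsum_mass : ∃ m > 0, ∀ U : ℝ, 1 ≤ U → m ≤ ∑' n, mass 1 U n := by
  refine ⟨Real.exp (-2) / 8, by positivity, fun U hU => ?_⟩
  have hU0 : 0 < U := by linarith
  have h1 := hasSum_mul_mass one_pos hU0 (summable_mass one_pos hU) (a := fun _ => 1) (by simp)
  set f : ℝ → ℝ := fun u => weight 1 U u * (Real.exp (-u) * ⌊Real.exp u⌋₊) with hf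
  have e : ∀ u, (weight 1 U u : ℂ) * expAvg (fun _ => 1) u = (f u : ℂ) := by
    intro u
    rw [expAvg, hf]
    simp
  have hi := integrableOn_weight_mul one_pos hU0 (a := fun _ => 1) (by simp)
  simp_rw [e, one_mul] at h1 hi
  have hi' : IntegrableOn f (Set.Ici 0) := hi.re
  have e2 : ∑' n, mass 1 U n = ∫ u in Set.Ici 0, f u := by
    have := h1.tsum_eq
    rw [integral_complex_ofReal, ← Complex.ofReal_tsum] at this
    exact_mod_cast this
  have hf0 : ∀ u ∈ Set.Ici (0 : ℝ), 0 ≤ f u := fun u hu =>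
    mul_nonneg (weight_nonneg zero_le_one hU0 hu) (by positivity)
  have hsub : Set.Icc U (U + 1) ⊆ Set.Ici (0 : ℝ) := fun u hu => hU0.le.trans hu.1
  rw [e2]
  calc Real.exp (-2) / 8 = ∫ u in Set.Icc U (U + 1), Real.exp (-2) / 8 := by simp
    _ ≤ ∫ u in Set.Icc U (U + 1), f u := by
      refine setIntegral_mono_on (by simp) (hi'.mono_set hsub) measurableSet_Icc fun u hu => ?_
      have hu0 : 0 ≤ u := hsub hu
      have a1 : 1 ≤ u / U := by rw [le_div_iff₀ hU0]; linarith [hu.1]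
      have a2 : u / U ≤ 2 := by rw [div_le_iff₀ hU0]; linarith [hu.2]
      have a3 : Real.exp (-2) ≤ u / U * Real.exp (-(u / U)) := by
        have : Real.exp (-2) ≤ Real.exp (-(u / U)) := by gcongr
        nlinarith [Real.exp_pos (-(u / U))]
      have a4 : 1 / 4 ≤ fejer (u - U) := by
        have hy0 : 0 ≤ (u - U) / 2 := by linarith [hu.1]
        have hy1 : (u - U) / 2 ≤ Real.pi / 2 := by
          have := Real.pi_gt_three
          linarith [hu.2]
        have : 1 / 2 ≤ Real.sinc ((u - U) / 2) := by
          rcases hy0.eq_or_lt with h0 | h0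
          · rw [← h0, Real.sinc_zero]; norm_num
          · rw [Real.sinc_of_ne_zero h0.ne', le_div_iff₀ h0]
            refine le_trans ?_ (Real.mul_le_sin hy0 hy1)
            have hpi : 1 / 2 ≤ 2 / Real.pi := by
              rw [div_le_div_iff₀ two_pos Real.pi_pos]
              linarith [Real.pi_lt_four]
            exact mul_le_mul_of_nonneg_right hpi hy0
        rw [fejer]
        nlinarith
      have a5 : 1 / 2 ≤ Real.exp (-u) * ⌊Real.exp u⌋₊ := by
        have b1 : 1 ≤ Real.exp u := Real.one_le_exp hu0
        have b2 : (1 : ℝ) ≤ ⌊Real.exp u⌋₊ := by exact_mod_cast (Nat.one_le_floor_iff _).mpr b1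
        have b3 := Nat.lt_floor_add_one (Real.exp u)
        rw [Real.exp_neg, inv_mul_eq_div, div_le_div_iff₀ two_pos (Real.exp_pos u)]
        linarith
      rw [hf]
      simp only [weight, one_mul]
      have a6 := mul_le_mul a3 a4 (by norm_num) (by positivity)
      have a7 := mul_le_mul a6 a5 (by norm_num)
        (mul_nonneg (by positivity) (fejer_nonneg _))
      linarith
    _ ≤ _ := setIntegral_mono_set hi'
        ((ae_restrict_iff' measurableSet_Ici).mpr (Eventually.of_forall hf0))
        hsub.eventuallyLE

lemma norm_sum_range_mul_le {f : ℕ → ℂ} {H : ℕ} {B : ℝ} (m : ℕ)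
    (h : ∀ i < m, ‖∑ j ∈ range H, f (i * H + j)‖ ≤ B) :
    ‖∑ k ∈ range (m * H), f k‖ ≤ m * B := by
  induction m with
  | zero => simp
  | succ m ih =>
    rw [add_one_mul, Finset.sum_range_add]
    refine (norm_add_le _ _).trans ?_
    have h1 := ih fun i hi => h i (by omega)
    have h2 := h m (by omega)
    push_cast
    linarith

namespace SelbergBound

variable {C U : ℝ} {Q : ℕ → ℝ}

lemma norm_tsum_sub_sum_le (h : SelbergBound C U Q) (hC : 0 ≤ C) (hU : 0 < U)
    (hL : 16 ≤ Real.log U) {A : ℝ} {G : ℕ → ℂ} (hG : ∀ k, ‖G k‖ ≤ 1) {S : Finset ℕ}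
    (hS : ∀ k ∉ S, A * √(Real.log U) < |(k : ℝ) - Real.log U|) :
    ‖∑' k, G k * (Q k : ℂ) - ∑ k ∈ S, G k * (Q k : ℂ)‖ ≤ 6 * C * Real.exp (-A) := by
  have hs := h.norm_summable hG
  set f : ℕ → ℝ := fun k => if A * √(Real.log U) < |(k : ℝ) - Real.log U| then Q k else 0 with hf
  have hf0 : ∀ k, 0 ≤ f k := fun k => by
    rw [hf]; simp only; split_ifs; exacts [h.1 k, le_rfl]
  have hfs : Summable f := h.summable.of_nonneg_of_le hf0 fun k => by
    rw [hf]; simp only; split_ifs; exacts [le_rfl, h.1 k]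
  have hsum : ∑ k ∈ S, G k * (Q k : ℂ) = ∑' k, (if k ∈ S then G k * (Q k : ℂ) else 0) := by
    rw [tsum_eq_sum (s := S) (fun k hk => if_neg hk)]
    exact sum_congr rfl fun k hk => (if_pos hk).symm
  have hsS : Summable fun k => (if k ∈ S then G k * (Q k : ℂ) else 0) :=
    summable_of_ne_finset_zero (s := S) fun k hk => if_neg hk
  rw [hsum, ← hs.of_norm.tsum_sub hsS]
  refine le_trans ?_ (h.tsum_tail_le hC hU hL A)
  refine tsum_of_norm_bounded hfs.hasSum fun k => ?_
  by_cases hk : k ∈ S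
  · rw [if_pos hk, sub_self, norm_zero]
    exact hf0 k
  · rw [if_neg hk, sub_zero, hf]
    simp only
    rw [if_pos (hS k hk), norm_mul, Complex.norm_of_nonneg (h.1 k)]
    exact mul_le_of_le_one_left (h.1 k) (hG k)

lemma abs_coeff_add_sub_le (h : SelbergBound C U Q) (hC : 0 ≤ C) (hU : 1 ≤ U)
    (hL : 0 < Real.log U) (a j : ℕ) : |Q (a + j) - Q a| ≤ j * (16 * C / Real.log U) := by
  induction j with
  | zero => simp
  | succ j ih =>
    have h1 := h.abs_coeff_succ_sub_le hC hU hL (a + j)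
    have h2 := abs_sub_le (Q (a + j + 1)) (Q (a + j)) (Q a)
    rw [← add_assoc]
    push_cast
    linarith

lemma norm_window_le (h : SelbergBound C U Q) (hC : 0 ≤ C) (hU : 1 ≤ U)
    (hL : 0 < Real.log U) {G : ℕ → ℂ} (hG : ∀ k, ‖G k‖ ≤ 1) {η : ℝ} {a H : ℕ}
    (hsum : ‖∑ j ∈ range H, G (a + j)‖ ≤ η * H) :
    ‖∑ j ∈ range H, G (a + j) * (Q (a + j) : ℂ)‖ ≤
      H * (2 * C * η / √(Real.log U) + 16 * C * H / Real.log U) := by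
  have e : ∑ j ∈ range H, G (a + j) * (Q (a + j) : ℂ) =
      Q a * (∑ j ∈ range H, G (a + j)) +
        ∑ j ∈ range H, G (a + j) * ((Q (a + j) - Q a : ℝ) : ℂ) := by
    rw [mul_sum, ← sum_add_distrib]
    refine sum_congr rfl fun j _ => ?_
    push_cast
    ring
  rw [e]
  refine (norm_add_le _ _).trans ?_
  rw [norm_mul, Complex.norm_of_nonneg (h.1 a)]
  have h1 := mul_le_mul (h.coeff_le hC hU hL a) hsum (norm_nonneg _) (by positivity)
  have h2 : ‖∑ j ∈ range H, G (a + j) * ((Q (a + j) - Q a : ℝ) : ℂ)‖ ≤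
      H * (H * (16 * C / Real.log U)) := by
    refine (norm_sum_le _ _).trans ?_
    have : ∀ j ∈ range H, ‖G (a + j) * ((Q (a + j) - Q a : ℝ) : ℂ)‖ ≤
        H * (16 * C / Real.log U) := by
      intro j hj
      rw [norm_mul, Complex.norm_real, Real.norm_eq_abs]
      refine (mul_le_of_le_one_left (abs_nonneg _) (hG _)).trans
        ((h.abs_coeff_add_sub_le hC hU hL a j).trans ?_)
      have : (j : ℝ) ≤ H := by exact_mod_cast (mem_range.mp hj).le
      gcongr
    refine (sum_le_sum this).trans ?_
    rw [sum_const, card_range, nsmul_eq_mul]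
  refine (add_le_add h1 h2).trans (le_of_eq ?_)
  ring

end SelbergBound

theorem tendsto_tsum_expChar_rpow {c : ℝ} (hc : 1 / 2 < c) (hcZ : ¬∃ m : ℤ, c = (m : ℝ)) {h : ℝ}
    (hh : h ≠ 0) {C : ℝ} (hC : 0 < C) {Q : ℝ → ℕ → ℝ}
    (hQ : ∀ U : ℝ, 1 ≤ U → SelbergBound C U (Q U)) :
    Tendsto (fun U => ∑' k : ℕ, expChar (h * (k : ℝ) ^ c) * (Q U k : ℂ)) atTop (nhds 0) := by
  rw [Metric.tendsto_nhds]
  intro ε₀ hε₀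
  obtain ⟨A, hA0, hA⟩ : ∃ A : ℝ, 0 ≤ A ∧ 6 * C * Real.exp (-A) < ε₀ / 2 := by
    have h1 : Tendsto (fun A : ℝ => 6 * C * Real.exp (-A)) atTop (nhds (6 * C * 0)) :=
      Real.tendsto_exp_neg_atTop_nhds_zero.const_mul _
    rw [mul_zero] at h1
    exact ((eventually_ge_atTop 0).and (h1.eventually (gt_mem_nhds (half_pos hε₀)))).exists
  set ε := min 1 (ε₀ / (68 * C * (2 * A + 3))) with hε
  have hε0 : 0 < ε := lt_min one_pos (by positivity)
  have hε1 : ε ≤ 1 := min_le_left _ _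
  have hε2 : (2 * A + 3) * (34 * C * ε) ≤ ε₀ / 2 := by
    have h1 : ε ≤ ε₀ / (68 * C * (2 * A + 3)) := min_le_right _ _
    rw [le_div_iff₀ (by positivity)] at h1
    linarith
  have hlogT : Tendsto Real.log atTop atTop := Real.tendsto_log_atTop
  have hsqrtT : Tendsto (fun U => √(Real.log U)) atTop atTop := Real.tendsto_sqrt_atTop.comp hlogT
  filter_upwards [hlogT.eventually (eventually_norm_sum_expChar_rpow_le hc hcZ hh hε0 hε0),
    eventually_ge_atTop 1, hlogT.eventually (eventually_ge_atTop 16),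
    hsqrtT.eventually (eventually_ge_atTop (1 / ε)),
    hsqrtT.eventually (eventually_ge_atTop (2 * (2 * A + 3)))] with U hwin hU hL hs1 hs2
  rw [dist_zero_right]
  set L := Real.log U with hLdef
  have hL0 : 0 < L := by linarith
  have hs0 : 0 < √L := Real.sqrt_pos.mpr hL0
  have hss : √L * √L = L := Real.mul_self_sqrt hL0.le
  have hεs : 1 ≤ ε * √L := by
    rw [div_le_iff₀ hε0] at hs1
    linarith
  set H := ⌈ε * √L⌉₊ with hH
  have hH1 : ε * √L ≤ H := Nat.le_ceil _
  have hH2 : (H : ℝ) ≤ 2 * (ε * √L) := by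
    have := Nat.ceil_lt_add_one (show 0 ≤ ε * √L by positivity)
    linarith
  have hHpos : (0 : ℝ) < H := by linarith
  have hH3 : (H : ℝ) ≤ √L + 1 := by
    have := Nat.ceil_lt_add_one (show 0 ≤ ε * √L by positivity)
    nlinarith
  have hs4 : 4 ≤ √L := by
    by_contra hlt
    nlinarith [not_le.mp hlt]
  set m := ⌈(2 * A * √L + 2) / H⌉₊ with hm
  have hm1 : 2 * A * √L + 2 ≤ m * H := by
    rw [← div_le_iff₀ hHpos]
    exact Nat.le_ceil _
  have hm2 : (m : ℝ) * H ≤ (2 * A + 3) * √L := by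
    have h1 := Nat.ceil_lt_add_one (show 0 ≤ (2 * A * √L + 2) / H by positivity)
    have h2 : ((m : ℝ) - 1) * H ≤ 2 * A * √L + 2 := by
      rw [← le_div_iff₀ hHpos]
      linarith
    nlinarith
  have hAL : A * √L ≤ L / 4 := by nlinarith
  set a := ⌊L - A * √L⌋₊ with ha
  have ha1 : (a : ℝ) ≤ L - A * √L := Nat.floor_le (by linarith)
  have ha2 : L - A * √L < a + 1 := Nat.lt_floor_add_one _
  have hNL : (2 * A + 3) * √L ≤ L / 2 := by nlinarith
  have hcover : ∀ k ∉ Ico a (a + m * H), A * √L < |(k : ℝ) - L| := by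
    intro k hk
    rw [mem_Ico, not_and_or, not_le, not_lt] at hk
    rcases hk with hk | hk
    · have : (k : ℝ) + 1 ≤ a := by exact_mod_cast hk
      rw [lt_abs]
      right
      linarith
    · have : (a : ℝ) + m * H ≤ k := by exact_mod_cast hk
      rw [lt_abs]
      left
      linarith
  set G : ℕ → ℂ := fun k => expChar (h * (k : ℝ) ^ c) with hG
  have hG1 : ∀ k, ‖G k‖ ≤ 1 := fun k => (norm_expChar _).le
  have htail := (hQ U hU).norm_tsum_sub_sum_le hC.le (by linarith) hL hG1 hcover
  have hmain : ‖∑ k ∈ Ico a (a + m * H), G k * (Q U k : ℂ)‖ ≤ ε₀ / 2 := by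
    rw [sum_Ico_eq_sum_range, Nat.add_sub_cancel_left]
    have hw : ∀ i < m, ‖∑ j ∈ range H, G (a + (i * H + j)) * (Q U (a + (i * H + j)) : ℂ)‖ ≤
        H * (2 * C * ε / √L + 16 * C * H / L) := by
      intro i hi
      simp_rw [← add_assoc]
      refine (hQ U hU).norm_window_le hC.le hU hL0 hG1 ?_
      have hi1 : (i : ℝ) * H ≤ m * H := by
        have : (i : ℝ) ≤ m := by exact_mod_cast hi.le
        gcongr
      have hi0 : (0 : ℝ) ≤ i * H := by positivity
      have hAs : 0 ≤ A * √L := by positivity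
      exact hwin (a + i * H) (by push_cast; linarith) (by push_cast; linarith)
    refine (norm_sum_range_mul_le (f := fun k => G (a + k) * (Q U (a + k) : ℂ)) m hw).trans ?_
    calc (m : ℝ) * (H * (2 * C * ε / √L + 16 * C * H / L))
        = (m * H) * (2 * C * ε / √L + 16 * C * H / L) := by ring
      _ ≤ ((2 * A + 3) * √L) * (2 * C * ε / √L + 16 * C * (2 * (ε * √L)) / L) := by gcongr
      _ = (2 * A + 3) * (34 * C * ε) := by
        have : 16 * C * (2 * (ε * √L)) / L = 32 * C * ε / √L := by
          rw [div_eq_div_iff hL0.ne' hs0.ne']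
          linear_combination (32 * C * ε) * hss
        rw [this]
        field_simp
        ring
      _ ≤ _ := hε2
  calc _ = ‖(∑' k, G k * (Q U k : ℂ) - ∑ k ∈ Ico a (a + m * H), G k * (Q U k : ℂ)) +
        ∑ k ∈ Ico a (a + m * H), G k * (Q U k : ℂ)‖ := by rw [sub_add_cancel]
    _ ≤ _ := norm_add_le _ _
    _ < ε₀ := by linarith

lemma one_add_rpow_ge {c s : ℝ} (hc : 0 ≤ c) (hc1 : c ≤ 1) (hs : |s| ≤ 1 / 2) :
    1 + c * s - s ^ 2 ≤ (1 + s) ^ c := by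
  rw [abs_le] at hs
  have hp : 0 < 1 + s := by linarith
  have h1 := rpow_one_add_le_one_add_mul_self (s := s) (by linarith)
    (show 0 ≤ 1 - c by linarith) (by linarith)
  have h2 : (1 + s) ^ c * (1 + s) ^ (1 - c) = 1 + s := by
    rw [← Real.rpow_add hp]; simp
  have h3 : 0 < (1 + s) ^ c := Real.rpow_pos_of_pos hp _
  have h4 : 1 + s ≤ (1 + s) ^ c * (1 + (1 - c) * s) := by
    calc 1 + s = (1 + s) ^ c * (1 + s) ^ (1 - c) := h2.symm
      _ ≤ _ := by gcongr
  have h5 : 1 / 2 ≤ 1 + (1 - c) * s := by nlinarith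
  by_contra hlt
  rw [not_le] at hlt
  have h6 : (1 + s) ^ c * (1 + (1 - c) * s) < (1 + c * s - s ^ 2) * (1 + (1 - c) * s) := by
    gcongr
  have h7 : c * (1 - c) ≤ 1 / 4 := by nlinarith [sq_nonneg (c - 1 / 2)]
  nlinarith [sq_nonneg s, mul_le_mul_of_nonneg_left h5 (sq_nonneg s),
    mul_le_mul_of_nonneg_left h7 (sq_nonneg s)]

lemma abs_rpow_sub_tangent_le {c L x : ℝ} (hc : 0 ≤ c) (hc1 : c ≤ 1) (hL : 0 < L)
    (hx : |x - L| ≤ L / 2) :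
    |x ^ c - (L ^ c + c * L ^ (c - 1) * (x - L))| ≤ L ^ (c - 2) * (x - L) ^ 2 := by
  set s := (x - L) / L with hs
  have hxs : x = L * (1 + s) := by rw [hs]; field_simp; ring
  have hsb : |s| ≤ 1 / 2 := by
    rw [hs, abs_div, abs_of_pos hL, div_le_iff₀ hL]
    linarith
  have hsb' := abs_le.mp hsb
  have h1 := one_add_rpow_ge hc hc1 hsb
  have h2 := rpow_one_add_le_one_add_mul_self (s := s) (by linarith) hc hc1
  have e1 : x ^ c = L ^ c * (1 + s) ^ c := by
    rw [hxs, Real.mul_rpow hL.le (by linarith)]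
  have e2 : x - L = L * s := by rw [hxs]; ring
  have e3 : L ^ (c - 1) * L = L ^ c := by
    rw [← Real.rpow_add_one hL.ne']; congr 1; ring
  have e4 : L ^ (c - 2) * L ^ 2 = L ^ c := by
    rw [← Real.rpow_two, ← Real.rpow_add hL]; congr 1; ring
  have e5 : x ^ c - (L ^ c + c * L ^ (c - 1) * (x - L)) = L ^ c * ((1 + s) ^ c - (1 + c * s)) := by
    rw [e1, e2]
    linear_combination (-c * s) * e3
  have e6 : L ^ (c - 2) * (x - L) ^ 2 = L ^ c * s ^ 2 := by
    rw [e2]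
    linear_combination s ^ 2 * e4
  rw [e5, e6, abs_mul, abs_of_pos (Real.rpow_pos_of_pos hL c)]
  gcongr
  rw [abs_le]
  constructor <;> linarith [sq_nonneg s]

theorem not_tendsto_tsum_expChar_rpow {c : ℝ} (hc0 : 0 < c) (hc : c ≤ 1 / 2) {C m : ℝ} (hC : 0 < C)
    (hm : 0 < m) {Q : ℝ → ℕ → ℝ} (hQ : ∀ U : ℝ, 1 ≤ U → SelbergBound C U (Q U))
    (hQm : ∀ U : ℝ, 1 ≤ U → m ≤ ∑' k, Q U k) :
    ¬Tendsto (fun U => ∑' k : ℕ, expChar ((k : ℝ) ^ c) * (Q U k : ℂ)) atTop (nhds 0) := by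
  intro htend
  set m' := m / 2 * Real.exp (-(2 * Real.pi ^ 2 * c ^ 2)) with hm'
  have hm'0 : 0 < m' := by positivity
  obtain ⟨A, hA0, hA⟩ : ∃ A : ℝ, 0 ≤ A ∧ 12 * C * Real.exp (-A) < m' / 4 := by
    have h1 : Tendsto (fun A : ℝ => 12 * C * Real.exp (-A)) atTop (nhds (12 * C * 0)) :=
      Real.tendsto_exp_neg_atTop_nhds_zero.const_mul _
    rw [mul_zero] at h1
    exact ((eventually_ge_atTop 0).and
      (h1.eventually (gt_mem_nhds (show 0 < m' / 4 by positivity)))).exists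
  have hlogT : Tendsto Real.log atTop atTop := Real.tendsto_log_atTop
  have hsqrtT : Tendsto (fun U => √(Real.log U)) atTop atTop := Real.tendsto_sqrt_atTop.comp hlogT
  have hpow : Tendsto (fun U => Real.log U ^ (c - 1)) atTop (nhds 0) := by
    have := (tendsto_rpow_neg_atTop (show 0 < 1 - c by linarith)).comp hlogT
    simpa only [neg_sub, Function.comp_def] using this
  have hs1 := hpow.const_mul (2 * Real.pi * c)
  have hs2 := hpow.const_mul (4 * C * (2 * Real.pi * c))
  have hs3 := hpow.const_mul (2 * Real.pi * A ^ 2 * C)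
  rw [mul_zero] at hs1 hs2 hs3
  have ht0 : ∀ᶠ U in atTop, ‖∑' k : ℕ, expChar ((k : ℝ) ^ c) * (Q U k : ℂ)‖ < m' / 2 := by
    simpa only [dist_zero_right] using
      (Metric.tendsto_nhds.mp htend) (m' / 2) (by positivity)
  obtain ⟨U, hU, hL, hsA, h1, h2, h3, h0⟩ := ((eventually_ge_atTop (1 : ℝ)).and
    ((hlogT.eventually (eventually_ge_atTop 16)).and
    ((hsqrtT.eventually (eventually_ge_atTop (2 * A))).and
    ((hs1.eventually (gt_mem_nhds (show (0 : ℝ) < 1 / 2 by norm_num))).and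
    ((hs2.eventually (gt_mem_nhds (half_pos hm))).and
    ((hs3.eventually (gt_mem_nhds (show 0 < m' / 4 by positivity))).and ht0)))))).exists
  have hU0 : 0 < U := by linarith
  set L := Real.log U with hLdef
  have hL0 : 0 < L := by linarith
  have hss : √L * √L = L := Real.mul_self_sqrt hL0.le
  have hs0 : 0 < √L := Real.sqrt_pos.mpr hL0
  have hB := hQ U hU
  set β := c * L ^ (c - 1) with hβ
  have hβ0 : 0 < β := by positivity
  set z := expChar β with hz
  have hz1 : ‖z - 1‖ ≤ 2 * Real.pi * β := by
    have := norm_expChar_sub_one_le β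
    rwa [abs_of_pos hβ0] at this
  have hzm : ‖z - 1‖ < 1 / 2 := by
    refine hz1.trans_lt ?_
    rw [hβ]
    linarith
  set S := ∑' k, z ^ k * (Q U k : ℂ) with hS
  have hSlow : m' ≤ ‖S‖ := by
    have hg := hB.norm_rpow_mul_tsum_sub_le hU hzm
    rw [← hS] at hg
    have hMm := hQm U hU
    have hn : ‖((∑' k, Q U k : ℝ) : ℂ)‖ = ∑' k, Q U k :=
      Complex.norm_of_nonneg (hm.le.trans hMm)
    have hn2 := norm_sub_norm_le ((∑' k, Q U k : ℝ) : ℂ) ((U : ℂ) ^ (1 - z) * S)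
    rw [norm_sub_rev, hn, norm_mul, Complex.norm_cpow_eq_rpow_re_of_pos hU0] at hn2
    have hre : (1 - z).re = 1 - Real.cos (2 * Real.pi * β) := by
      rw [Complex.sub_re, Complex.one_re, hz, expChar, mul_comm Complex.I,
        Complex.exp_ofReal_mul_I_re]
    have hcos := Real.one_sub_sq_div_two_le_cos (x := 2 * Real.pi * β)
    have hUle : U ^ (1 - z).re ≤ Real.exp (2 * Real.pi ^ 2 * c ^ 2) := by
      rw [Real.rpow_def_of_pos hU0, Real.exp_le_exp, hre]
      have hLβ : L * β ^ 2 ≤ c ^ 2 := by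
        have e1 : L * β ^ 2 = c ^ 2 * L ^ (2 * c - 1) := by
          rw [hβ, mul_pow, ← Real.rpow_natCast (L ^ (c - 1)), ← Real.rpow_mul hL0.le,
            mul_left_comm]
          congr 1
          rw [mul_comm, ← Real.rpow_add_one hL0.ne']
          congr 1
          push_cast
          ring
        rw [e1]
        refine mul_le_of_le_one_right (sq_nonneg c) ?_
        exact Real.rpow_le_one_of_one_le_of_nonpos (by linarith) (by linarith)
      calc L * (1 - Real.cos (2 * Real.pi * β)) ≤ L * ((2 * Real.pi * β) ^ 2 / 2) := by
            gcongr
            linarith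
        _ = 2 * Real.pi ^ 2 * (L * β ^ 2) := by ring
        _ ≤ _ := by gcongr
    have h4 : m / 2 ≤ U ^ (1 - z).re * ‖S‖ := by
      have : 4 * C * ‖z - 1‖ ≤ m / 2 := by
        calc 4 * C * ‖z - 1‖ ≤ 4 * C * (2 * Real.pi * β) := by gcongr
          _ = 4 * C * (2 * Real.pi * c) * L ^ (c - 1) := by rw [hβ]; ring
          _ ≤ _ := h2.le
      linarith
    have h5 : m / 2 ≤ Real.exp (2 * Real.pi ^ 2 * c ^ 2) * ‖S‖ :=
      h4.trans (by gcongr)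
    calc m' ≤ Real.exp (2 * Real.pi ^ 2 * c ^ 2) * ‖S‖ * Real.exp (-(2 * Real.pi ^ 2 * c ^ 2)) := by
          rw [hm']; gcongr
      _ = ‖S‖ * (Real.exp (2 * Real.pi ^ 2 * c ^ 2) * Real.exp (-(2 * Real.pi ^ 2 * c ^ 2))) := by
          ring
      _ = ‖S‖ := by rw [← Real.exp_add]; simp
  set P := expChar (L ^ c - β * L) with hP
  have hPz : ∀ k : ℕ, P * z ^ k = expChar (L ^ c + β * (k - L)) := by
    intro k
    rw [hP, hz, ← expChar_nat_mul, ← expChar_add]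
    congr 1
    ring
  have hG1 : ∀ k : ℕ, ‖expChar ((k : ℝ) ^ c)‖ ≤ 1 := fun k => (norm_expChar _).le
  have hz1' : ∀ k : ℕ, ‖P * z ^ k‖ ≤ 1 := fun k => by rw [hPz]; exact (norm_expChar _).le
  have hdiff : ‖∑' k : ℕ, expChar ((k : ℝ) ^ c) * (Q U k : ℂ) - P * S‖ ≤ m' / 2 := by
    have e : P * S = ∑' k, P * z ^ k * (Q U k : ℂ) := by
      rw [hS, ← tsum_mul_left]
      exact tsum_congr fun k => by ring
    rw [e, ← (hB.norm_summable hG1).of_norm.tsum_sub (hB.norm_summable hz1').of_norm]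
    set f : ℕ → ℝ := fun k => if A * √L < |(k : ℝ) - L| then Q U k else 0 with hf
    have hf0 : ∀ k, 0 ≤ f k := fun k => by
      rw [hf]; simp only; split_ifs; exacts [hB.1 k, le_rfl]
    have hfs : Summable f := hB.summable.of_nonneg_of_le hf0 fun k => by
      rw [hf]; simp only; split_ifs; exacts [le_rfl, hB.1 k]
    set κ := 2 * Real.pi * (A ^ 2 * L ^ (c - 1)) with hκ
    have hκ0 : 0 ≤ κ := by positivity
    have hbs := (hB.summable.mul_left κ).add (hfs.mul_left 2)
    have hpt : ∀ k : ℕ, ‖expChar ((k : ℝ) ^ c) * (Q U k : ℂ) - P * z ^ k * (Q U k : ℂ)‖ ≤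
        κ * Q U k + 2 * f k := by
      intro k
      have hq := hB.1 k
      rw [← sub_mul, norm_mul, Complex.norm_of_nonneg hq]
      by_cases hk : A * √L < |(k : ℝ) - L|
      · have e1 : f k = Q U k := if_pos hk
        rw [e1]
        have e2 : ‖expChar ((k : ℝ) ^ c) - P * z ^ k‖ ≤ 2 :=
          (norm_sub_le _ _).trans (by linarith [hG1 k, hz1' k])
        nlinarith
      · have hk' := not_lt.mp hk
        have e1 : f k = 0 := if_neg hk
        rw [e1, mul_zero, add_zero]
        gcongr
        rw [hPz]
        have e2 : |(k : ℝ) - L| ≤ L / 2 := by nlinarith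
        have e3 := abs_rpow_sub_tangent_le hc0.le (by linarith) hL0 e2
        refine (norm_expChar_sub_le _ _).trans ?_
        rw [hκ]
        gcongr
        refine e3.trans ?_
        have e4 : ((k : ℝ) - L) ^ 2 ≤ A ^ 2 * L := by
          rw [← sq_abs]
          calc |(k : ℝ) - L| ^ 2 ≤ (A * √L) ^ 2 := by gcongr
            _ = A ^ 2 * L := by rw [mul_pow, sq √L, hss]
        calc L ^ (c - 2) * ((k : ℝ) - L) ^ 2 ≤ L ^ (c - 2) * (A ^ 2 * L) := by gcongr
          _ = A ^ 2 * (L ^ (c - 2) * L) := by ring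
          _ = A ^ 2 * L ^ (c - 1) := by
            rw [← Real.rpow_add_one hL0.ne']
            congr 2
            ring
    refine (tsum_of_norm_bounded hbs.hasSum hpt).trans ?_
    rw [(hB.summable.mul_left κ).tsum_add (hfs.mul_left 2), tsum_mul_left, tsum_mul_left]
    have e1 := hB.tsum_tail_le hC.le hU0 hL A
    have e2 := mul_le_mul_of_nonneg_left hB.tsum_le hκ0
    have e3 : κ * C = 2 * Real.pi * A ^ 2 * C * L ^ (c - 1) := by rw [hκ]; ring
    change ∑' k, f k ≤ _ at e1
    linarith
  have hPS : ‖P * S‖ = ‖S‖ := by rw [norm_mul, hP, norm_expChar, one_mul]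
  have := norm_sub_norm_le (P * S) (∑' k : ℕ, expChar ((k : ℝ) ^ c) * (Q U k : ℂ))
  rw [norm_sub_rev, hPS] at this
  linarith

noncomputable def partialMean (a : ℕ → ℂ) (N : ℕ) : ℂ := (N : ℂ)⁻¹ * ∑ n ∈ Icc 1 N, a n

lemma norm_partialMean_le {a : ℕ → ℂ} {B : ℝ} (hB : 0 ≤ B) (ha : ∀ n, ‖a n‖ ≤ B) (N : ℕ) :
    ‖partialMean a N‖ ≤ B := by
  rcases N.eq_zero_or_pos with rfl | hN
  · simpa [partialMean] using hB
  · have hN' : (0 : ℝ) < N := by exact_mod_cast hN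
    rw [partialMean, norm_mul, norm_inv, Complex.norm_natCast, inv_mul_le_iff₀ hN']
    refine (norm_sum_le _ _).trans ((sum_le_sum fun n _ => ha n).trans ?_)
    rw [sum_const, Nat.card_Icc, Nat.add_sub_cancel, nsmul_eq_mul]

lemma partialMean_sub (a b : ℕ → ℂ) (N : ℕ) :
    partialMean (fun n => a n - b n) N = partialMean a N - partialMean b N := by
  simp only [partialMean, sum_sub_distrib, mul_sub]

lemma tendsto_partialMean_of_tendsto_expAvg {a : ℕ → ℂ}
    (h : Tendsto (expAvg a) atTop (nhds 0)) : Tendsto (partialMean a) atTop (nhds 0) := by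
  have h1 := h.comp (Real.tendsto_log_atTop.comp tendsto_natCast_atTop_atTop)
  refine h1.congr' ?_
  filter_upwards [eventually_gt_atTop 0] with N hN
  have hN' : (0 : ℝ) < N := by exact_mod_cast hN
  simp only [Function.comp_apply, expAvg, partialMean]
  rw [Real.exp_neg, Real.exp_log hN', Nat.floor_natCast]
  push_cast
  rfl

lemma tendsto_expAvg_of_tendsto_partialMean {a : ℕ → ℂ}
    (h : Tendsto (partialMean a) atTop (nhds 0)) : Tendsto (expAvg a) atTop (nhds 0) := by
  have h1 : Tendsto (fun u : ℝ => ‖partialMean a ⌊Real.exp u⌋₊‖) atTop (nhds 0) :=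
    tendsto_zero_iff_norm_tendsto_zero.mp
      (h.comp (tendsto_nat_floor_atTop.comp Real.tendsto_exp_atTop))
  refine squeeze_zero_norm (fun u => ?_) h1
  rcases (⌊Real.exp u⌋₊).eq_zero_or_pos with h0 | hpos
  · simp [expAvg, h0]
  · have hf : (0 : ℝ) < ⌊Real.exp u⌋₊ := by exact_mod_cast hpos
    rw [expAvg, partialMean, norm_mul, norm_mul, norm_inv, Complex.norm_natCast,
      Complex.norm_of_nonneg (Real.exp_pos _).le, Real.exp_neg]
    gcongr
    exact Nat.floor_le (Real.exp_pos _).le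

lemma integral_weight_mul_expAvg_smallOmega {T U : ℝ} (hT : 0 < T) (hU : 1 ≤ U) {φ : ℕ → ℂ}
    (hφ : ∀ k, ‖φ k‖ ≤ 1) :
    ∫ u in Set.Ici 0, (weight T U u : ℂ) * expAvg (fun n => φ (smallOmega n)) u =
      ∑' k, φ k * (fiberMass T U k : ℂ) := by
  have h := hasSum_mul_mass hT (by linarith) (summable_mass hT hU)
    (a := fun n => φ (smallOmega n)) fun n => hφ _
  rw [← h.tsum_eq]
  exact (hasSum_fiberMass h.summable).tsum_eq.symm

lemma tendsto_partialMean_expChar_smallOmega {c : ℝ} (hc : 1 / 2 < c)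
    (hcZ : ¬∃ m : ℤ, c = (m : ℝ)) {h : ℝ} (hh : h ≠ 0) :
    Tendsto (partialMean fun n => expChar (h * (smallOmega n : ℝ) ^ c)) atTop (nhds 0) := by
  refine tendsto_partialMean_of_tendsto_expAvg
    (tendsto_expAvg_of_tendsto_weighted (fun n => (norm_expChar _).le) fun T hT => ?_)
  obtain ⟨C, hC, hQ⟩ := exists_selbergBound hT
  refine (tendsto_tsum_expChar_rpow hc hcZ hh hC hQ).congr' ?_
  filter_upwards [eventually_ge_atTop 1] with U hU
  exact (integral_weight_mul_expAvg_smallOmega hT hU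
    (φ := fun k => expChar (h * (k : ℝ) ^ c)) fun k => (norm_expChar _).le).symm

lemma not_tendsto_partialMean_expChar_smallOmega {c : ℝ} (hc0 : 0 < c) (hc : c ≤ 1 / 2) :
    ¬Tendsto (partialMean fun n => expChar ((smallOmega n : ℝ) ^ c)) atTop (nhds 0) := by
  intro htend
  obtain ⟨C, hC, hQ⟩ := exists_selbergBound one_pos
  obtain ⟨m, hm, hmass⟩ := exists_le_tsum_mass
  refine not_tendsto_tsum_expChar_rpow hc0 hc hC hm hQ (fun U hU => ?_) ?_
  · have hs := (hasSum_fiberMass (T := 1) (U := U) (φ := fun _ => 1)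
      (by simpa using Complex.ofRealCLM.summable (summable_mass one_pos hU))).tsum_eq
    simp only [one_mul, ← Complex.ofReal_tsum] at hs
    rw [Complex.ofReal_injective hs]
    exact hmass U hU
  · refine (tendsto_weighted_of_tendsto_expAvg (fun n => (norm_expChar _).le) one_pos
      (tendsto_expAvg_of_tendsto_partialMean htend)).congr' ?_
    filter_upwards [eventually_ge_atTop 1] with U hU
    exact integral_weight_mul_expAvg_smallOmega one_pos hU
      (φ := fun k => expChar ((k : ℝ) ^ c)) fun k => (norm_expChar _).le

lemma expChar_intCast (m : ℤ) : expChar m = 1 := by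
  rw [expChar, Complex.exp_eq_one_iff]
  exact ⟨m, by push_cast; ring⟩

lemma expChar_fract (x : ℝ) : expChar (Int.fract x) = expChar x := by
  conv_rhs => rw [← Int.floor_add_fract x, expChar_add, expChar_intCast, one_mul]

lemma fourier_coe_eq_expChar (m : ℤ) (x : ℝ) :
    fourier m (x : UnitAddCircle) = expChar (m * x) := by
  rw [fourier_coe_apply, expChar]
  congr 1
  push_cast
  ring

lemma intervalIntegral_fourier (m : ℤ) :
    ∫ t in (0 : ℝ)..1, fourier m (t : UnitAddCircle) = if m = 0 then 1 else 0 := by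
  have hp : Function.Periodic (fun t : ℝ => fourier m (t : UnitAddCircle)) 1 := fun t => by
    simp
  have h := hp.intervalIntegral_add_eq 0 (-(1 / 2))
  rw [zero_add, show (-(1 / 2) : ℝ) + 1 = 1 / 2 by norm_num] at h
  rw [h]
  simp_rw [fourier_coe_eq_expChar]
  exact SelbergBound.integral_expChar_int m

/-- Weyl's criterion, for continuous test functions on the circle. -/
lemma tendsto_partialMean_continuous {x : ℕ → ℝ}
    (hx : ∀ m : ℤ, m ≠ 0 → Tendsto (partialMean fun n => expChar (m * x n)) atTop (nhds 0))
    (f : C(UnitAddCircle, ℂ)) :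
    Tendsto (partialMean fun n => f (x n)) atTop (nhds (∫ t in (0 : ℝ)..1, f t)) := by
  have hint : ∀ g : C(UnitAddCircle, ℂ),
      IntervalIntegrable (fun t : ℝ => g (t : UnitAddCircle)) volume 0 1 := fun g =>
    (g.continuous.comp (AddCircle.continuous_mk' (1 : ℝ))).intervalIntegrable _ _
  have hspan : ∀ g ∈ Submodule.span ℂ (Set.range (@fourier (1 : ℝ))),
      Tendsto (partialMean fun n => g (x n)) atTop (nhds (∫ t in (0 : ℝ)..1, g t)) := by
    intro g hg
    induction hg using Submodule.span_induction with
    | mem g hg =>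
      obtain ⟨m, rfl⟩ := hg
      rw [intervalIntegral_fourier]
      simp_rw [fourier_coe_eq_expChar]
      split_ifs with hm
      · refine tendsto_const_nhds.congr' ?_
        filter_upwards [eventually_gt_atTop 0] with N hN
        have hN' : (N : ℂ) ≠ 0 := by exact_mod_cast hN.ne'
        simp [partialMean, hm, expChar_zero, hN']
      · exact hx m hm
    | zero =>
      refine Tendsto.congr (f₁ := fun _ => 0) (fun N => ?_) ?_
      · simp [partialMean]
      · simp
    | add g₁ g₂ _ _ h₁ h₂ =>
      have := h₁.add h₂
      rw [← intervalIntegral.integral_add (hint g₁) (hint g₂)] at this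
      refine this.congr fun N => ?_
      simp only [partialMean, ContinuousMap.add_apply, sum_add_distrib, mul_add]
    | smul r g _ h₁ =>
      have := h₁.const_mul r
      rw [← intervalIntegral.integral_const_mul] at this
      refine this.congr fun N => ?_
      simp only [partialMean, ContinuousMap.smul_apply, smul_eq_mul, ← mul_sum]
      ring
  rw [Metric.tendsto_nhds]
  intro ε hε
  have hf : f ∈ (Submodule.span ℂ (Set.range (@fourier (1 : ℝ)))).topologicalClosure := by
    rw [span_fourier_closure_eq_top]; trivial
  obtain ⟨g, hg, hfg⟩ := Metric.mem_closure_iff.mp hf (ε / 3) (by positivity)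
  have hpt : ∀ t : UnitAddCircle, ‖f t - g t‖ ≤ ε / 3 := fun t => by
    rw [dist_eq_norm] at hfg
    exact ((f - g).norm_coe_le_norm t).trans hfg.le
  filter_upwards [(Metric.tendsto_nhds.mp (hspan g hg)) (ε / 3) (by positivity)] with N hN
  rw [dist_eq_norm] at hN ⊢
  have h1 : ‖partialMean (fun n => f (x n)) N - partialMean (fun n => g (x n)) N‖ ≤ ε / 3 := by
    rw [← partialMean_sub]
    exact norm_partialMean_le (by positivity) (fun n => hpt _) N
  have h2 : ‖(∫ t in (0 : ℝ)..1, g t) - ∫ t in (0 : ℝ)..1, f t‖ ≤ ε / 3 := by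
    rw [← intervalIntegral.integral_sub (hint g) (hint f)]
    refine (intervalIntegral.norm_integral_le_of_norm_le_const (C := ε / 3) fun t _ => ?_).trans ?_
    · rw [norm_sub_rev]; exact hpt _
    · simp
  calc _ = ‖(partialMean (fun n => f (x n)) N - partialMean (fun n => g (x n)) N) +
        (partialMean (fun n => g (x n)) N - ∫ t in (0 : ℝ)..1, g t) +
        ((∫ t in (0 : ℝ)..1, g t) - ∫ t in (0 : ℝ)..1, f t)‖ := by congr 1; ring
    _ ≤ _ := norm_add₃_le
    _ < ε := by linarith

/-- The proportion of the first `N` terms whose fractional part lies in `[a, b)`. -/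
noncomputable def fractFreq (x : ℕ → ℝ) (a b : ℝ) (N : ℕ) : ℝ :=
  (((Icc 1 N).filter fun n => a ≤ Int.fract (x n) ∧ Int.fract (x n) < b).card : ℝ) / N

lemma eventually_lt_fractFreq {x : ℕ → ℝ}
    (hx : ∀ m : ℤ, m ≠ 0 → Tendsto (partialMean fun n => expChar (m * x n)) atTop (nhds 0))
    {a b ε : ℝ} (ha : 0 ≤ a) (hb : b ≤ 1) (hε : 0 < ε) :
    ∀ᶠ N in atTop, b - a - ε < fractFreq x a b N := by
  have hfreq0 : ∀ N, 0 ≤ fractFreq x a b N := fun N => by unfold fractFreq; positivity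
  rcases lt_or_ge (b - a) ε with hlt | hge
  · exact Eventually.of_forall fun N => by linarith [hfreq0 N]
  set δ := ε / 4 with hδ
  have hδ0 : 0 < δ := by positivity
  set F : ℝ → ℝ := fun t => max 0 (min 1 (min (t - a) (b - t) / δ)) with hF
  have hFc : Continuous F := by rw [hF]; fun_prop
  have hF0 : ∀ t, 0 ≤ F t := fun t => le_max_left _ _
  have hF1 : ∀ t, F t ≤ 1 := fun t => max_le zero_le_one (min_le_left _ _)
  have hFz : ∀ t, ¬(a ≤ t ∧ t < b) → F t = 0 := by
    intro t ht
    refine max_eq_left ((min_le_right _ _).trans (div_nonpos_of_nonpos_of_nonneg ?_ hδ0.le))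
    rw [not_and_or, not_le, not_lt] at ht
    rcases ht with ht | ht
    · exact (min_le_left _ _).trans (by linarith)
    · exact (min_le_right _ _).trans (by linarith)
  have hFo : ∀ t ∈ Set.Icc (a + δ) (b - δ), 1 ≤ F t := by
    intro t ht
    refine le_max_of_le_right (le_min le_rfl ?_)
    rw [le_div_iff₀ hδ0, one_mul]
    exact le_min (by linarith [ht.1]) (by linarith [ht.2])
  have hFends : F 0 = F (0 + 1) := by
    rw [hFz (0 + 1) (by rintro ⟨_, h⟩; linarith)]
    refine max_eq_left ((min_le_right _ _).trans (div_nonpos_of_nonpos_of_nonneg ?_ hδ0.le))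
    exact (min_le_left _ _).trans (by linarith)
  let f : C(UnitAddCircle, ℂ) := ⟨AddCircle.liftIco 1 0 fun t => (F t : ℂ),
    AddCircle.liftIco_continuous (by rw [hFends])
      (Complex.continuous_ofReal.comp hFc).continuousOn⟩
  have hfF : ∀ t ∈ Set.Ico (0 : ℝ) 1, f (t : UnitAddCircle) = F t := fun t ht =>
    AddCircle.liftIco_coe_apply (f := fun t => (F t : ℂ)) (a := 0) (p := 1) (by rwa [zero_add])
  have hI : ∫ t in (0 : ℝ)..1, f (t : UnitAddCircle) = ((∫ t in (0 : ℝ)..1, F t : ℝ) : ℂ) := by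
    rw [← intervalIntegral.integral_ofReal]
    refine intervalIntegral.integral_congr_ae ?_
    filter_upwards [(Set.countable_singleton (1 : ℝ)).ae_notMem volume] with t ht hmem
    rw [Set.uIoc_of_le zero_le_one] at hmem
    exact hfF t ⟨hmem.1.le, lt_of_le_of_ne hmem.2 ht⟩
  have hIlow : b - a - 2 * δ ≤ ∫ t in (0 : ℝ)..1, F t := by
    have hle : a + δ ≤ b - δ := by linarith
    calc b - a - 2 * δ = ∫ _ in (a + δ)..(b - δ), (1 : ℝ) := by
          rw [intervalIntegral.integral_const, smul_eq_mul]; ring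
      _ ≤ ∫ t in (a + δ)..(b - δ), F t :=
          intervalIntegral.integral_mono_on hle (by simp) (hFc.intervalIntegrable _ _) hFo
      _ ≤ _ := intervalIntegral.integral_mono_interval (by linarith) hle (by linarith)
          (Eventually.of_forall hF0) (hFc.intervalIntegrable _ _)
  have hlim := (Complex.continuous_re.tendsto _).comp (tendsto_partialMean_continuous hx f)
  rw [hI, Complex.ofReal_re] at hlim
  filter_upwards [hlim.eventually (lt_mem_nhds (show b - a - ε < _ by linarith))] with N hN
  refine hN.trans_le ?_
  have hval : ∀ n, f (x n : UnitAddCircle) = F (Int.fract (x n)) := by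
    intro n
    rw [← hfF _ ⟨Int.fract_nonneg _, Int.fract_lt_one _⟩]
    congr 1
    rw [← sub_eq_zero, ← AddCircle.coe_sub, Int.self_sub_fract, AddCircle.coe_eq_zero_iff]
    exact ⟨⌊x n⌋, by simp⟩
  rw [Function.comp_apply, partialMean, sum_congr rfl fun n _ => hval n, ← Complex.ofReal_sum,
    ← Complex.ofReal_natCast, ← Complex.ofReal_inv, ← Complex.ofReal_mul, Complex.ofReal_re,
    fractFreq, div_eq_inv_mul, card_filter, Nat.cast_sum]
  gcongr with n
  split_ifs with h
  · simpa using hF1 _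
  · simp [hFz _ h]

/-- Weyl's criterion. -/
theorem udMod1_of_tendsto_partialMean {x : ℕ → ℝ}
    (hx : ∀ m : ℤ, m ≠ 0 → Tendsto (partialMean fun n => expChar (m * x n)) atTop (nhds 0)) :
    udMod1 x := by
  intro a b ha hab hb
  change Tendsto (fractFreq x a b) atTop (nhds (b - a))
  rw [Metric.tendsto_nhds]
  intro ε hε
  filter_upwards [eventually_lt_fractFreq hx (b := a) le_rfl (by linarith) (half_pos hε),
    eventually_lt_fractFreq hx ha hb (half_pos hε),
    eventually_lt_fractFreq hx (a := b) (by linarith) le_rfl (half_pos hε),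
    eventually_gt_atTop 0] with N h1 h2 h3 hN
  have hN' : (0 : ℝ) < N := by exact_mod_cast hN
  have hsum : fractFreq x 0 a N + fractFreq x a b N + fractFreq x b 1 N = 1 := by
    simp only [fractFreq, ← add_div]
    rw [div_eq_one_iff_eq hN'.ne']
    simp only [card_filter, Nat.cast_sum, ← sum_add_distrib]
    rw [sum_congr rfl (g := fun _ => (1 : ℝ))]
    · simp
    · intro n _
      have e0 := Int.fract_nonneg (x n)
      have e1 := Int.fract_lt_one (x n)
      rcases lt_or_ge (Int.fract (x n)) a with h | h
      · simp [h, e0, not_le.mpr h, not_le.mpr (h.trans hab)]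
      · rcases lt_or_ge (Int.fract (x n)) b with h' | h'
        · simp [h, h', not_lt.mpr h, not_le.mpr h']
        · simp [h, h', e1, not_lt.mpr h, not_lt.mpr h']
  rw [Real.dist_eq, abs_lt]
  constructor <;> linarith

lemma tendsto_partialMean_expChar_of_udMod1 {x : ℕ → ℝ} (hx : udMod1 x) :
    Tendsto (partialMean fun n => expChar (x n)) atTop (nhds 0) := by
  rw [Metric.tendsto_nhds]
  intro ε hε
  obtain ⟨M, hM2, hM⟩ : ∃ M : ℕ, 2 ≤ M ∧ 2 * Real.pi / M < ε / 2 :=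
    ((eventually_ge_atTop 2).and
      ((tendsto_const_div_atTop_nhds_zero_nat (2 * Real.pi)).eventually
        (gt_mem_nhds (half_pos hε)))).exists
  have hM0 : (0 : ℝ) < M := by exact_mod_cast (by omega : 0 < M)
  set g : ℕ → ℕ := fun n => ⌊Int.fract (x n) * M⌋₊ with hg
  have hnn : ∀ n, 0 ≤ Int.fract (x n) * M := fun n => mul_nonneg (Int.fract_nonneg _) hM0.le
  have hgM : ∀ n, g n ∈ range M := fun n => by
    rw [mem_range, hg, Nat.floor_lt (hnn n)]
    exact mul_lt_of_lt_one_left hM0 (Int.fract_lt_one _)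
  have hgiff : ∀ n j, g n = j ↔ (j : ℝ) / M ≤ Int.fract (x n) ∧ Int.fract (x n) < (j + 1) / M := by
    intro n j
    rw [hg, Nat.floor_eq_iff (hnn n), div_le_iff₀ hM0, lt_div_iff₀ hM0]
  have happrox : ∀ n, ‖expChar (x n) - expChar ((g n : ℝ) / M)‖ ≤ 2 * Real.pi / M := by
    intro n
    obtain ⟨h1, h2⟩ := (hgiff n (g n)).mp rfl
    rw [← expChar_fract (x n)]
    refine (norm_expChar_sub_le _ _).trans ?_
    rw [div_eq_mul_one_div (2 * Real.pi)]
    gcongr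
    rw [add_div] at h2
    rw [abs_le]
    constructor <;> linarith [one_div_pos.mpr hM0]
  have hroots : ∑ j ∈ range M, expChar ((j : ℝ) / M) * ((1 / M : ℝ) : ℂ) = 0 := by
    rw [← sum_mul]
    have e : ∀ j ∈ range M, expChar ((j : ℝ) / M) = expChar (1 / M) ^ j := fun j _ => by
      rw [← expChar_nat_mul]; congr 1; ring
    rw [sum_congr rfl e]
    have hz : expChar (1 / M) - 1 ≠ 0 := by
      have h2 : (1 : ℝ) / M ≤ 1 / 2 := by
        have : (2 : ℝ) ≤ M := by exact_mod_cast hM2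
        gcongr
      have := four_mul_le_norm_expChar_sub_one (x := 1 / M) (by positivity) h2
      exact norm_pos_iff.mp (lt_of_lt_of_le (by positivity) this)
    have hgeom := geom_sum_mul (expChar (1 / M)) M
    rw [← expChar_nat_mul, mul_one_div_cancel hM0.ne',
      show (1 : ℝ) = ((1 : ℤ) : ℝ) by simp, expChar_intCast, sub_self] at hgeom
    push_cast at hgeom
    rcases mul_eq_zero.mp hgeom with h | h
    · rw [h, zero_mul]
    · exact absurd h hz
  have hstep : Tendsto (partialMean fun n => expChar ((g n : ℝ) / M)) atTop (nhds 0) := by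
    rw [← hroots]
    have hj : ∀ j ∈ range M, Tendsto (fun N => expChar ((j : ℝ) / M) *
        ((fractFreq x (j / M) ((j + 1) / M) N : ℝ) : ℂ)) atTop
        (nhds (expChar ((j : ℝ) / M) * ((1 / M : ℝ) : ℂ))) := by
      intro j hj
      refine Tendsto.const_mul _ ((Complex.continuous_ofReal.tendsto _).comp ?_)
      have hj1 : (j : ℝ) + 1 ≤ M := by exact_mod_cast mem_range.mp hj
      have := hx (j / M) ((j + 1) / M) (by positivity) (by gcongr; linarith)
        (by rw [div_le_one hM0]; exact hj1)
      rwa [← sub_div, add_sub_cancel_left] at this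
    refine (tendsto_finsetSum _ hj).congr fun N => ?_
    rw [partialMean, ← sum_fiberwise_of_maps_to (s := Icc 1 N) (g := g) (t := range M)
      (fun n _ => hgM n), mul_sum]
    refine Finset.sum_congr rfl fun j _ => ?_
    have hconst : ∀ n ∈ (Icc 1 N).filter (g · = j), expChar ((g n : ℝ) / M) =
        expChar ((j : ℝ) / M) := fun n hn => by rw [(mem_filter.mp hn).2]
    rw [sum_congr rfl hconst, sum_const, nsmul_eq_mul, fractFreq,
      filter_congr (fun n _ => hgiff n j)]
    push_cast
    ring
  filter_upwards [(Metric.tendsto_nhds.mp hstep) (ε / 2) (half_pos hε)] with N hN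
  rw [dist_zero_right] at hN ⊢
  have h1 := norm_partialMean_le (by positivity) happrox N
  rw [partialMean_sub] at h1
  have h2 := norm_sub_norm_le (partialMean (fun n => expChar (x n)) N)
    (partialMean (fun n => expChar ((g n : ℝ) / M)) N)
  linarith

lemma not_udMod1_smallOmega_rpow_natCast (k : ℕ) :
    ¬udMod1 fun n => (smallOmega n : ℝ) ^ (k : ℝ) := by
  intro h
  have h1 := h (1 / 2) 1 (by norm_num) (by norm_num) le_rfl
  have h2 : ∀ n, Int.fract ((smallOmega n : ℝ) ^ (k : ℝ)) = 0 := fun n => by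
    rw [Real.rpow_natCast, ← Nat.cast_pow, Int.fract_natCast]
  simp only [h2] at h1
  norm_num at h1

/-- for `c > 0`, the sequence `(ω(n)^c)` is uniformly distributed mod 1
iff `c > 1/2` and `c` is not an integer. -/
theorem stmt6 (c : ℝ) (hc : 0 < c) :
    udMod1 (fun n => (smallOmega n : ℝ) ^ c) ↔
      (1 / 2 < c ∧ ¬∃ m : ℤ, c = (m : ℝ)) := by
  refine ⟨fun h => ⟨?_, ?_⟩, fun ⟨h1, h2⟩ => ?_⟩
  · by_contra hle
    exact not_tendsto_partialMean_expChar_smallOmega hc (not_lt.mp hle)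
      (tendsto_partialMean_expChar_of_udMod1 h)
  · rintro ⟨m, rfl⟩
    obtain ⟨k, rfl⟩ := Int.eq_ofNat_of_zero_le (a := m) (by exact_mod_cast hc.le)
    exact not_udMod1_smallOmega_rpow_natCast k (by exact_mod_cast h)
  · exact udMod1_of_tendsto_partialMean fun m hm =>
      tendsto_partialMean_expChar_smallOmega h1 h2 (by exact_mod_cast hm)
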